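/- Let r ≥ 3 and let F be a quasi-linear, inconsistent r-graph which admits all inconsistent descriptive sequences of order r. Then the uniform Turán density of F equals C(r,2)^(−C(r,2)): there exists a locally C(r,2)^(−C(r,2))-dense sequence of F-free r-graphs, and for every ε > 0 every locally (C(r,2)^(−C(r,2))+ε)-dense sequence of r-graphs has a member containing F as a subgraph. -/

import Mathlib

namespace UTD

/-- An `r`-uniform hypergraph on a finite vertex set of naturals. -/
structure RGraph (r : ℕ) where
  verts : Finset ℕ
  edges : Finset (Finset ℕ)
  edges_subset : ∀ e ∈ edges, e ⊆ verts
  edges_card : ∀ e ∈ edges, e.card = r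

/-- `F` is a subgraph of `H`: an injection of `V(F)` into `V(H)` mapping edges to edges. -/
def IsSubgraph {r : ℕ} (F H : RGraph r) : Prop :=
  ∃ φ : ℕ → ℕ, Set.InjOn φ ↑F.verts ∧ (∀ v ∈ F.verts, φ v ∈ H.verts) ∧
    ∀ e ∈ F.edges, e.image φ ∈ H.edges

/-- `H` is `(d, ε)`-dense: every `S ⊆ V(H)` with `|S| ≥ ε|V(H)|` spans at least
`(d - ε) * C(|S|, r)` edges. -/
def IsDense {r : ℕ} (H : RGraph r) (d ε : ℝ) : Prop :=
  ∀ S ⊆ H.verts, ε * H.verts.card ≤ S.card →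
    (d - ε) * (S.card.choose r : ℝ) ≤ ((H.edges.filter (fun e => e ⊆ S)).card : ℝ)

/-- A sequence of `r`-graphs is locally `d`-dense. -/
def LocallyDense {r : ℕ} (H : ℕ → RGraph r) (d : ℝ) : Prop :=
  ∃ ε : ℕ → ℝ, (∀ n, 0 < ε n) ∧
    Filter.Tendsto ε Filter.atTop (nhds 0) ∧
    Filter.Tendsto (fun n => (H n).verts.card) Filter.atTop Filter.atTop ∧
    ∀ n, IsDense (H n) d (ε n)

/-- The role (set of ranks, 1-indexed) that the elements of `p` play within the
set `e`, with respect to the order given by `ord`. -/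
def role (ord : ℕ → ℕ) (e p : Finset ℕ) : Finset ℕ :=
  p.image (fun v => (e.filter (fun w => ord w < ord v)).card + 1)

/-- Twin pair of edges: distinct edges intersecting in exactly two vertices. -/
def IsTwin {r : ℕ} (F : RGraph r) (e f : Finset ℕ) : Prop :=
  e ∈ F.edges ∧ f ∈ F.edges ∧ e ≠ f ∧ (e ∩ f).card = 2

/-- Quasi-linear: every edge `e` has a unique twin, and all other edges meet `e`
in at most one vertex. -/
def QuasiLinear {r : ℕ} (F : RGraph r) : Prop :=
  ∀ e ∈ F.edges, ∃ f ∈ F.edges, f ≠ e ∧ (e ∩ f).card = 2 ∧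
    ∀ f' ∈ F.edges, f' ≠ e → f' ≠ f → (e ∩ f').card ≤ 1

/-- `F` with the vertex order `ord` is consistently ordered. -/
def ConsistentlyOrdered {r : ℕ} (F : RGraph r) (ord : ℕ → ℕ) : Prop :=
  ∀ e f, IsTwin F e f → role ord e (e ∩ f) = role ord f (e ∩ f)

/-- `F` is consistent: some linear order of its vertices makes it consistently ordered. -/
def Consistent {r : ℕ} (F : RGraph r) : Prop :=
  ∃ ord : ℕ → ℕ, Set.InjOn ord ↑F.verts ∧ ConsistentlyOrdered F ord

/-- `p` is the head of the edge `e`: its two smallest vertices w.r.t. `ord`. -/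
def IsHead (ord : ℕ → ℕ) (e p : Finset ℕ) : Prop :=
  p ⊆ e ∧ p.card = 2 ∧ ∀ u ∈ p, ∀ w ∈ e, w ∉ p → ord u < ord w

/-- `p` is the tail of the edge `e`: its two largest vertices w.r.t. `ord`. -/
def IsTail (ord : ℕ → ℕ) (e p : Finset ℕ) : Prop :=
  p ⊆ e ∧ p.card = 2 ∧ ∀ u ∈ p, ∀ w ∈ e, w ∉ p → ord w < ord u

/-- Head-tail-mixing: for every linear order of the vertex set there are edges
`e, f` such that the head of `e` equals the tail of `f`. -/
def HeadTailMixing {r : ℕ} (F : RGraph r) : Prop :=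
  ∀ ord : ℕ → ℕ, Set.InjOn ord ↑F.verts →
    ∃ e ∈ F.edges, ∃ f ∈ F.edges, ∃ p : Finset ℕ, IsHead ord e p ∧ IsTail ord f p

inductive Letter : Type
  | X | Y | Z
  deriving DecidableEq

/-- A descriptive sequence of order `r`: `2r - 2` letters, among which `r - 2`
are `X`, `r - 2` are `Y`, and two are `Z`. -/
def IsDescSeq (r : ℕ) (σ : Fin (2 * r - 2) → Letter) : Prop :=
  (Finset.univ.filter (fun i => σ i = Letter.X)).card = r - 2 ∧
  (Finset.univ.filter (fun i => σ i = Letter.Y)).card = r - 2 ∧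
  (Finset.univ.filter (fun i => σ i = Letter.Z)).card = 2

/-- The descriptive sequence `XX…XZZYY…Y`. -/
def headTailSeq (r : ℕ) : Fin (2 * r - 2) → Letter := fun i =>
  if (i : ℕ) < r - 2 then Letter.X
  else if (i : ℕ) < r then Letter.Z
  else Letter.Y

/-- The role (set of ranks, 1-indexed) played by the positions of the two `Z`s
within the positions carrying letters different from `avoid`. -/
def seqRole (r : ℕ) (σ : Fin (2 * r - 2) → Letter) (avoid : Letter) : Finset ℕ :=
  (Finset.univ.filter (fun i => σ i = Letter.Z)).image
    (fun i => (Finset.univ.filter (fun j => σ j ≠ avoid ∧ j < i)).card + 1)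

/-- A descriptive sequence is consistent if its two `Z`s play the same role among
the `X/Z` positions as among the `Y/Z` positions. -/
def SeqConsistent (r : ℕ) (σ : Fin (2 * r - 2) → Letter) : Prop :=
  seqRole r σ Letter.Y = seqRole r σ Letter.X

def SeqInconsistent (r : ℕ) (σ : Fin (2 * r - 2) → Letter) : Prop :=
  IsDescSeq r σ ∧ ¬ SeqConsistent r σ

/-- The descriptive sequence `σ` describes the pair of edges `{e, f}` under the
vertex order `ord`. -/
def Describes (r : ℕ) (σ : Fin (2 * r - 2) → Letter) (ord : ℕ → ℕ)
    (e f : Finset ℕ) : Prop :=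
  ∃ w : Fin (2 * r - 2) → ℕ,
    (∀ i j : Fin (2 * r - 2), i < j → ord (w i) < ord (w j)) ∧
    (∀ v : ℕ, v ∈ e ∪ f ↔ ∃ i, w i = v) ∧
    (((∀ i, w i ∈ e ↔ σ i ≠ Letter.Y) ∧ (∀ i, w i ∈ f ↔ σ i ≠ Letter.X)) ∨
     ((∀ i, w i ∈ e ↔ σ i ≠ Letter.X) ∧ (∀ i, w i ∈ f ↔ σ i ≠ Letter.Y)))

/-- A quasi-linear `r`-graph admits the descriptive sequence `σ`: there is a
linear order of its vertices in which every twin pair of edges is described by `σ`. -/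
def AdmitsSeq {r : ℕ} (F : RGraph r) (σ : Fin (2 * r - 2) → Letter) : Prop :=
  ∃ ord : ℕ → ℕ, Set.InjOn ord ↑F.verts ∧
    ∀ e f, IsTwin F e f → Describes r σ ord e f

/-- Linear hypergraph: any two distinct edges intersect in at most one vertex. -/
def LinearGraph {r : ℕ} (H : RGraph r) : Prop :=
  ∀ e ∈ H.edges, ∀ f ∈ H.edges, e ≠ f → (e ∩ f).card ≤ 1

/-- Nowhere-empty sequence of `r`-graphs. -/
def NowhereEmpty {r : ℕ} (H : ℕ → RGraph r) : Prop :=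
  ∀ c : ℝ, 0 < c → ∃ n₀ : ℕ, ∀ n ≥ n₀, ∀ S : Fin r → Finset ℕ,
    (∀ i, S i ⊆ (H n).verts) →
    (∀ i j, i ≠ j → Disjoint (S i) (S j)) →
    (∀ i, c * (H n).verts.card ≤ (S i).card) →
    ∃ e ∈ (H n).edges, ∀ i, (e ∩ S i).Nonempty

/-- A `(k, r)`-reduced hypergraph. -/
structure ReducedGraph (k r : ℕ) where
  part : Fin k → Fin k → Finset ℕ
  part_symm : ∀ i j, part i j = part j i
  part_disj : ∀ i j i' j' : Fin k, i < j → i' < j' → (i, j) ≠ (i', j') →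
    Disjoint (part i j) (part i' j')
  edges : Finset (Finset ℕ)
  edges_card : ∀ e ∈ edges, e.card = r.choose 2
  edges_struct : ∀ e ∈ edges, ∃ t : Fin r → Fin k, StrictMono t ∧
    ∀ a b : Fin r, a < b → (e ∩ part (t a) (t b)).card = 1

/-- The constituent `A_{t 0, …, t (r-1)}` of a reduced hypergraph. -/
def constituent {k r : ℕ} (H : ReducedGraph k r) (t : Fin r → Fin k) :
    Finset (Finset ℕ) :=
  H.edges.filter (fun e => ∀ a b : Fin r, a < b → (e ∩ H.part (t a) (t b)).card = 1)

/-- A reduced hypergraph has density at least `d`. -/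
def HasDensity {k r : ℕ} (H : ReducedGraph k r) (d : ℝ) : Prop :=
  ∀ t : Fin r → Fin k, StrictMono t →
    d * ∏ p ∈ Finset.univ.filter (fun p : Fin r × Fin r => p.1 < p.2),
      ((H.part (t p.1) (t p.2)).card : ℝ) ≤ ((constituent H t).card : ℝ)

/-- The `(2r-2)`-tuple of indices `t` admits the descriptive sequence `σ` in the
reduced hypergraph `H`. -/
def TupleAdmits {k r : ℕ} (H : ReducedGraph k r) (σ : Fin (2 * r - 2) → Letter)
    (t : Fin (2 * r - 2) → Fin k) : Prop :=
  ∃ tx ty : Fin r → Fin k, StrictMono tx ∧ StrictMono ty ∧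
    Set.range tx = t '' {i | σ i ≠ Letter.Y} ∧
    Set.range ty = t '' {i | σ i ≠ Letter.X} ∧
    ∃ eX ∈ constituent H tx, ∃ eY ∈ constituent H ty, (eX ∩ eY).card = 1

/-- The uniform Turán density threshold `C(r,2)^(-C(r,2))`. -/
noncomputable def piR (r : ℕ) : ℝ := ((r.choose 2 : ℝ) ^ (r.choose 2))⁻¹


section P1
open scoped Classical
variable {ι : Type} [Fintype ι] [DecidableEq ι]

noncomputable def cnt (R : ℕ → ℕ → Prop) (X Y : Finset ℕ) : ℝ :=
  (((X ×ˢ Y).filter fun p => R p.1 p.2).card : ℝ)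

def Sub (c : ℝ) (A V : ι → Finset ℕ) : Prop :=
  ∀ i, A i ⊆ V i ∧ c * ((V i).card : ℝ) ≤ ((A i).card : ℝ)

noncomputable def vol (A : ι → Finset ℕ) : ℝ := ∏ i, ((A i).card : ℝ)

structure PD (ι : Type) [Fintype ι] where
  i : ι
  j : ι
  D : (ι → Finset ℕ) → ℝ → ℕ → ℕ → Prop
  mono : ∀ c A V η a b, 0 < c → 0 ≤ η → Sub c A V → D A η a b →
    D V (η * c ^ (Fintype.card ι)) a b
  anti : ∀ A η η' a b, η ≤ η' → D A η' a b → D A η a b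

def Stuff (P : PD ι) (W : ι → Finset ℕ) (α δ ξ η : ℝ) (G : ℕ → ℕ → Prop) (m : ℝ) : Prop :=
  0 ≤ m ∧
  (∀ a b, P.D W ξ a b → G a b) ∧
  cnt G (W P.i) (W P.j) ≤ (m + δ) * ((W P.i).card * (W P.j).card) ∧
  ∀ A, Sub α A W →
    m * ((A P.i).card * (A P.j).card) ≤ cnt (fun a b => P.D A η a b ∧ G a b) (A P.i) (A P.j)

lemma cnt_nonneg (R X Y) : 0 ≤ cnt R X Y := by unfold cnt; positivity

lemma cnt_le (R X Y) : cnt R X Y ≤ X.card * Y.card := by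
  unfold cnt
  rw [← Nat.cast_mul, ← Finset.card_product]
  exact_mod_cast Finset.card_filter_le _ _

lemma cnt_mono {R R' : ℕ → ℕ → Prop} {X X' Y Y' : Finset ℕ} (hX : X ⊆ X') (hY : Y ⊆ Y')
    (h : ∀ a ∈ X, ∀ b ∈ Y, R a b → R' a b) : cnt R X Y ≤ cnt R' X' Y' := by
  unfold cnt
  norm_cast
  apply Finset.card_le_card
  intro p hp
  simp only [Finset.mem_filter, Finset.mem_product] at hp ⊢
  exact ⟨⟨hX hp.1.1, hY hp.1.2⟩, h _ hp.1.1 _ hp.1.2 hp.2⟩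

lemma cnt_split_left (R : ℕ → ℕ → Prop) {X X' : Finset ℕ} (Y : Finset ℕ) (hX : X ⊆ X') :
    cnt R X' Y = cnt R X Y + cnt R (X' \ X) Y := by
  unfold cnt
  norm_cast
  rw [← Finset.card_union_of_disjoint]
  · congr 1
    ext p
    simp only [Finset.mem_filter, Finset.mem_product, Finset.mem_union, Finset.mem_sdiff]
    have := @hX p.1
    tauto
  · rw [Finset.disjoint_left]
    intro p
    simp only [Finset.mem_filter, Finset.mem_product, Finset.mem_sdiff]
    tauto

lemma cnt_split_right (R : ℕ → ℕ → Prop) (X : Finset ℕ) {Y Y' : Finset ℕ} (hY : Y ⊆ Y') :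
    cnt R X Y' = cnt R X Y + cnt R X (Y' \ Y) := by
  unfold cnt
  norm_cast
  rw [← Finset.card_union_of_disjoint]
  · congr 1
    ext p
    simp only [Finset.mem_filter, Finset.mem_product, Finset.mem_union, Finset.mem_sdiff]
    have := @hY p.2
    tauto
  · rw [Finset.disjoint_left]
    intro p
    simp only [Finset.mem_filter, Finset.mem_product, Finset.mem_sdiff]
    tauto

lemma Sub.refl {c : ℝ} (hc : c ≤ 1) (V : ι → Finset ℕ) : Sub c V V := fun i =>
  ⟨subset_rfl, by nlinarith [Nat.cast_nonneg (α := ℝ) (V i).card]⟩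

lemma Sub.trans {c d : ℝ} {A B V : ι → Finset ℕ} (hc : 0 ≤ c) (h : Sub c A B) (h' : Sub d B V) :
    Sub (c * d) A V := fun i =>
  ⟨(h i).1.trans (h' i).1, by
    have := mul_le_mul_of_nonneg_left (h' i).2 hc
    linarith [(h i).2]⟩

lemma Sub.weaken {c d : ℝ} {A V : ι → Finset ℕ} (hcd : d ≤ c) (h : Sub c A V) : Sub d A V :=
  fun i => ⟨(h i).1, le_trans (by gcongr) (h i).2⟩

lemma Sub.vol {c : ℝ} {A V : ι → Finset ℕ} (hc : 0 ≤ c) (h : Sub c A V) :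
    c ^ (Fintype.card ι) * vol V ≤ vol A := by
  unfold UTD.vol
  rw [← Finset.card_univ, ← Finset.prod_const, ← Finset.prod_mul_distrib]
  apply Finset.prod_le_prod
  · intros; positivity
  · intro i _; exact (h i).2

lemma single_aux (α δ ξ : ℝ) (hα : 0 < α) (hα1 : α ≤ 1) (hδ : 0 < δ) (hξ : 0 < ξ) (P : PD ι)
    (N n : ℕ) (hn : n ≤ N) (V : ι → Finset ℕ)
    (hV : cnt (P.D V (ξ * (α ^ (Fintype.card ι)) ^ n)) (V P.i) (V P.j) ≤
      n * δ * ((V P.i).card * (V P.j).card)) :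
    ∃ W, Sub (α ^ n) W V ∧ ∃ G m, Stuff P W α δ ξ (ξ * (α ^ (Fintype.card ι)) ^ N) G m := by
  set q := α ^ (Fintype.card ι) with hq
  have hq0 : 0 < q := by positivity
  have hq1 : q ≤ 1 := pow_le_one₀ hα.le hα1
  induction n generalizing V with
  | zero =>
    refine ⟨V, by simpa using Sub.refl le_rfl V, P.D V ξ, 0, le_rfl, fun a b h => h, ?_, ?_⟩
    · simp only [pow_zero, mul_one, Nat.cast_zero, zero_mul] at hV
      refine hV.trans ?_
      positivity
    · intro A _
      simp only [zero_mul]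
      exact cnt_nonneg _ _ _
  | succ n ih =>
    set f := cnt (P.D V (ξ * q ^ (n + 1))) (V P.i) (V P.j)
    set vv : ℝ := ((V P.i).card * (V P.j).card) with hvv
    have hvv0 : 0 ≤ vv := by positivity
    by_cases hA : ∀ A, Sub α A V → (f / vv - δ) * ((A P.i).card * (A P.j).card) ≤
        cnt (P.D A (ξ * q ^ n)) (A P.i) (A P.j)
    · refine ⟨V, Sub.refl (pow_le_one₀ hα.le hα1) V, P.D V (ξ * q ^ (n+1)), max (f / vv - δ) 0,
        le_max_right _ _, ?_, ?_, ?_⟩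
      · intro a b
        apply P.anti
        have : q ^ (n+1) ≤ 1 := pow_le_one₀ hq0.le hq1
        nlinarith
      · rcases eq_or_lt_of_le hvv0 with h0 | h0
        · have := cnt_le (P.D V (ξ * q ^ (n + 1))) (V P.i) (V P.j)
          rw [← hvv, ← h0] at this ⊢
          simpa using this
        · calc f = (f / vv - δ + δ) * vv := by field_simp; ring
            _ ≤ _ := by gcongr; exact le_max_left _ _
      · intro A hAV
        rw [max_mul_of_nonneg _ _ (by positivity)]
        apply max_le
        · refine (hA A hAV).trans ?_
          apply cnt_mono subset_rfl subset_rfl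
          intro a _ b _ h
          refine ⟨P.anti _ _ _ _ _ ?_ h, ?_⟩
          · gcongr ?_ * ?_
            exact pow_le_pow_of_le_one hq0.le hq1 (by omega)
          · have := P.mono α A V _ a b hα (by positivity) hAV h
            rwa [mul_assoc, ← hq, ← pow_succ] at this
        · rw [zero_mul]; exact cnt_nonneg _ _ _
    · push Not at hA
      obtain ⟨A, hAV, hlt⟩ := hA
      obtain ⟨W, hW, G, m, hS⟩ := ih (by omega) A (by
        refine hlt.le.trans ?_
        gcongr
        rw [sub_le_iff_le_add]
        rcases eq_or_lt_of_le hvv0 with h0 | h0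
        · rw [← h0, div_zero]; positivity
        · rw [div_le_iff₀ h0]
          refine hV.trans (le_of_eq ?_)
          push_cast; ring)
      refine ⟨W, ?_, G, m, hS⟩
      rw [pow_succ]
      exact hW.trans (by positivity) hAV

lemma single (ι : Type) [Fintype ι] [DecidableEq ι] (α δ ξ : ℝ) (hα : 0 < α) (hα1 : α ≤ 1)
    (hδ : 0 < δ) (hξ : 0 < ξ) :
    ∃ c η : ℝ, 0 < c ∧ c ≤ 1 ∧ 0 < η ∧ ∀ (P : PD ι) (V : ι → Finset ℕ),
      ∃ W, Sub c W V ∧ ∃ G m, Stuff P W α δ ξ η G m := by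
  obtain ⟨N, hN⟩ := exists_nat_ge (1 / δ)
  refine ⟨α ^ N, ξ * (α ^ (Fintype.card ι)) ^ N, by positivity, pow_le_one₀ hα.le hα1,
    by positivity, fun P V => ?_⟩
  apply single_aux α δ ξ hα hα1 hδ hξ P N N le_rfl V
  refine (cnt_le _ _ _).trans ?_
  rw [div_le_iff₀ hδ] at hN
  apply le_mul_of_one_le_left (by positivity) hN

lemma Stuff.m_le_one {P : PD ι} {W : ι → Finset ℕ} {α δ ξ η m : ℝ} {G}
    (h : Stuff P W α δ ξ η G m) (hα1 : α ≤ 1) (hne : ∀ i, (W i).Nonempty) : m ≤ 1 := by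
  have h1 := (h.2.2.2 W (Sub.refl hα1 W)).trans (cnt_le _ _ _)
  have hp : (0:ℝ) < (W P.i).card * (W P.j).card := by
    have := (hne P.i).card_pos
    have := (hne P.j).card_pos
    positivity
  by_contra hc
  push Not at hc
  nlinarith

/-- `G` is dense on all rectangles up to an additive error. -/
lemma Stuff.lower {P : PD ι} {W : ι → Finset ℕ} {α δ ξ η m : ℝ} {G} (hij : P.i ≠ P.j)
    (h : Stuff P W α δ ξ η G m) (hα : 0 < α) (hα1 : α ≤ 1) (hne : ∀ i, (W i).Nonempty)
    {X Y : Finset ℕ} (hX : X ⊆ W P.i) (hY : Y ⊆ W P.j) :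
    m * (X.card * Y.card) - α * ((W P.i).card * (W P.j).card) ≤ cnt G X Y := by
  have hm := h.m_le_one hα1 hne
  have hm0 := h.1
  have hXc : (X.card : ℝ) ≤ (W P.i).card := by exact_mod_cast Finset.card_le_card hX
  have hYc : (Y.card : ℝ) ≤ (W P.j).card := by exact_mod_cast Finset.card_le_card hY
  by_cases h1 : α * (W P.i).card ≤ X.card
  · by_cases h2 : α * (W P.j).card ≤ Y.card
    · let A : ι → Finset ℕ := Function.update (Function.update W P.i X) P.j Y
      have hA : Sub α A W := by
        intro u
        by_cases hu : u = P.j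
        · subst hu; simpa [A] using ⟨hY, h2⟩
        · by_cases hu' : u = P.i
          · subst hu'; simpa [A, hu] using ⟨hX, h1⟩
          · simp only [A, Function.update_of_ne hu, Function.update_of_ne hu']
            exact Sub.refl hα1 W u
      have := h.2.2.2 A hA
      have e1 : A P.i = X := by simp [A, hij]
      have e2 : A P.j = Y := by simp [A]
      rw [e1, e2] at this
      have h3 : cnt (fun a b => P.D A η a b ∧ G a b) X Y ≤ cnt G X Y :=
        cnt_mono subset_rfl subset_rfl (fun _ _ _ _ h => h.2)
      have : 0 ≤ α * ((W P.i).card * (W P.j).card : ℝ) := by positivity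
      linarith
    · push Not at h2
      have := cnt_nonneg G X Y
      have h3 : (X.card * Y.card : ℝ) ≤ (W P.i).card * (α * (W P.j).card) := by gcongr
      have h4 : (0:ℝ) ≤ X.card * Y.card := by positivity
      nlinarith
  · push Not at h1
    have := cnt_nonneg G X Y
    have h3 : (X.card * Y.card : ℝ) ≤ (α * (W P.i).card) * (W P.j).card := by gcongr
    have h4 : (0:ℝ) ≤ X.card * Y.card := by positivity
    nlinarith

lemma Stuff.upper {P : PD ι} {W : ι → Finset ℕ} {α δ ξ η m : ℝ} {G} (hij : P.i ≠ P.j)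
    (h : Stuff P W α δ ξ η G m) (hα : 0 < α) (hα1 : α ≤ 1) (hne : ∀ i, (W i).Nonempty)
    {X Y : Finset ℕ} (hX : X ⊆ W P.i) (hY : Y ⊆ W P.j) :
    cnt G X Y ≤ m * (X.card * Y.card) + (δ + 2 * α) * ((W P.i).card * (W P.j).card) := by
  have h1 := h.lower hij hα hα1 hne (X := W P.i \ X) (Y := W P.j) Finset.sdiff_subset subset_rfl
  have h2 := h.lower hij hα hα1 hne (X := X) (Y := W P.j \ Y) hX Finset.sdiff_subset
  have h3 := h.2.2.1
  rw [cnt_split_left G (W P.j) hX, cnt_split_right G X hY] at h3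
  rw [Finset.card_sdiff_of_subset hX, Nat.cast_sub (Finset.card_le_card hX)] at h1
  rw [Finset.card_sdiff_of_subset hY, Nat.cast_sub (Finset.card_le_card hY)] at h2
  linarith

lemma Stuff.heredity {P : PD ι} {V W : ι → Finset ℕ} {α δ ξ η m c α' δ' ξ' : ℝ} {G}
    (hij : P.i ≠ P.j)
    (h : Stuff P V α' δ' ξ' η G m) (hα : 0 < α) (hα' : 0 < α') (hα1 : α' ≤ 1)
    (hne : ∀ i, (V i).Nonempty) (hc : 0 < c) (hξ : 0 ≤ ξ)
    (hW : Sub c W V) (h1 : α' ≤ α * c) (h2 : δ' + 2 * α' ≤ δ * c ^ 2)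
    (h3 : ξ' ≤ ξ * c ^ (Fintype.card ι)) (hδ : 0 ≤ δ) :
    Stuff P W α δ ξ η G m := by
  refine ⟨h.1, fun a b hab => h.2.1 a b (P.anti _ _ _ _ _ h3 (P.mono c W V _ a b hc hξ hW hab)),
    ?_, fun A hA => h.2.2.2 A ((hA.trans hα.le hW).weaken h1)⟩
  refine (h.upper hij hα' hα1 hne (hW P.i).1 (hW P.j).1).trans ?_
  have hi := (hW P.i).2
  have hj := (hW P.j).2
  have : c ^ 2 * (((V P.i).card : ℝ) * (V P.j).card) ≤ (W P.i).card * (W P.j).card := by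
    calc _ = (c * (V P.i).card) * (c * (V P.j).card) := by ring
      _ ≤ _ := by gcongr
  have h4 : (δ' + 2 * α') * (((V P.i).card : ℝ) * (V P.j).card) ≤
      δ * c ^ 2 * (((V P.i).card : ℝ) * (V P.j).card) := by gcongr
  have := mul_le_mul_of_nonneg_left this hδ
  nlinarith

/-- From every nonempty box one can pass to a `c`-subbox with property `Q`. -/
def Reach (ι : Type) (c : ℝ) (Q : Finset (Finset ℕ) → (ι → Finset ℕ) → Prop) : Prop :=
  ∀ H V, (∀ i, (V i).Nonempty) → ∃ W, Sub c W V ∧ Q H W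

lemma Sub.nonempty {c : ℝ} {A V : ι → Finset ℕ} (hc : 0 < c) (h : Sub c A V)
    (hV : ∀ i, (V i).Nonempty) (i : ι) : (A i).Nonempty := by
  rw [← Finset.card_pos]
  have h1 := (h i).2
  have h2 := (hV i).card_pos
  have : (0:ℝ) < (A i).card := lt_of_lt_of_le (by positivity) h1
  exact_mod_cast this

lemma compose_one {c : ℝ} {Q} (hc : 0 < c) (hc1 : c ≤ 1) (hQ : Reach ι c Q)
    (α δ ξ : ℝ) (hα : 0 < α) (hδ : 0 < δ) (hξ : 0 < ξ) :
    ∃ c' η : ℝ, 0 < c' ∧ c' ≤ 1 ∧ 0 < η ∧ ∀ P : Finset (Finset ℕ) → PD ι, (∀ H, (P H).i ≠ (P H).j) →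
      Reach ι c' (fun H W => Q H W ∧ ∃ G m, Stuff (P H) W α δ ξ η G m) := by
  obtain ⟨c1, η, h1, h1', h2, h3⟩ := single ι (min 1 (min (α * c) (δ * c ^ 2 / 4))) (δ * c ^ 2 / 2)
    (ξ * c ^ (Fintype.card ι)) (by positivity) (min_le_left _ _) (by positivity) (by positivity)
  refine ⟨c * c1, η, by positivity, by nlinarith, h2, fun P hP H V hV => ?_⟩
  obtain ⟨W1, hW1, G, m, hS⟩ := h3 (P H) V
  have hne := hW1.nonempty h1 hV
  obtain ⟨W, hW, hQW⟩ := hQ H W1 hne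
  refine ⟨W, hW.trans hc.le hW1, hQW, G, m, ?_⟩
  have e1 : min 1 (min (α * c) (δ * c ^ 2 / 4)) ≤ α * c := (min_le_right _ _).trans (min_le_left _ _)
  have e2 : min 1 (min (α * c) (δ * c ^ 2 / 4)) ≤ δ * c ^ 2 / 4 :=
    (min_le_right _ _).trans (min_le_right _ _)
  exact hS.heredity (hP H) hα (by positivity) (min_le_left _ _) hne hc hξ.le hW e1
    (by linarith) le_rfl hδ.le

lemma Stuff.eta_mono {P : PD ι} {W : ι → Finset ℕ} {α δ ξ η η' m : ℝ} {G}
    (h : Stuff P W α δ ξ η G m) (hη : η' ≤ η) : Stuff P W α δ ξ η' G m :=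
  ⟨h.1, h.2.1, h.2.2.1, fun A hA => (h.2.2.2 A hA).trans
    (cnt_mono subset_rfl subset_rfl fun _ _ _ _ hh => ⟨P.anti _ _ _ _ _ hη hh.1, hh.2⟩)⟩

lemma compose {κ : Type} [DecidableEq κ] (s : Finset κ) {c : ℝ} {Q} (hc : 0 < c) (hc1 : c ≤ 1)
    (hQ : Reach ι c Q) (α δ ξ : ℝ) (hα : 0 < α) (hδ : 0 < δ) (hξ : 0 < ξ)
    (P : κ → Finset (Finset ℕ) → PD ι) (hP : ∀ x ∈ s, ∀ H, (P x H).i ≠ (P x H).j) :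
    ∃ c' η : ℝ, 0 < c' ∧ c' ≤ 1 ∧ 0 < η ∧
      Reach ι c' (fun H W => Q H W ∧ ∀ x ∈ s, ∃ G m, Stuff (P x H) W α δ ξ η G m) := by
  induction s using Finset.induction_on with
  | empty => exact ⟨c, 1, hc, hc1, one_pos, by simpa using hQ⟩
  | insert a s ha ih =>
    obtain ⟨c1, η1, h1, h1', h2, h3⟩ := ih (fun x hx => hP x (Finset.mem_insert_of_mem hx))
    obtain ⟨c2, η2, h4, h4', h5, h6⟩ := compose_one h1 h1' h3 α δ ξ hα hδ hξ
    refine ⟨c2, min η1 η2, h4, h4', by positivity, ?_⟩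
    intro H V hV
    obtain ⟨W, hW, ⟨hQ, hs⟩, G, m, hG⟩ := h6 (P a) (hP a (Finset.mem_insert_self _ _)) H V hV
    refine ⟨W, hW, hQ, fun x hx => ?_⟩
    rcases Finset.mem_insert.1 hx with rfl | hx
    · exact ⟨G, m, hG.eta_mono (min_le_right _ _)⟩
    · obtain ⟨G, m, hG⟩ := hs x hx
      exact ⟨G, m, hG.eta_mono (min_le_left _ _)⟩

end P1

section P2
open scoped Classical
set_option linter.unusedSectionVars false
variable {ι : Type} [Fintype ι] [DecidableEq ι]

noncomputable def num (W : ι → Finset ℕ) (C : (ι → ℕ) → Prop) : ℝ :=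
  (((Fintype.piFinset W).filter C).card : ℝ)

lemma num_nonneg (W : ι → Finset ℕ) (C) : 0 ≤ num W C := by unfold num; positivity

lemma num_eq_sum (W : ι → Finset ℕ) (C) :
    num W C = ∑ x ∈ Fintype.piFinset W, if C x then (1:ℝ) else 0 := by
  unfold num; rw [Finset.card_filter]; push_cast; rfl

lemma cnt_eq_sum (R X Y) : cnt R X Y = ∑ a ∈ X, ∑ b ∈ Y, if R a b then (1:ℝ) else 0 := by
  unfold cnt; rw [Finset.card_filter, Finset.sum_product]; push_cast; rfl

lemma vol_eq (W : ι → Finset ℕ) : vol W = ((Fintype.piFinset W).card : ℝ) := by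
  unfold vol; rw [Fintype.card_piFinset]; push_cast; rfl

lemma num_mono {W W' : ι → Finset ℕ} {C C' : (ι → ℕ) → Prop} (hW : ∀ i, W i ⊆ W' i)
    (h : ∀ x ∈ Fintype.piFinset W, C x → C' x) : num W C ≤ num W' C' := by
  unfold num
  norm_cast
  apply Finset.card_le_card
  intro x hx
  rw [Finset.mem_filter] at hx ⊢
  exact ⟨Fintype.piFinset_subset _ _ hW hx.1, h x hx.1 hx.2⟩

lemma num_le (W : ι → Finset ℕ) (C) : num W C ≤ vol W := by
  rw [vol_eq]; unfold num; exact_mod_cast Finset.card_filter_le _ _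

lemma vol_pos {W : ι → Finset ℕ} (h : ∀ i, (W i).Nonempty) : 0 < vol W := by
  unfold vol
  exact Finset.prod_pos fun i _ => by exact_mod_cast (h i).card_pos

lemma num_true (W : ι → Finset ℕ) : num W (fun _ => True) = vol W := by
  rw [vol_eq]; unfold num; simp

lemma resample (W : ι → Finset ℕ) (i : ι) (f : (ι → ℕ) → ℝ) :
    ∑ x ∈ Fintype.piFinset W, ∑ a ∈ W i, f (Function.update x i a) =
      (W i).card * ∑ x ∈ Fintype.piFinset W, f x := by
  have : ∑ x ∈ Fintype.piFinset W, ∑ a ∈ W i, f (Function.update x i a) =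
      ∑ x ∈ Fintype.piFinset W, ∑ a ∈ W i, f x := by
    rw [← Finset.sum_product', ← Finset.sum_product']
    refine Finset.sum_nbij' (fun p => (Function.update p.1 i p.2, p.1 i))
      (fun p => (Function.update p.1 i p.2, p.1 i)) ?_ ?_ ?_ ?_ ?_
    · rintro ⟨x, a⟩ h
      simp only [Finset.mem_product, Fintype.mem_piFinset] at h ⊢
      refine ⟨fun u => ?_, h.1 i⟩
      by_cases hu : u = i
      · subst hu; simpa using h.2
      · simpa [hu] using h.1 u
    · rintro ⟨x, a⟩ h
      simp only [Finset.mem_product, Fintype.mem_piFinset] at h ⊢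
      refine ⟨fun u => ?_, h.1 i⟩
      by_cases hu : u = i
      · subst hu; simpa using h.2
      · simpa [hu] using h.1 u
    · rintro ⟨x, a⟩ h; simp
    · rintro ⟨x, a⟩ h; simp
    · rintro ⟨x, a⟩ h; simp
  rw [this]
  simp [Finset.mul_sum]

def upd2 (x : ι → ℕ) (i j : ι) (a b : ℕ) : ι → ℕ :=
  Function.update (Function.update x i a) j b

lemma resample2 (W : ι → Finset ℕ) (i j : ι) (C : (ι → ℕ) → Prop) :
    ∑ x ∈ Fintype.piFinset W, cnt (fun a b => C (upd2 x i j a b)) (W i) (W j) =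
      (W i).card * (W j).card * num W C := by
  simp only [cnt_eq_sum, num_eq_sum, upd2]
  rw [mul_assoc, ← resample W j, ← resample W i]

lemma resample2' (W : ι → Finset ℕ) (i j : ι) (C : (ι → ℕ) → Prop) :
    ∑ a ∈ W i, ∑ b ∈ W j, num W (fun x => C (upd2 x i j a b)) =
      (W i).card * (W j).card * num W C := by
  rw [← resample2]
  simp only [cnt_eq_sum, num_eq_sum]
  rw [Finset.sum_comm (s := Fintype.piFinset W) (t := W i)]
  refine Finset.sum_congr rfl fun a _ => ?_
  rw [Finset.sum_comm]

lemma resample_pw (W : ι → Finset ℕ) (t : Finset ι) (C : (ι → ℕ) → Prop) :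
    ∑ x ∈ Fintype.piFinset W, num W (fun y => C (t.piecewise y x)) = vol W * num W C := by
  simp only [num_eq_sum]
  have : ∑ x ∈ Fintype.piFinset W, ∑ y ∈ Fintype.piFinset W,
      (if C (t.piecewise y x) then (1:ℝ) else 0) =
      ∑ x ∈ Fintype.piFinset W, ∑ y ∈ Fintype.piFinset W, (if C y then (1:ℝ) else 0) := by
    rw [← Finset.sum_product', ← Finset.sum_product']
    refine Finset.sum_nbij' (fun p => (t.piecewise p.1 p.2, t.piecewise p.2 p.1))
      (fun p => (t.piecewise p.1 p.2, t.piecewise p.2 p.1)) ?_ ?_ ?_ ?_ ?_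
    · rintro ⟨x, y⟩ h
      simp only [Finset.mem_product, Fintype.mem_piFinset, Finset.piecewise] at h ⊢
      refine ⟨fun u => ?_, fun u => ?_⟩ <;> split_ifs <;> simp [h.1 u, h.2 u]
    · rintro ⟨x, y⟩ h
      simp only [Finset.mem_product, Fintype.mem_piFinset, Finset.piecewise] at h ⊢
      refine ⟨fun u => ?_, fun u => ?_⟩ <;> split_ifs <;> simp [h.1 u, h.2 u]
    · rintro ⟨x, y⟩ h
      ext u <;> simp only [Finset.piecewise] <;> split_ifs <;> rfl
    · rintro ⟨x, y⟩ h
      ext u <;> simp only [Finset.piecewise] <;> split_ifs <;> rfl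
    · rintro ⟨x, y⟩ h; rfl
  rw [this, Finset.sum_const, vol_eq, nsmul_eq_mul]

lemma averaging {β : Type} (s : Finset β) (f h : β → ℝ) (g N q : ℝ) (hN : 0 < N) (hg : 0 ≤ g)
    (hq : 0 ≤ q)
    (hf : g * (s.card * N) ≤ ∑ x ∈ s, f x) (hfN : ∀ x ∈ s, f x ≤ N) (hh : ∀ x ∈ s, 0 ≤ h x)
    (H : ∀ x ∈ s, g / 2 * N ≤ f x → q ≤ h x) :
    g / 2 * s.card * q ≤ ∑ x ∈ s, h x := by
  set T := s.filter fun x => g / 2 * N ≤ f x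
  have h1 : ∑ x ∈ s, f x ≤ T.card * N + s.card * (g / 2 * N) := by
    rw [← Finset.sum_filter_add_sum_filter_not s (fun x => g / 2 * N ≤ f x)]
    gcongr
    · rw [← nsmul_eq_mul]
      apply Finset.sum_le_card_nsmul
      intro x hx; exact hfN x (Finset.mem_filter.1 hx).1
    · calc _ ≤ (s.filter fun x => ¬ (g / 2 * N ≤ f x)).card • (g / 2 * N) := by
            apply Finset.sum_le_card_nsmul
            intro x hx
            have := (Finset.mem_filter.1 hx).2
            push Not at this; exact this.le
        _ ≤ _ := by
          rw [nsmul_eq_mul]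
          gcongr
          exact Finset.filter_subset _ _
  have h2 : g / 2 * s.card ≤ T.card := by
    have : g / 2 * s.card * N ≤ T.card * N := by nlinarith
    exact le_of_mul_le_mul_right this hN
  calc g / 2 * s.card * q ≤ T.card * q := by gcongr
    _ ≤ ∑ x ∈ T, h x := by
      rw [← nsmul_eq_mul]
      apply Finset.card_nsmul_le_sum
      intro x hx
      exact H x (Finset.mem_filter.1 hx).1 (Finset.mem_filter.1 hx).2
    _ ≤ _ := Finset.sum_le_sum_of_subset_of_nonneg (Finset.filter_subset _ _)
      (fun x hx _ => hh x hx)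

def Eh (H : Finset (Finset ℕ)) (t : Finset ι) (x : ι → ℕ) : Prop := t.image x ∈ H

def DD (H : Finset (Finset ℕ)) (t : Finset ι) (i j : ι) (A : ι → Finset ℕ) (η : ℝ) (a b : ℕ) :
    Prop := η * vol A ≤ num A (fun y => Eh H t (upd2 y i j a b))

lemma DD_mono (H : Finset (Finset ℕ)) (t : Finset ι) (i j : ι) (c : ℝ) (A V : ι → Finset ℕ)
    (η : ℝ) (a b : ℕ) (hc : 0 < c) (hη : 0 ≤ η) (hA : Sub c A V) (h : DD H t i j A η a b) :
    DD H t i j V (η * c ^ (Fintype.card ι)) a b := by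
  unfold DD at *
  refine le_trans ?_ (h.trans (num_mono (fun u => (hA u).1) fun _ _ h => h))
  rw [mul_assoc]
  exact mul_le_mul_of_nonneg_left (hA.vol hc.le) hη

lemma DD_anti (H : Finset (Finset ℕ)) (t : Finset ι) (i j : ι) (A : ι → Finset ℕ)
    (η η' : ℝ) (a b : ℕ) (hη : η ≤ η') (h : DD H t i j A η' a b) :
    DD H t i j A η a b := by
  unfold DD at *
  refine le_trans ?_ h
  have : 0 ≤ vol A := by unfold vol; positivity
  gcongr

def PDind (t : Finset ι) (i j : ι) (H : Finset (Finset ℕ)) : PD ι where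
  i := i
  j := j
  D := DD H t i j
  mono := DD_mono H t i j
  anti := DD_anti H t i j

def PDint (t t' : Finset ι) (i j : ι) (H : Finset (Finset ℕ)) : PD ι where
  i := i
  j := j
  D := fun A η a b => DD H t i j A η a b ∧ DD H t' i j A η a b
  mono := fun c A V η a b hc hη hA h =>
    ⟨DD_mono H t i j c A V η a b hc hη hA h.1, DD_mono H t' i j c A V η a b hc hη hA h.2⟩
  anti := fun A η η' a b hη h =>
    ⟨DD_anti H t i j A η η' a b hη h.1, DD_anti H t' i j A η η' a b hη h.2⟩

/-- pair-adding step -/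
lemma pair_step (W : ι → Finset ℕ) (hW : ∀ i, (W i).Nonempty) (i j : ι) (hij : i ≠ j)
    (C : (ι → ℕ) → Prop) (G : ℕ → ℕ → Prop)
    (hC : ∀ x a b a' b', C (upd2 x i j a b') → C (upd2 x i j a' b) → C (upd2 x i j a b))
    (g μ : ℝ) (hg : 0 ≤ g) (hμ : 0 ≤ μ)
    (hG : ∀ X Y, X ⊆ W i → Y ⊆ W j → g / 2 * (W i).card ≤ X.card → g / 2 * (W j).card ≤ Y.card →
      μ * (X.card * Y.card) ≤ cnt G X Y)
    (hn : g * vol W ≤ num W C) :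
    g / 2 * (μ * (g / 2)) * vol W ≤ num W (fun x => C x ∧ G (x i) (x j)) := by
  have hNi : (0:ℝ) < (W i).card := by exact_mod_cast (hW i).card_pos
  have hNj : (0:ℝ) < (W j).card := by exact_mod_cast (hW j).card_pos
  have key := averaging (Fintype.piFinset W)
    (fun x => cnt (fun a b => C (upd2 x i j a b)) (W i) (W j))
    (fun x => cnt (fun a b => C (upd2 x i j a b) ∧ G (upd2 x i j a b i) (upd2 x i j a b j))
      (W i) (W j)) g
    ((W i).card * (W j).card) (μ * (g / 2 * ((W i).card * (W j).card))) (by positivity) hg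
    (by positivity) ?_ (fun x _ => cnt_le _ _ _) (fun x _ => cnt_nonneg _ _ _) ?_
  · rw [resample2 W i j (fun x => C x ∧ G (x i) (x j)), ← vol_eq] at key
    have : 0 < ((W i).card : ℝ) * (W j).card := by positivity
    refine le_of_mul_le_mul_left ?_ this
    linarith
  · rw [resample2, ← vol_eq]
    have : 0 < ((W i).card : ℝ) * (W j).card := by positivity
    nlinarith
  · intro x _ hx
    set X := (W i).filter fun a => ∃ b ∈ W j, C (upd2 x i j a b)
    set Y := (W j).filter fun b => ∃ a ∈ W i, C (upd2 x i j a b)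
    have hXW : X ⊆ W i := Finset.filter_subset _ _
    have hYW : Y ⊆ W j := Finset.filter_subset _ _
    have hXc : (X.card : ℝ) ≤ (W i).card := by exact_mod_cast Finset.card_le_card hXW
    have hYc : (Y.card : ℝ) ≤ (W j).card := by exact_mod_cast Finset.card_le_card hYW
    have e1 : cnt (fun a b => C (upd2 x i j a b)) (W i) (W j) ≤ X.card * Y.card := by
      refine le_trans ?_ (cnt_le (fun a b => C (upd2 x i j a b)) X Y)
      unfold cnt
      norm_cast
      apply Finset.card_le_card
      intro p hp
      simp only [Finset.mem_filter, Finset.mem_product, X, Y] at hp ⊢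
      exact ⟨⟨⟨hp.1.1, _, hp.1.2, hp.2⟩, ⟨hp.1.2, _, hp.1.1, hp.2⟩⟩, hp.2⟩
    have e2 : g / 2 * (((W i).card : ℝ) * (W j).card) ≤ X.card * Y.card := hx.trans e1
    have e3 : g / 2 * (W i).card ≤ X.card := by
      refine le_of_mul_le_mul_right ?_ hNj
      calc _ ≤ (X.card : ℝ) * Y.card := by linarith
        _ ≤ _ := by gcongr
    have e4 : g / 2 * (W j).card ≤ Y.card := by
      refine le_of_mul_le_mul_left ?_ hNi
      calc _ ≤ (X.card : ℝ) * Y.card := by linarith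
        _ ≤ _ := by gcongr
    calc _ ≤ μ * (X.card * Y.card : ℝ) := by gcongr
      _ ≤ _ := hG X Y hXW hYW e3 e4
      _ ≤ _ := by
        apply cnt_mono hXW hYW
        intro a ha b hb hab
        simp only [Finset.mem_filter, X, Y] at ha hb
        obtain ⟨_, b', _, h1⟩ := ha
        obtain ⟨_, a', _, h2⟩ := hb
        refine ⟨hC x a b a' b' h1 h2, ?_⟩
        simpa [upd2, hij] using hab

lemma Eh_congr (H : Finset (Finset ℕ)) (t : Finset ι) {x y : ι → ℕ} (h : ∀ u ∈ t, x u = y u) :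
    Eh H t x ↔ Eh H t y := by
  unfold Eh
  rw [Finset.image_congr (g := y)]
  intro u hu; exact h u hu

end P2

section P3
open scoped Classical
set_option linter.unusedSectionVars false
variable {ι : Type} [Fintype ι] [DecidableEq ι]

lemma vol_coord {A W : ι → Finset ℕ} {c : ℝ} (hA : ∀ u, A u ⊆ W u) (hW : ∀ i, (W i).Nonempty)
    (h : c * vol W ≤ vol A) (u : ι) : c * (W u).card ≤ (A u).card := by
  have hp : (0:ℝ) < ∏ v ∈ Finset.univ.erase u, ((W v).card : ℝ) :=
    Finset.prod_pos fun i _ => by exact_mod_cast (hW i).card_pos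
  refine le_of_mul_le_mul_right ?_ hp
  calc c * (W u).card * ∏ v ∈ Finset.univ.erase u, ((W v).card : ℝ) = c * vol W := by
        unfold vol; rw [← Finset.mul_prod_erase _ _ (Finset.mem_univ u)]; ring
    _ ≤ vol A := h
    _ = (A u).card * ∏ v ∈ Finset.univ.erase u, ((A v).card : ℝ) := by
        unfold vol; rw [← Finset.mul_prod_erase _ _ (Finset.mem_univ u)]
    _ ≤ _ := by
        gcongr with v _
        exact hA v

lemma upd2_mem {W : ι → Finset ℕ} {y : ι → ℕ} (hy : y ∈ Fintype.piFinset W) {i j : ι} {a b : ℕ}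
    (ha : a ∈ W i) (hb : b ∈ W j) : upd2 y i j a b ∈ Fintype.piFinset W := by
  rw [Fintype.mem_piFinset] at hy ⊢
  intro u
  unfold upd2
  by_cases h : u = j
  · subst h; simpa using hb
  · by_cases h' : u = i
    · subst h'; simpa [h] using ha
    · simpa [h, h'] using hy u

lemma pw_mem {W : ι → Finset ℕ} {x y : ι → ℕ} (hy : y ∈ Fintype.piFinset W)
    (hx : x ∈ Fintype.piFinset W) (t : Finset ι) : t.piecewise y x ∈ Fintype.piFinset W := by
  rw [Fintype.mem_piFinset] at *
  intro u
  simp only [Finset.piecewise]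
  split_ifs
  exacts [hy u, hx u]

lemma cnt_incl (B D G : ℕ → ℕ → Prop) (X Y : Finset ℕ)
    (h : ∀ a ∈ X, ∀ b ∈ Y, B a b → G a b) :
    cnt B X Y + cnt (fun a b => D a b ∧ G a b) X Y ≤ cnt (fun a b => B a b ∧ D a b) X Y + cnt G X Y := by
  simp only [cnt_eq_sum, ← Finset.sum_add_distrib]
  refine Finset.sum_le_sum fun a ha => Finset.sum_le_sum fun b hb => ?_
  have := h a ha b hb
  by_cases hB : B a b
  · have hG := this hB
    by_cases hD : D a b <;> simp [hB, hG, hD]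
  · by_cases hD : D a b <;> by_cases hG : G a b <;> simp [hB, hG, hD]

/-- edge-adding step -/
lemma edge_step (H : Finset (Finset ℕ)) (W : ι → Finset ℕ) (hW : ∀ i, (W i).Nonempty)
    (t : Finset ι) (i j : ι) (hij : i ≠ j) (hi : i ∈ t) (hj : j ∈ t)
    (C : (ι → ℕ) → Prop) (G : ℕ → ℕ → Prop)
    (hC : ∀ x y, (∀ u ∈ t, u ≠ i → u ≠ j → ∃ y', C (t.piecewise y' x) ∧ y' u = y u) →
      (∃ y', C (t.piecewise y' x) ∧ y' i = y i ∧ y' j = y j) → C (t.piecewise y x))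
    (hCG : ∀ x, C x → G (x i) (x j))
    {α δ ξ η m e : ℝ} (he : 0 ≤ e) (hη : 0 ≤ η)
    (hS : Stuff (PDind t i j H) W α δ ξ η G m) (hα : α ≤ e / 2) (hδ : δ ≤ e / 4)
    (hn : e * vol W ≤ num W C) :
    e / 2 * (e / 4 * (η * (e / 2) ^ (Fintype.card ι))) * vol W ≤
      num W (fun x => C x ∧ Eh H t x) := by
  have hNi : (0:ℝ) < (W i).card := by exact_mod_cast (hW i).card_pos
  have hNj : (0:ℝ) < (W j).card := by exact_mod_cast (hW j).card_pos
  have hv := vol_pos hW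
  have key := averaging (Fintype.piFinset W) (fun x => num W (fun y => C (t.piecewise y x)))
    (fun x => num W (fun y => C (t.piecewise y x) ∧ Eh H t (t.piecewise y x))) e (vol W)
    (e / 4 * (η * (e / 2) ^ (Fintype.card ι)) * vol W) hv he (by positivity) ?_
    (fun x _ => num_le _ _) (fun x _ => num_nonneg _ _) ?_
  · rw [resample_pw W t (fun x => C x ∧ Eh H t x), ← vol_eq] at key
    refine le_of_mul_le_mul_left ?_ hv
    linarith
  · rw [resample_pw, ← vol_eq]
    nlinarith
  · intro x hx hfx
    set A : ι → Finset ℕ := fun u => if u ∈ t ∧ u ≠ i ∧ u ≠ j then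
      (W u).filter (fun a => ∃ y' ∈ Fintype.piFinset W, C (t.piecewise y' x) ∧ y' u = a) else W u
      with hA
    have hAW : ∀ u, A u ⊆ W u := by
      intro u
      simp only [hA]
      split_ifs
      · exact Finset.filter_subset _ _
      · exact subset_rfl
    have hAi : A i = W i := by simp [hA]
    have hAj : A j = W j := by simp [hA]
    have hvA : e / 2 * vol W ≤ vol A := by
      refine hfx.trans ?_
      rw [vol_eq A]
      unfold num
      norm_cast
      apply Finset.card_le_card
      intro y hy
      rw [Finset.mem_filter] at hy
      rw [Fintype.mem_piFinset]
      have hyW := Fintype.mem_piFinset.1 hy.1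
      intro u
      simp only [hA]
      split_ifs
      · rw [Finset.mem_filter]; exact ⟨hyW u, y, hy.1, hy.2, rfl⟩
      · exact hyW u
    have hSub : Sub (e / 2) A W := fun u => ⟨hAW u, vol_coord hAW hW hvA u⟩
    set B : ℕ → ℕ → Prop := fun a b =>
      ∃ y' ∈ Fintype.piFinset W, C (t.piecewise y' x) ∧ y' i = a ∧ y' j = b with hB
    have hui : ∀ (y : ι → ℕ) a b, upd2 y i j a b i = a := by intro y a b; simp [upd2, hij]
    have huj : ∀ (y : ι → ℕ) a b, upd2 y i j a b j = b := by intro y a b; simp [upd2]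
    have hBc : e / 2 * ((W i).card * (W j).card) ≤ cnt B (W i) (W j) := by
      have h1 := resample2' W i j (fun y => C (t.piecewise y x))
      have h2 : ∑ a ∈ W i, ∑ b ∈ W j, num W (fun y => C (t.piecewise (upd2 y i j a b) x)) ≤
          cnt B (W i) (W j) * vol W := by
        rw [cnt_eq_sum, Finset.sum_mul]
        refine Finset.sum_le_sum fun a ha => ?_
        rw [Finset.sum_mul]
        refine Finset.sum_le_sum fun b hb => ?_
        split_ifs with hab
        · rw [one_mul]; exact num_le _ _
        · rw [zero_mul]
          apply le_of_eq
          unfold num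
          rw [Nat.cast_eq_zero, Finset.card_eq_zero, Finset.filter_eq_empty_iff]
          intro y hy hc
          exact hab ⟨_, upd2_mem hy ha hb, hc, hui _ _ _, huj _ _ _⟩
      rw [h1] at h2
      refine le_of_mul_le_mul_right ?_ hv
      calc _ = ((W i).card * (W j).card : ℝ) * (e / 2 * vol W) := by ring
        _ ≤ ((W i).card * (W j).card : ℝ) * num W (fun y => C (t.piecewise y x)) := by gcongr
        _ ≤ _ := h2
    have hBG : ∀ a ∈ W i, ∀ b ∈ W j, B a b → G a b := by
      rintro a _ b _ ⟨y', _, h1, rfl, rfl⟩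
      have := hCG _ h1
      simpa [hi, hj] using this
    have h3 := cnt_incl B (DD H t i j A η) G (W i) (W j) hBG
    have h4 := hS.2.2.1
    have h5 := hS.2.2.2 A (hSub.weaken hα)
    simp only [PDind] at h4 h5
    rw [hAi, hAj] at h5
    have hcnt : e / 4 * ((W i).card * (W j).card) ≤
        cnt (fun a b => B a b ∧ DD H t i j A η a b) (W i) (W j) := by
      have : δ * ((W i).card * (W j).card : ℝ) ≤ e / 4 * ((W i).card * (W j).card) := by gcongr
      linarith
    have h1 := resample2' W i j (fun y => C (t.piecewise y x) ∧ Eh H t (t.piecewise y x))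
    have h2 : cnt (fun a b => B a b ∧ DD H t i j A η a b) (W i) (W j) *
        (η * (e / 2) ^ (Fintype.card ι) * vol W) ≤
        ∑ a ∈ W i, ∑ b ∈ W j, num W (fun y => C (t.piecewise (upd2 y i j a b) x) ∧
          Eh H t (t.piecewise (upd2 y i j a b) x)) := by
      rw [cnt_eq_sum, Finset.sum_mul]
      refine Finset.sum_le_sum fun a ha => ?_
      rw [Finset.sum_mul]
      refine Finset.sum_le_sum fun b hb => ?_
      split_ifs with hab
      · rw [one_mul]
        obtain ⟨hBab, hD⟩ := hab
        unfold DD at hD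
        have h6 := hSub.vol (by positivity)
        calc _ = η * ((e / 2) ^ (Fintype.card ι) * vol W) := by ring
          _ ≤ η * vol A := by gcongr
          _ ≤ _ := hD
          _ ≤ _ := by
            apply num_mono hAW
            intro y hy hE
            rw [Fintype.mem_piFinset] at hy
            refine ⟨hC x _ ?_ ?_, ?_⟩
            · intro u hu hui' huj'
              have := hy u
              simp only [hA, if_pos (show u ∈ t ∧ u ≠ i ∧ u ≠ j from ⟨hu, hui', huj'⟩)] at this
              obtain ⟨y', _, h7, h8⟩ := (Finset.mem_filter.1 this).2
              exact ⟨y', h7, by simp [upd2, hui', huj', h8]⟩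
            · obtain ⟨y', _, h7, h8, h9⟩ := hBab
              exact ⟨y', h7, by rw [h8, hui], by rw [h9, huj]⟩
            · refine (Eh_congr H t ?_).1 hE
              intro u hu
              simp [hu]
      · rw [zero_mul]; exact num_nonneg _ _
    rw [h1] at h2
    have hpp : 0 < ((W i).card : ℝ) * (W j).card := by positivity
    refine le_of_mul_le_mul_left ?_ hpp
    refine le_trans ?_ h2
    calc _ = e / 4 * ((W i).card * (W j).card : ℝ) * (η * (e / 2) ^ (Fintype.card ι) * vol W) := by ring
      _ ≤ _ := by gcongr

end P3

section P4
open scoped Classical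
set_option linter.unusedSectionVars false
variable {ι : Type} [Fintype ι] [DecidableEq ι]

noncomputable def gseq (μ : ℝ) : ℕ → ℝ
  | 0 => 1
  | n + 1 => gseq μ n / 2 * (μ * (gseq μ n / 2))

lemma gseq_pos {μ : ℝ} (hμ : 0 < μ) (n : ℕ) : 0 < gseq μ n := by
  induction n with
  | zero => simp [gseq]
  | succ n ih => simp only [gseq]; positivity

lemma gseq_le_one {μ : ℝ} (hμ : 0 < μ) (hμ1 : μ ≤ 1) (n : ℕ) : gseq μ n ≤ 1 := by
  induction n with
  | zero => simp [gseq]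
  | succ n ih =>
    simp only [gseq]
    have := gseq_pos hμ n
    calc gseq μ n / 2 * (μ * (gseq μ n / 2)) ≤ 1 / 2 * (1 * (1 / 2)) := by gcongr
      _ ≤ 1 := by norm_num

lemma gseq_anti {μ : ℝ} (hμ : 0 < μ) (hμ1 : μ ≤ 1) : Antitone (gseq μ) := by
  apply antitone_nat_of_succ_le
  intro n
  simp only [gseq]
  have := gseq_pos hμ n
  have h1 := gseq_le_one hμ hμ1 n
  calc gseq μ n / 2 * (μ * (gseq μ n / 2)) ≤ gseq μ n / 2 * (1 * (1 / 2)) := by gcongr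
    _ ≤ _ := by linarith

lemma pair_phase (W : ι → Finset ℕ) (hW : ∀ i, (W i).Nonempty) (μ : ℝ) (hμ : 0 < μ) (hμ1 : μ ≤ 1)
    (N : ℕ) (G : ι × ι → ℕ → ℕ → Prop) (S : Finset (ι × ι)) (hN : S.card ≤ N)
    (hS : ∀ p ∈ S, p.1 ≠ p.2)
    (hS2 : ∀ p ∈ S, ∀ p' ∈ S, p ≠ p' → (p'.1 ≠ p.1 ∧ p'.1 ≠ p.2) ∨ (p'.2 ≠ p.1 ∧ p'.2 ≠ p.2))
    (hG : ∀ p ∈ S, ∀ X Y, X ⊆ W p.1 → Y ⊆ W p.2 → gseq μ N / 2 * (W p.1).card ≤ X.card →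
      gseq μ N / 2 * (W p.2).card ≤ Y.card → μ * (X.card * Y.card) ≤ cnt (G p) X Y) :
    gseq μ S.card * vol W ≤ num W (fun x => ∀ p ∈ S, G p (x p.1) (x p.2)) := by
  induction S using Finset.induction_on with
  | empty => simp [gseq, num_true]
  | insert p S hp ih =>
    rw [Finset.card_insert_of_notMem hp] at hN ⊢
    have ih := ih (by omega) (fun q hq => hS q (Finset.mem_insert_of_mem hq))
      (fun q hq q' hq' => hS2 q (Finset.mem_insert_of_mem hq) q' (Finset.mem_insert_of_mem hq'))
      (fun q hq => hG q (Finset.mem_insert_of_mem hq))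
    have hanti := gseq_anti hμ hμ1 (show S.card ≤ N by omega)
    have hp' := Finset.mem_insert_self p S
    have := pair_step W hW p.1 p.2 (hS p hp') (fun x => ∀ p ∈ S, G p (x p.1) (x p.2)) (G p) ?_
      (gseq μ S.card) μ (gseq_pos hμ _).le hμ.le ?_ ih
    · refine this.trans (num_mono (fun _ => subset_rfl) ?_)
      rintro x _ ⟨h1, h2⟩ q hq
      rcases Finset.mem_insert.1 hq with rfl | hq
      · exact h2
      · exact h1 q hq
    · intro x a b a' b' h1 h2 q hq
      have hne : p ≠ q := by rintro rfl; exact hp hq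
      have hpp := hS p hp'
      have h1 := h1 q hq
      have h2 := h2 q hq
      unfold upd2 at *
      rcases hS2 p hp' q (Finset.mem_insert_of_mem hq) hne with ⟨h3, h4⟩ | ⟨h3, h4⟩
      · rw [Function.update_of_ne h4, Function.update_of_ne h3] at *
        by_cases h5 : q.2 = p.2
        · rw [h5] at h2 ⊢; simpa using h2
        · rw [Function.update_of_ne h5] at *; exact h1
      · rw [Function.update_of_ne h4, Function.update_of_ne h3] at *
        by_cases h5 : q.1 = p.2
        · rw [h5] at h2 ⊢; simpa using h2
        · rw [Function.update_of_ne h5] at *; exact h1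
    · intro X Y hX hY h1 h2
      refine hG p hp' X Y hX hY (le_trans ?_ h1) (le_trans ?_ h2) <;> gcongr

def Rect (t : Finset ι) (i j : ι) (C : (ι → ℕ) → Prop) : Prop :=
  ∀ x y, (∀ u ∈ t, u ≠ i → u ≠ j → ∃ y', C (t.piecewise y' x) ∧ y' u = y u) →
      (∃ y', C (t.piecewise y' x) ∧ y' i = y i ∧ y' j = y j) → C (t.piecewise y x)

lemma Rect.all {κ : Type} {t : Finset ι} {i j : ι} {C : κ → (ι → ℕ) → Prop} {S : Set κ}
    (h : ∀ k ∈ S, Rect t i j (C k)) : Rect t i j (fun x => ∀ k ∈ S, C k x) := by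
  intro x y h1 h2 k hk
  refine h k hk x y (fun u hu hi hj => ?_) ?_
  · obtain ⟨y', h3, h4⟩ := h1 u hu hi hj
    exact ⟨y', h3 k hk, h4⟩
  · obtain ⟨y', h3, h4⟩ := h2
    exact ⟨y', h3 k hk, h4⟩

lemma Rect.and {t : Finset ι} {i j : ι} {C C' : (ι → ℕ) → Prop}
    (h : Rect t i j C) (h' : Rect t i j C') : Rect t i j (fun x => C x ∧ C' x) := by
  intro x y h1 h2
  constructor
  · refine h x y (fun u hu hi hj => ?_) ?_
    · obtain ⟨y', h3, h4⟩ := h1 u hu hi hj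
      exact ⟨y', h3.1, h4⟩
    · obtain ⟨y', h3, h4⟩ := h2
      exact ⟨y', h3.1, h4⟩
  · refine h' x y (fun u hu hi hj => ?_) ?_
    · obtain ⟨y', h3, h4⟩ := h1 u hu hi hj
      exact ⟨y', h3.2, h4⟩
    · obtain ⟨y', h3, h4⟩ := h2
      exact ⟨y', h3.2, h4⟩

def Compat (s t : Finset ι) (i j : ι) : Prop := (s ∩ t ⊆ {i, j}) ∨ ∃ u ∈ t, s ∩ t ⊆ {u}

lemma Rect.of_dep {s t : Finset ι} {i j : ι} {C : (ι → ℕ) → Prop}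
    (hC : ∀ x y, (∀ u ∈ s, x u = y u) → C x → C y) (hs : Compat s t i j) : Rect t i j C := by
  intro x y h1 h2
  have caseA : s ∩ t ⊆ {i, j} → C (t.piecewise y x) := by
    intro hs
    obtain ⟨y', h3, h4, h5⟩ := h2
    refine hC _ _ ?_ h3
    intro u hu
    by_cases hut : u ∈ t
    · have := hs (Finset.mem_inter.2 ⟨hu, hut⟩)
      simp only [hut, Finset.piecewise_eq_of_mem]
      rcases Finset.mem_insert.1 this with rfl | h
      · exact h4
      · rw [Finset.mem_singleton.1 h]; exact h5
    · simp [hut]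
  rcases hs with hs | ⟨u, hu, hs⟩
  · exact caseA hs
  · by_cases hui : u = i
    · exact caseA (hs.trans (by simp [hui]))
    by_cases huj : u = j
    · exact caseA (hs.trans (by simp [huj]))
    obtain ⟨y', h3, h4⟩ := h1 u hu hui huj
    refine hC _ _ ?_ h3
    intro v hv
    by_cases hvt : v ∈ t
    · have := Finset.mem_singleton.1 (hs (Finset.mem_inter.2 ⟨hv, hvt⟩))
      subst this
      simpa [hvt] using h4
    · simp [hvt]

def PhaseProp (ξ e0 : ℝ) (n : ℕ) (e : ℝ) (H : Finset (Finset ℕ)) (W : ι → Finset ℕ) : Prop :=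
  ∀ S : Finset (Finset ι × ι × ι), S.card = n →
    (∀ a ∈ S, a.2.1 ∈ a.1 ∧ a.2.2 ∈ a.1 ∧ a.2.1 ≠ a.2.2) →
    (∀ a ∈ S, ∀ b ∈ S, a ≠ b → Compat b.1 a.1 a.2.1 a.2.2) →
    ∀ C0 : (ι → ℕ) → Prop, (∀ a ∈ S, Rect a.1 a.2.1 a.2.2 C0) →
    (∀ a ∈ S, ∀ x, C0 x → DD H a.1 a.2.1 a.2.2 W ξ (x a.2.1) (x a.2.2)) →
    e0 * vol W ≤ num W C0 → e * vol W ≤ num W (fun x => C0 x ∧ ∀ a ∈ S, Eh H a.1 x)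

lemma edge_phase {c : ℝ} {Q} (hc : 0 < c) (hc1 : c ≤ 1)
    (hQ : Reach ι c Q) (ξ e0 : ℝ) (hξ : 0 < ξ) (he0 : 0 < e0) (n : ℕ) :
    ∃ c' e : ℝ, 0 < c' ∧ c' ≤ 1 ∧ 0 < e ∧
      Reach ι c' (fun H W => Q H W ∧ PhaseProp ξ e0 n e H W) := by
  induction n with
  | zero =>
    refine ⟨c, e0, hc, hc1, he0, ?_⟩
    intro H V hV
    obtain ⟨W, hW, hq⟩ := hQ H V hV
    refine ⟨W, hW, hq, ?_⟩
    intro S hS _ _ C0 _ _ h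
    rw [Finset.card_eq_zero] at hS
    subst hS
    simpa using h
  | succ n ih =>
    obtain ⟨c1, e, h1, h1', he, h2⟩ := ih
    obtain ⟨c2, η, h3, h3', hη, h4⟩ := compose
      ((Finset.univ : Finset (Finset ι × ι × ι)).filter fun a => a.2.1 ≠ a.2.2) h1 h1' h2
      (e / 2) (e / 4) ξ (by positivity) (by positivity) hξ (fun a H => PDind a.1 a.2.1 a.2.2 H)
      (fun a ha H => (Finset.mem_filter.1 ha).2)
    refine ⟨c2, e / 2 * (e / 4 * (η * (e / 2) ^ (Fintype.card ι))), h3, h3', by positivity, ?_⟩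
    intro H V hV
    obtain ⟨W, hW, ⟨hq, hP⟩, hS⟩ := h4 H V hV
    refine ⟨W, hW, hq, ?_⟩
    intro S hcard hin hcomp C0 hrect hD hnum
    obtain ⟨a, S', ha, rfl, hS'⟩ := Finset.card_eq_succ.1 hcard
    have hsub : S' ⊆ insert a S' := Finset.subset_insert _ _
    have haS := Finset.mem_insert_self a S'
    have hprev := hP S' hS' (fun b hb => hin b (hsub hb))
      (fun b hb b' hb' => hcomp b (hsub hb) b' (hsub hb')) C0 (fun b hb => hrect b (hsub hb))
      (fun b hb => hD b (hsub hb)) hnum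
    obtain ⟨hi, hj, hij⟩ := hin a haS
    obtain ⟨G, m, hG⟩ := hS a (Finset.mem_filter.2 ⟨Finset.mem_univ _, hij⟩)
    have := edge_step H W (hW.nonempty h3 hV) a.1 a.2.1 a.2.2 hij hi hj _ G ?_ ?_ he.le hη.le
      hG le_rfl le_rfl hprev
    · refine this.trans (num_mono (fun _ => subset_rfl) ?_)
      rintro x _ ⟨⟨h5, h6⟩, h7⟩
      refine ⟨h5, fun b hb => ?_⟩
      rcases Finset.mem_insert.1 hb with rfl | hb
      · exact h7
      · exact h6 b hb
    · refine Rect.and (hrect a haS) (Rect.all (S := {b | b ∈ S'}) fun b hb => ?_)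
      have hbS : b ∈ S' := hb
      refine Rect.of_dep (fun x y hxy => (Eh_congr H b.1 hxy).1) (hcomp a haS b (hsub hbS) ?_)
      rintro rfl; exact ha hbS
    · intro x hx
      exact hG.2.1 _ _ (hD a haS x hx.1)

end P4

section P5
open scoped Classical
set_option linter.unusedSectionVars false
variable {ι : Type} [Fintype ι] [DecidableEq ι]

def IndProp (α δ ξ η : ℝ) (H : Finset (Finset ℕ)) (W : ι → Finset ℕ) : Prop :=
  ∀ (t : Finset ι) (i j : ι), i ≠ j → ∃ G m, Stuff (PDind t i j H) W α δ ξ η G m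

def EmbProp (N : ℕ) (μ η : ℝ) (H : Finset (Finset ℕ)) (W : ι → Finset ℕ) : Prop :=
  ∀ S : Finset (Finset ι × ι × ι), S.card = N →
    (∀ a ∈ S, a.2.1 ∈ a.1 ∧ a.2.2 ∈ a.1 ∧ a.2.1 ≠ a.2.2) →
    (∀ a ∈ S, ∀ b ∈ S, a ≠ b → (a.2 = b.2 ∧ b.1 ∩ a.1 ⊆ {a.2.1, a.2.2}) ∨
      (b.1 ∩ a.1).card ≤ 1) →
    (∀ a ∈ S, ∃ t t' : Finset ι, (∀ b ∈ S, b.2 = a.2 → b.1 = t ∨ b.1 = t') ∧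
      2 * μ * ((W a.2.1).card * (W a.2.2).card) ≤
        cnt (fun x y => DD H t a.2.1 a.2.2 W η x y ∧ DD H t' a.2.1 a.2.2 W η x y)
          (W a.2.1) (W a.2.2)) →
    ∃ x ∈ Fintype.piFinset W, ∀ a ∈ S, Eh H a.1 x

lemma compat_of_card {s t : Finset ι} {i j : ι} (hi : i ∈ t) (h : (s ∩ t).card ≤ 1) :
    Compat s t i j := by
  right
  rcases (s ∩ t).eq_empty_or_nonempty with h0 | ⟨u, hu⟩
  · exact ⟨i, hi, by simp [h0]⟩
  · refine ⟨u, (Finset.mem_inter.1 hu).2, ?_⟩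
    intro v hv
    rw [Finset.mem_singleton]
    exact Finset.card_le_one.1 h v hv u hu

lemma master (ι : Type) [Fintype ι] [DecidableEq ι] (α δ ξ μ : ℝ) (hα : 0 < α) (hδ : 0 < δ) (hξ : 0 < ξ)
    (hμ : 0 < μ) (hμ1 : μ ≤ 1) (N : ℕ) :
    ∃ c η : ℝ, 0 < c ∧ c ≤ 1 ∧ 0 < η ∧
      Reach ι c (fun H W => IndProp α δ ξ η H W ∧ EmbProp N μ η H W) := by
  obtain ⟨c1, η, hc1, hc1', hη, h1⟩ := compose
      ((Finset.univ : Finset (Finset ι × ι × ι)).filter fun a => a.2.1 ≠ a.2.2) (c := 1)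
      (Q := fun _ _ => True) one_pos le_rfl
      (fun H V _ => ⟨V, Sub.refl le_rfl V, trivial⟩) α δ ξ hα hδ hξ
      (fun a H => PDind a.1 a.2.1 a.2.2 H) (fun a ha H => (Finset.mem_filter.1 ha).2)
  have hg := gseq_pos hμ N
  obtain ⟨c2, η2, hc2, hc2', hη2, h2⟩ := compose
      ((Finset.univ : Finset (Finset ι × Finset ι × ι × ι)).filter fun a => a.2.2.1 ≠ a.2.2.2)
      hc1 hc1' h1 (gseq μ N / 2) μ η (by positivity) hμ hη
      (fun a H => PDint a.1 a.2.1 a.2.2.1 a.2.2.2 H) (fun a ha H => (Finset.mem_filter.1 ha).2)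
  set ηs := η2 * (gseq μ N / 2) ^ (Fintype.card ι) with hηs
  obtain ⟨c3, e, hc3, hc3', he, h3⟩ := edge_phase hc2 hc2' h2 ηs (gseq μ N) (by positivity) hg N
  refine ⟨c3, η, hc3, hc3', hη, ?_⟩
  intro H V hV
  obtain ⟨W, hW, ⟨⟨-, hInd⟩, hInt⟩, hPh⟩ := h3 H V hV
  have hne := hW.nonempty hc3 hV
  refine ⟨W, hW, ?_, ?_⟩
  · intro t i j hij
    exact hInd (t, i, j) (Finset.mem_filter.2 ⟨Finset.mem_univ _, hij⟩)
  intro S hcard hin hS hpair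
  set P := S.image Prod.snd with hP
  set G : ι × ι → ℕ → ℕ → Prop := fun p x y => ∀ b ∈ S, b.2 = p → DD H b.1 p.1 p.2 W ηs x y with hG
  have hPS : ∀ p ∈ P, ∃ a ∈ S, a.2 = p := by
    intro p hp; simpa [hP] using hp
  have hp1 := pair_phase W hne μ hμ hμ1 N G P (hcard ▸ Finset.card_image_le) ?_ ?_ ?_
  · have hp2 : gseq μ N * vol W ≤ num W (fun x => ∀ p ∈ P, G p (x p.1) (x p.2)) := by
      refine le_trans ?_ hp1
      have : 0 ≤ vol W := (vol_pos hne).le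
      gcongr
      exact gseq_anti hμ hμ1 (hcard ▸ Finset.card_image_le)
    have hp3 := hPh S hcard hin ?_ _ ?_ ?_ hp2
    · have hpos : 0 < e * vol W := mul_pos he (vol_pos hne)
      have := lt_of_lt_of_le hpos hp3
      unfold num at this
      rw [Nat.cast_pos, Finset.card_pos] at this
      obtain ⟨x, hx⟩ := this
      simp only [Finset.mem_filter] at hx
      exact ⟨x, hx.1, hx.2.2⟩
    · intro a ha b hb hab
      rcases hS a ha b hb hab with h | h
      · exact Or.inl h.2
      · exact compat_of_card (hin a ha).1 h
    · intro a ha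
      refine Rect.all (S := {p | p ∈ P}) fun p hp => ?_
      obtain ⟨b, hb, rfl⟩ := hPS p hp
      refine Rect.of_dep (s := {b.2.1, b.2.2}) ?_ ?_
      · intro x y hxy
        rw [hxy b.2.1 (by simp), hxy b.2.2 (by simp)]
        exact id
      · by_cases hab : a.2 = b.2
        · left
          rw [← hab]; exact Finset.inter_subset_left
        · have hab' : a ≠ b := by rintro rfl; exact hab rfl
          rcases hS a ha b hb hab' with h | h
          · exact absurd h.1 hab
          · refine compat_of_card (hin a ha).1 (le_trans (Finset.card_le_card ?_) h)
            apply Finset.inter_subset_inter _ subset_rfl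
            intro u hu
            rcases Finset.mem_insert.1 hu with rfl | hu
            · exact (hin b hb).1
            · rw [Finset.mem_singleton.1 hu]; exact (hin b hb).2.1
    · intro a ha x hx
      exact hx a.2 (Finset.mem_image_of_mem _ ha) a ha rfl
  · intro p hp
    obtain ⟨a, ha, rfl⟩ := hPS p hp
    exact (hin a ha).2.2
  · intro p hp p' hp' hne'
    obtain ⟨a, ha, rfl⟩ := hPS p hp
    obtain ⟨b, hb, rfl⟩ := hPS p' hp'
    have hab' : a ≠ b := by rintro rfl; exact hne' rfl
    rcases hS a ha b hb hab' with h | h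
    · exact absurd h.1 hne'
    · by_contra hcon
      have hb1 : b.2.1 ∈ b.1 ∩ a.1 := by
        refine Finset.mem_inter.2 ⟨(hin b hb).1, ?_⟩
        by_cases h1 : b.2.1 = a.2.1
        · rw [h1]; exact (hin a ha).1
        · by_cases h2 : b.2.1 = a.2.2
          · rw [h2]; exact (hin a ha).2.1
          · exact absurd (Or.inl ⟨h1, h2⟩) hcon
      have hb2 : b.2.2 ∈ b.1 ∩ a.1 := by
        refine Finset.mem_inter.2 ⟨(hin b hb).2.1, ?_⟩
        by_cases h1 : b.2.2 = a.2.1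
        · rw [h1]; exact (hin a ha).1
        · by_cases h2 : b.2.2 = a.2.2
          · rw [h2]; exact (hin a ha).2.1
          · exact absurd (Or.inr ⟨h1, h2⟩) hcon
      exact (hin b hb).2.2 (Finset.card_le_one.1 h _ hb1 _ hb2)
  · intro p hp X Y hX hY hXc hYc
    obtain ⟨a, ha, rfl⟩ := hPS p hp
    obtain ⟨t, t', htt, hcnt⟩ := hpair a ha
    have hij := (hin a ha).2.2
    obtain ⟨G', m, hSt⟩ := hInt (t, t', a.2.1, a.2.2) (Finset.mem_filter.2 ⟨Finset.mem_univ _, hij⟩)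
    have hNi : (0:ℝ) < (W a.2.1).card := by exact_mod_cast (hne _).card_pos
    have hNj : (0:ℝ) < (W a.2.2).card := by exact_mod_cast (hne _).card_pos
    have hpp : 0 < ((W a.2.1).card : ℝ) * (W a.2.2).card := by positivity
    have hm : μ ≤ m := by
      have e1 := hSt.2.2.1
      have e2 : cnt (fun x y => DD H t a.2.1 a.2.2 W η x y ∧ DD H t' a.2.1 a.2.2 W η x y)
          (W a.2.1) (W a.2.2) ≤ cnt G' (W a.2.1) (W a.2.2) :=
        cnt_mono subset_rfl subset_rfl fun x _ y _ hxy => hSt.2.1 x y hxy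
      simp only [PDint] at e1
      have : 2 * μ * (((W a.2.1).card : ℝ) * (W a.2.2).card) ≤
        (m + μ) * (((W a.2.1).card : ℝ) * (W a.2.2).card) := by linarith
      have := le_of_mul_le_mul_right this hpp
      linarith
    have hg1 : gseq μ N / 2 ≤ 1 := by linarith [gseq_le_one hμ hμ1 N]
    set A : ι → Finset ℕ := Function.update (Function.update W a.2.1 X) a.2.2 Y with hA
    have e1 : A a.2.1 = X := by simp [A, hij]
    have e2 : A a.2.2 = Y := by simp [A]
    have hAW : Sub (gseq μ N / 2) A W := by
      intro u
      by_cases hu : u = a.2.2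
      · subst hu; rw [e2]; exact ⟨hY, hYc⟩
      · by_cases hu' : u = a.2.1
        · subst hu'; rw [e1]; exact ⟨hX, hXc⟩
        · simp only [A, Function.update_of_ne hu, Function.update_of_ne hu']
          exact Sub.refl hg1 W u
    have e3 := hSt.2.2.2 A hAW
    simp only [PDint] at e3
    rw [e1, e2] at e3
    calc μ * (X.card * Y.card : ℝ) ≤ m * (X.card * Y.card : ℝ) := by gcongr
      _ ≤ _ := e3
      _ ≤ _ := by
        apply cnt_mono subset_rfl subset_rfl
        intro x _ y _ hxy b hb hbp
        rcases htt b hb hbp with h | h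
        · rw [h]; exact DD_mono H t _ _ _ A W η2 x y (by positivity) hη2.le hAW hxy.1.1
        · rw [h]; exact DD_mono H t' _ _ _ A W η2 x y (by positivity) hη2.le hAW hxy.1.2

end P5

section P6
open scoped Classical
set_option linter.unusedSectionVars false
variable {ι : Type} [Fintype ι] [DecidableEq ι]

lemma rect_count (W : ι → Finset ℕ) (i j : ι) (hij : i ≠ j) (x : ι → ℕ)
    (C : (ι → ℕ) → Prop) (G : ℕ → ℕ → Prop)
    (hC : ∀ x a b a' b', C (upd2 x i j a b') → C (upd2 x i j a' b) → C (upd2 x i j a b)) :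
    ∃ X Y, X ⊆ W i ∧ Y ⊆ W j ∧
      cnt (fun a b => C (upd2 x i j a b)) (W i) (W j) = X.card * Y.card ∧
      cnt (fun a b => C (upd2 x i j a b) ∧ G (upd2 x i j a b i) (upd2 x i j a b j)) (W i) (W j)
        = cnt G X Y := by
  refine ⟨(W i).filter fun a => ∃ b ∈ W j, C (upd2 x i j a b),
    (W j).filter fun b => ∃ a ∈ W i, C (upd2 x i j a b), Finset.filter_subset _ _,
    Finset.filter_subset _ _, ?_, ?_⟩
  · unfold cnt
    rw [← Nat.cast_mul, ← Finset.card_product]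
    congr 2
    ext ⟨a, b⟩
    simp only [Finset.mem_filter, Finset.mem_product]
    constructor
    · rintro ⟨⟨h1, h2⟩, h3⟩
      exact ⟨⟨h1, b, h2, h3⟩, h2, a, h1, h3⟩
    · rintro ⟨⟨h1, b', _, h3⟩, h2, a', _, h4⟩
      exact ⟨⟨h1, h2⟩, hC _ _ _ _ _ h3 h4⟩
  · unfold cnt
    congr 2
    ext ⟨a, b⟩
    simp only [Finset.mem_filter, Finset.mem_product]
    have e1 : upd2 x i j a b i = a := by simp [upd2, hij]
    have e2 : upd2 x i j a b j = b := by simp [upd2]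
    rw [e1, e2]
    constructor
    · rintro ⟨⟨h1, h2⟩, h3, hG⟩
      exact ⟨⟨⟨h1, b, h2, h3⟩, h2, a, h1, h3⟩, hG⟩
    · rintro ⟨⟨⟨h1, b', _, h3⟩, h2, a', _, h4⟩, hG⟩
      exact ⟨⟨h1, h2⟩, hC _ _ _ _ _ h3 h4, hG⟩

lemma telescope (W : ι → Finset ℕ) (w : ι → ℝ) (hw : ∀ i, ((W i).card : ℝ) ≤ w i)
    (s κ : ℝ) (hκ : 0 ≤ κ) (m : ι × ι → ℝ)
    (G : ι × ι → ℕ → ℕ → Prop) (S : Finset (ι × ι)) (hm0 : ∀ p ∈ S, 0 ≤ m p) (hm1 : ∀ p ∈ S, m p ≤ 1)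
    (hS : ∀ p ∈ S, p.1 ≠ p.2)
    (hS2 : ∀ p ∈ S, ∀ p' ∈ S, p ≠ p' → (p'.1 ≠ p.1 ∧ p'.1 ≠ p.2) ∨ (p'.2 ≠ p.1 ∧ p'.2 ≠ p.2))
    (hG : ∀ p ∈ S, ∀ X Y, X ⊆ W p.1 → Y ⊆ W p.2 →
      s * (cnt (G p) X Y - m p * (X.card * Y.card)) ≤ κ * (w p.1 * w p.2)) :
    s * (num W (fun x => ∀ p ∈ S, G p (x p.1) (x p.2)) - (∏ p ∈ S, m p) * vol W) ≤
      S.card * (κ * ∏ i, w i) := by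
  have hw0 : ∀ i, 0 ≤ w i := fun i => le_trans (by positivity) (hw i)
  have hPw : 0 ≤ ∏ i, w i := Finset.prod_nonneg fun i _ => hw0 i
  induction S using Finset.induction_on with
  | empty => simp [num_true]
  | insert p S hp ih =>
    rw [Finset.card_insert_of_notMem hp, Finset.prod_insert hp]
    have hsub : S ⊆ insert p S := Finset.subset_insert _ _
    have ih := ih (fun q hq => hm0 q (hsub hq)) (fun q hq => hm1 q (hsub hq))
      (fun q hq => hS q (hsub hq))
      (fun q hq q' hq' => hS2 q (hsub hq) q' (hsub hq'))
      (fun q hq => hG q (hsub hq))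
    have hp' := Finset.mem_insert_self p S
    have hpp := hS p hp'
    set C : (ι → ℕ) → Prop := fun x => ∀ p ∈ S, G p (x p.1) (x p.2) with hCdef
    have hrect : ∀ x a b a' b', C (upd2 x p.1 p.2 a b') → C (upd2 x p.1 p.2 a' b) →
        C (upd2 x p.1 p.2 a b) := by
      intro x a b a' b' h1 h2 q hq
      have hne : p ≠ q := by rintro rfl; exact hp hq
      have h1 := h1 q hq
      have h2 := h2 q hq
      unfold upd2 at *
      rcases hS2 p hp' q (Finset.mem_insert_of_mem hq) hne with ⟨h3, h4⟩ | ⟨h3, h4⟩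
      · rw [Function.update_of_ne h4, Function.update_of_ne h3] at *
        by_cases h5 : q.2 = p.2
        · rw [h5] at h2 ⊢; simpa using h2
        · rw [Function.update_of_ne h5] at *; exact h1
      · rw [Function.update_of_ne h4, Function.update_of_ne h3] at *
        by_cases h5 : q.1 = p.2
        · rw [h5] at h2 ⊢; simpa using h2
        · rw [Function.update_of_ne h5] at *; exact h1
    have hnum : num W (fun x => ∀ q ∈ insert p S, G q (x q.1) (x q.2)) =
        num W (fun x => C x ∧ G p (x p.1) (x p.2)) := by
      congr 1
      funext x
      simp only [Finset.forall_mem_insert, hCdef]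
      exact propext and_comm
    rw [hnum]
    have key : s * (num W (fun x => C x ∧ G p (x p.1) (x p.2)) - m p * num W C) ≤
        κ * ∏ i, w i := by
      by_cases h0 : vol W = 0
      · have e1 : num W (fun x => C x ∧ G p (x p.1) (x p.2)) = 0 :=
          le_antisymm (h0 ▸ num_le _ _) (num_nonneg _ _)
        have e2 : num W C = 0 := le_antisymm (h0 ▸ num_le _ _) (num_nonneg _ _)
        rw [e1, e2]; simp; positivity
      · have hcard : ∀ i, (0:ℝ) < (W i).card := by
          intro i
          have : ((W i).card : ℝ) ≠ 0 := fun h => h0 (by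
            unfold vol; exact Finset.prod_eq_zero (Finset.mem_univ i) h)
          positivity
        have hNi := hcard p.1
        have hNj := hcard p.2
        have r1 := resample2 W p.1 p.2 (fun x => C x ∧ G p (x p.1) (x p.2))
        have r2 := resample2 W p.1 p.2 C
        have r3 : s * ((W p.1).card * (W p.2).card *
            (num W (fun x => C x ∧ G p (x p.1) (x p.2)) - m p * num W C)) ≤
            vol W * (κ * (w p.1 * w p.2)) := by
          have : s * ((W p.1).card * (W p.2).card *
            (num W (fun x => C x ∧ G p (x p.1) (x p.2)) - m p * num W C)) =
              ∑ x ∈ Fintype.piFinset W, s * (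
                cnt (fun a b => C (upd2 x p.1 p.2 a b) ∧ G p (upd2 x p.1 p.2 a b p.1)
                  (upd2 x p.1 p.2 a b p.2)) (W p.1) (W p.2) - m p *
                cnt (fun a b => C (upd2 x p.1 p.2 a b)) (W p.1) (W p.2)) := by
            rw [← Finset.mul_sum, Finset.sum_sub_distrib, ← Finset.mul_sum, r1, r2]; ring
          rw [this, vol_eq, ← nsmul_eq_mul]
          apply Finset.sum_le_card_nsmul
          intro x _
          obtain ⟨X, Y, hX, hY, e1, e2⟩ := rect_count W p.1 p.2 hpp x C (G p) hrect
          rw [e1, e2]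
          exact hG p hp' X Y hX hY
        have hpos : 0 < ((W p.1).card : ℝ) * (W p.2).card := by positivity
        refine le_of_mul_le_mul_left ?_ hpos
        calc _ = s * ((W p.1).card * (W p.2).card *
            (num W (fun x => C x ∧ G p (x p.1) (x p.2)) - m p * num W C)) := by ring
          _ ≤ _ := r3
          _ ≤ _ := by
            have hj : p.2 ∈ Finset.univ.erase p.1 := by simp [hpp.symm]
            unfold vol
            rw [← Finset.mul_prod_erase _ _ (Finset.mem_univ p.1), ← Finset.mul_prod_erase _ _ hj,
              ← Finset.mul_prod_erase _ w (Finset.mem_univ p.1),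
              ← Finset.mul_prod_erase _ w hj]
            have hle : ∏ x ∈ (Finset.univ.erase p.1).erase p.2, ((W x).card : ℝ) ≤
              ∏ x ∈ (Finset.univ.erase p.1).erase p.2, w x :=
              Finset.prod_le_prod (fun _ _ => by positivity) (fun x _ => hw x)
            have h1 := hw0 p.1
            have h2 := hw0 p.2
            calc _ = (((W p.1).card : ℝ) * (W p.2).card) * (κ * (w p.1 * w p.2)) *
                ∏ x ∈ (Finset.univ.erase p.1).erase p.2, ((W x).card : ℝ) := by ring
              _ ≤ (((W p.1).card : ℝ) * (W p.2).card) * (κ * (w p.1 * w p.2)) *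
                ∏ x ∈ (Finset.univ.erase p.1).erase p.2, w x := by gcongr
              _ = _ := by ring
    have h1 := hm0 p hp'
    have h2 := hm1 p hp'
    have h3 : 0 ≤ (S.card : ℝ) * (κ * ∏ i, w i) := by positivity
    have h4 := mul_le_mul_of_nonneg_left ih h1
    have h5 : m p * (S.card * (κ * ∏ i, w i)) ≤ S.card * (κ * ∏ i, w i) := by nlinarith
    push_cast
    linarith

end P6

section P7
open scoped Classical
set_option linter.unusedSectionVars false
variable {ι : Type} [Fintype ι] [DecidableEq ι]

lemma bad_pairs (H : Finset (Finset ℕ)) (W : ι → Finset ℕ) (hW : ∀ i, (W i).Nonempty)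
    (t : Finset ι) (i j : ι) {α δ ξ η m : ℝ} {G} (hξ : 0 ≤ ξ)
    (hS : Stuff (PDind t i j H) W α δ ξ η G m) :
    num W (fun x => Eh H t x ∧ ¬ G (x i) (x j)) ≤ ξ * vol W := by
  by_cases hij : i = j
  · subst hij
    have hNi : (0:ℝ) < (W i).card := by exact_mod_cast (hW i).card_pos
    have r := resample2' W i i (fun x => Eh H t x ∧ ¬ G (x i) (x i))
    refine le_of_mul_le_mul_left ?_ (show (0:ℝ) < (W i).card * (W i).card by positivity)
    rw [← r]
    have : ∀ a ∈ W i, ∀ b ∈ W i, num W (fun x => Eh H t (upd2 x i i a b) ∧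
        ¬ G (upd2 x i i a b i) (upd2 x i i a b i)) ≤ ξ * vol W := by
      intro a _ b _
      by_cases hb : G b b
      · refine le_trans (le_of_eq ?_) (mul_nonneg hξ (vol_pos hW).le)
        unfold num
        simp [upd2, hb]
      · have h1 : ¬ DD H t i i W ξ b b := fun h => hb (hS.2.1 b b h)
        unfold DD at h1
        push Not at h1
        refine le_trans (num_mono (fun _ => subset_rfl) ?_) h1.le
        rintro x _ ⟨h2, _⟩
        simpa [upd2] using h2
    calc _ ≤ ∑ a ∈ W i, ∑ b ∈ W i, ξ * vol W :=
          Finset.sum_le_sum fun a ha => Finset.sum_le_sum fun b hb => this a ha b hb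
      _ = _ := by simp; ring
  have hNi : (0:ℝ) < (W i).card := by exact_mod_cast (hW i).card_pos
  have hNj : (0:ℝ) < (W j).card := by exact_mod_cast (hW j).card_pos
  have r := resample2' W i j (fun x => Eh H t x ∧ ¬ G (x i) (x j))
  refine le_of_mul_le_mul_left ?_ (show (0:ℝ) < (W i).card * (W j).card by positivity)
  rw [← r]
  have : ∀ a ∈ W i, ∀ b ∈ W j, num W (fun x => Eh H t (upd2 x i j a b) ∧
      ¬ G (upd2 x i j a b i) (upd2 x i j a b j)) ≤ ξ * vol W := by
    intro a _ b _
    by_cases hb : G a b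
    · refine le_trans (le_of_eq ?_) (mul_nonneg hξ (vol_pos hW).le)
      unfold num
      simp [upd2, hij, hb]
    · have h1 : ¬ DD H t i j W ξ a b := fun h => hb (hS.2.1 a b h)
      unfold DD at h1
      push Not at h1
      refine le_trans (num_mono (fun _ => subset_rfl) ?_) h1.le
      rintro x _ ⟨h2, _⟩
      exact h2
  calc _ ≤ ∑ a ∈ W i, ∑ b ∈ W j, ξ * vol W :=
        Finset.sum_le_sum fun a ha => Finset.sum_le_sum fun b hb => this a ha b hb
    _ = _ := by simp; ring

lemma exists_eps (k : ℕ) (ε : ℝ) (hε : 0 < ε) : ∃ ε' : ℝ, 0 < ε' ∧ (1 + ε') ^ k < 1 + ε := by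
  have : ContinuousAt (fun x : ℝ => (1 + x) ^ k) 0 := by fun_prop
  have h := this.eventually (Iio_mem_nhds (show (1 + (0:ℝ)) ^ k < 1 + ε by simpa using hε))
  obtain ⟨d, hd, hball⟩ := Metric.eventually_nhds_iff.1 h
  refine ⟨d / 2, by positivity, hball ?_⟩
  rw [Real.dist_eq, sub_zero, abs_of_pos (by positivity)]
  linarith

lemma amgm {κ : Type} (S : Finset κ) (hS : 0 < S.card) (m : κ → ℝ) (hm : ∀ p ∈ S, 0 ≤ m p) :
    ∏ p ∈ S, m p ≤ ((∑ p ∈ S, m p) / S.card) ^ S.card := by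
  have hc : (0:ℝ) < S.card := by exact_mod_cast hS
  have h := Real.geom_mean_le_arith_mean_weighted S (fun _ => (1:ℝ) / S.card) m
    (fun _ _ => by positivity) (by simp; field_simp) hm
  rw [Real.finsetProd_rpow _ _ hm, ← Finset.mul_sum] at h
  have h0 : 0 ≤ ∏ p ∈ S, m p := Finset.prod_nonneg hm
  have h2 := pow_le_pow_left₀ (by positivity) h S.card
  rw [← Real.rpow_natCast, ← Real.rpow_mul h0, one_div, inv_mul_cancel₀ hc.ne', Real.rpow_one] at h2
  rw [div_eq_inv_mul]; exact h2

lemma num_or (W : ι → Finset ℕ) (A B : (ι → ℕ) → Prop) :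
    num W (fun x => A x ∨ B x) ≤ num W A + num W B := by
  unfold num
  norm_cast
  refine le_trans (Finset.card_le_card ?_) (Finset.card_union_le _ _)
  intro x; simp only [Finset.mem_filter, Finset.mem_union]; tauto

lemma num_exists {κ : Type} (W : ι → Finset ℕ) (S : Finset κ) (A : κ → (ι → ℕ) → Prop) :
    num W (fun x => ∃ p ∈ S, A p x) ≤ ∑ p ∈ S, num W (A p) := by
  induction S using Finset.induction_on with
  | empty => simp [num]
  | insert p S hp ih =>
    rw [Finset.sum_insert hp]
    refine le_trans (le_trans (le_of_eq ?_) (num_or W (A p) _)) (add_le_add le_rfl ih)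
    congr 1
    funext x
    simp

lemma sum_m (k : ℕ) (hk : 0 < k) (ε : ℝ) (hε : 0 < ε) :
    ∃ ε' : ℝ, 0 < ε' ∧ ∃ α δ ξ : ℝ, 0 < α ∧ α ≤ 1 ∧ 0 < δ ∧ 0 < ξ ∧
    ∀ (ι : Type) [Fintype ι] [DecidableEq ι] (H : Finset (Finset ℕ)) (W : ι → Finset ℕ) (η : ℝ)
      (t : Finset ι) (m : ι × ι → ℝ) (S : Finset (ι × ι)),
    (∀ i, (W i).Nonempty) → S.card = k →
    (∀ p ∈ S, p.1 ≠ p.2) →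
    (∀ p ∈ S, ∀ p' ∈ S, p ≠ p' → (p'.1 ≠ p.1 ∧ p'.1 ≠ p.2) ∨ (p'.2 ≠ p.1 ∧ p'.2 ≠ p.2)) →
    (∀ p ∈ S, ∃ G, Stuff (PDind t p.1 p.2 H) W α δ ξ η G (m p)) →
    (((k:ℝ) ^ k)⁻¹ + ε) * vol W ≤ num W (Eh H t) →
    1 + ε' < ∑ p ∈ S, m p := by
  have hk' : (0:ℝ) < k := by exact_mod_cast hk
  obtain ⟨ε', hε', hlt⟩ := exists_eps k (k ^ k * (ε / 2)) (by positivity)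
  set β := min 1 (ε / (8 * k)) with hβ
  have hβ0 : 0 < β := by positivity
  refine ⟨ε', hε', β, β, β, hβ0, min_le_left _ _, hβ0, hβ0, ?_⟩
  intro ι _ _ H W η t m S hne hcard hS hS2 hSt hE
  have hv := vol_pos hne
  choose! G hG using hSt
  have hm0 : ∀ p ∈ S, 0 ≤ m p := fun p hp => (hG p hp).1
  have hm1 : ∀ p ∈ S, m p ≤ 1 := fun p hp => (hG p hp).m_le_one (min_le_left _ _) hne
  have h1 := telescope W (fun i => ((W i).card : ℝ)) (fun _ => le_rfl) 1 (β + 2 * β) (by positivity)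
    m G S hm0 hm1 hS hS2 (by
      intro p hp X Y hX hY
      have := (hG p hp).upper (hS p hp) hβ0 (min_le_left _ _) hne hX hY
      simp only [PDind] at this
      linarith)
  have h2 : num W (Eh H t) ≤ num W (fun x => ∀ p ∈ S, G p (x p.1) (x p.2)) +
      ∑ p ∈ S, num W (fun x => Eh H t x ∧ ¬ G p (x p.1) (x p.2)) := by
    refine le_trans ?_ (add_le_add le_rfl (num_exists W S _))
    refine le_trans ?_ (num_or W _ _)
    apply num_mono (fun _ => subset_rfl)
    intro x _ hx
    by_cases h : ∀ p ∈ S, G p (x p.1) (x p.2)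
    · exact Or.inl h
    · push Not at h
      obtain ⟨p, hp, h⟩ := h
      exact Or.inr ⟨p, hp, hx, h⟩
  have h3 : ∑ p ∈ S, num W (fun x => Eh H t x ∧ ¬ G p (x p.1) (x p.2)) ≤ k * (β * vol W) := by
    rw [← hcard, ← nsmul_eq_mul]
    apply Finset.sum_le_card_nsmul
    intro p hp
    exact bad_pairs H W hne t p.1 p.2 hβ0.le (hG p hp)
  rw [hcard] at h1
  change 1 * (_ - _) ≤ k * ((β + 2 * β) * vol W) at h1
  have hβk : k * β ≤ ε / 8 := by
    have : β ≤ ε / (8 * k) := min_le_right _ _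
    calc k * β ≤ k * (ε / (8 * k)) := by gcongr
      _ = ε / 8 := by field_simp
  have h4 : (((k:ℝ) ^ k)⁻¹ + ε / 2) ≤ ∏ p ∈ S, m p := by
    refine le_of_mul_le_mul_right ?_ hv
    have : k * β * vol W ≤ ε / 8 * vol W := by gcongr
    nlinarith
  have h5 := h4.trans (amgm S (hcard ▸ hk) m hm0)
  rw [hcard, div_pow] at h5
  by_contra hcon
  push Not at hcon
  have h6 : (∑ p ∈ S, m p) ^ k ≤ (1 + ε') ^ k :=
    pow_le_pow_left₀ (Finset.sum_nonneg hm0) hcon k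
  rw [le_div_iff₀ (by positivity)] at h5
  have h7 : (((k:ℝ) ^ k)⁻¹ + ε / 2) * k ^ k = 1 + k ^ k * (ε / 2) := by
    field_simp
  linarith

end P7

section P8
open scoped Classical

lemma ramsey (κ : Type) [Fintype κ] (r m : ℕ) : ∃ M : ℕ, ∀ (α : Type) (S : Finset α), M ≤ S.card →
    ∀ c : Finset α → κ, ∃ T ⊆ S, T.card = m ∧ ∃ k, ∀ e ⊆ T, e.card = r → c e = k := by
  induction r generalizing m with
  | zero =>
    refine ⟨m, fun α S hS c => ?_⟩
    obtain ⟨T, hT, hc⟩ := Finset.exists_subset_card_eq hS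
    refine ⟨T, hT, hc, c ∅, fun e _ he => ?_⟩
    rw [Finset.card_eq_zero.1 he]
  | succ r ih =>
    have claim : ∀ n : ℕ, ∃ M : ℕ, ∀ (α : Type) (S : Finset α), M ≤ S.card →
        ∀ c : Finset α → κ, ∃ T ⊆ S, T.card = n ∧ ∃ f : α → κ,
          ∀ e ⊆ T, e.card = r + 1 → ∃ x ∈ e, c e = f x := by
      intro n
      induction n with
      | zero =>
        refine ⟨0, fun α S hS c => ⟨∅, by simp, by simp, fun _ => c ∅, fun e he hc => ?_⟩⟩
        rw [Finset.subset_empty.1 he] at hc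
        simp at hc
      | succ n ihn =>
        obtain ⟨M1, h1⟩ := ihn
        obtain ⟨M2, h2⟩ := ih M1
        refine ⟨M2 + 1, fun α S hS c => ?_⟩
        obtain ⟨x, hx⟩ : S.Nonempty := by rw [← Finset.card_pos]; omega
        obtain ⟨T1, hT1, hc1, k, hk⟩ := h2 α (S.erase x) (by rw [Finset.card_erase_of_mem hx]; omega)
          (fun e => c (insert x e))
        obtain ⟨T, hT, hc, f, hf⟩ := h1 α T1 hc1.ge c
        have hxT : x ∉ T := fun h => by simpa using hT1 (hT h)
        refine ⟨insert x T, ?_, by rw [Finset.card_insert_of_notMem hxT, hc],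
          Function.update f x k, fun e he hce => ?_⟩
        · intro y hy
          rcases Finset.mem_insert.1 hy with rfl | hy
          · exact hx
          · exact Finset.mem_of_mem_erase (hT1 (hT hy))
        · by_cases hxe : x ∈ e
          · refine ⟨x, hxe, ?_⟩
            have := hk (e.erase x) ?_ (by rw [Finset.card_erase_of_mem hxe]; omega)
            · rw [Finset.insert_erase hxe] at this
              simpa using this
            · intro y hy
              have h3 := he (Finset.mem_of_mem_erase hy)
              rcases Finset.mem_insert.1 h3 with rfl | h3
              · simp at hy
              · exact hT h3
          · obtain ⟨y, hy, hcy⟩ := hf e (fun y hy => by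
              rcases Finset.mem_insert.1 (he hy) with rfl | h3
              · exact absurd hy hxe
              · exact h3) hce
            refine ⟨y, hy, ?_⟩
            rw [Function.update_of_ne]
            · exact hcy
            · rintro rfl; exact hxe hy
    obtain ⟨M, hM⟩ := claim (Fintype.card κ * m)
    refine ⟨M, fun α S hS c => ?_⟩
    obtain ⟨T, hT, hc, f, hf⟩ := hM α S hS c
    obtain ⟨k, -, hk⟩ := Finset.exists_le_card_fiber_of_mul_le_card_of_maps_to
      (s := T) (t := (Finset.univ : Finset κ)) (f := f) (n := m) (fun _ _ => Finset.mem_univ _)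
      ⟨c ∅, Finset.mem_univ _⟩ (by rw [hc, Finset.card_univ])
    obtain ⟨T', hT', hc'⟩ := Finset.exists_subset_card_eq hk
    refine ⟨T', fun y hy => hT (Finset.mem_filter.1 (hT' hy)).1, hc', k, fun e he hce => ?_⟩
    obtain ⟨x, hx, hcx⟩ := hf e (fun y hy => (Finset.mem_filter.1 (hT' (he hy))).1) hce
    rw [hcx]
    exact (Finset.mem_filter.1 (hT' (he hx))).2

end P8

section P9
open scoped Classical
set_option linter.unusedSectionVars false
variable {ι : Type} [Fintype ι] [DecidableEq ι]

lemma shrink_one (g : ℕ → ℝ) (X : Finset ℕ) (s : ℕ) (hs : s ≤ X.card) :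
    ∃ A ⊆ X, A.card = s ∧ X.card * ∑ a ∈ A, g a ≤ s * ∑ a ∈ X, g a := by
  obtain ⟨d, hd⟩ := Nat.exists_eq_add_of_le hs
  induction d generalizing X with
  | zero => exact ⟨X, subset_rfl, by omega, by simp [hd]⟩
  | succ d ih =>
    obtain ⟨a, ha, hmax⟩ := X.exists_max_image g (by rw [← Finset.card_pos]; omega)
    have hc : (X.erase a).card = s + d := by rw [Finset.card_erase_of_mem ha]; omega
    obtain ⟨A, hA, hAc, hle⟩ := ih (X.erase a) (by omega) hc
    refine ⟨A, hA.trans (Finset.erase_subset _ _), hAc, ?_⟩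
    have h1 : ∑ x ∈ X, g x = g a + ∑ x ∈ X.erase a, g x := (Finset.add_sum_erase X g ha).symm
    have h2 : ∑ x ∈ X.erase a, g x ≤ (s + d) * g a := by
      have := Finset.sum_le_card_nsmul (X.erase a) g (g a)
        (fun x hx => hmax x (Finset.mem_of_mem_erase hx))
      rw [hc, nsmul_eq_mul] at this
      exact_mod_cast this
    rw [hc] at hle
    rw [h1, hd]
    push_cast at *
    rcases Nat.eq_zero_or_pos (s + d) with h0 | h0
    · have hs0 : s = 0 := by omega
      have : A = ∅ := Finset.card_eq_zero.1 (by omega)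
      simp [this, hs0]
    · have h0' : (0:ℝ) < s + d := by exact_mod_cast h0
      refine le_of_mul_le_mul_left ?_ h0'
      have hs0 : (0:ℝ) ≤ s := by positivity
      have : ((s:ℝ) + d) * ((s + (d + 1)) * ∑ a ∈ A, g a) ≤
        (s + (d + 1)) * (s * ∑ x ∈ X.erase a, g x) := by
        have := mul_le_mul_of_nonneg_left hle (show (0:ℝ) ≤ s + (d+1) by positivity)
        linarith
      refine this.trans ?_
      nlinarith [mul_le_mul_of_nonneg_left h2 hs0]


lemma sum_pi_update (W : ι → Finset ℕ) (i : ι) (A : Finset ℕ) (hA : A ⊆ W i) (f : (ι → ℕ) → ℝ) :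
    ∑ x ∈ Fintype.piFinset (Function.update W i A), f x =
      ∑ a ∈ A, ∑ x ∈ (Fintype.piFinset W).filter (fun x => x i = a), f x := by
  rw [← Finset.sum_fiberwise_of_maps_to (t := A) (g := fun x => x i)]
  · refine Finset.sum_congr rfl fun a ha => Finset.sum_congr ?_ fun _ _ => rfl
    ext x
    simp only [Finset.mem_filter, Fintype.mem_piFinset]
    refine and_congr_left fun hx => forall_congr' fun u => ?_
    by_cases hu : u = i
    · subst hu; simp [hx, ha, hA ha]
    · simp [hu]
  · intro x hx
    have := Fintype.mem_piFinset.1 hx i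
    simpa using this

lemma shrink (W : ι → Finset ℕ) (hW : ∀ i, (W i).Nonempty) (s : ℕ) (hs0 : 0 < s)
    (hs : ∀ i, s ≤ (W i).card)
    (f : (ι → ℕ) → ℝ) (T : Finset ι) : ∃ W' : ι → Finset ℕ, (∀ i, W' i ⊆ W i) ∧
      (∀ i ∉ T, W' i = W i) ∧ (∀ i ∈ T, (W' i).card = s) ∧
      vol W * ∑ x ∈ Fintype.piFinset W', f x ≤ vol W' * ∑ x ∈ Fintype.piFinset W, f x := by
  induction T using Finset.induction_on with
  | empty => exact ⟨W, fun _ => subset_rfl, fun _ _ => rfl, by simp, le_rfl⟩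
  | insert i T hi ih =>
    obtain ⟨W', h1, h2, h3, h4⟩ := ih
    obtain ⟨A, hA, hAc, hle⟩ := shrink_one
      (fun a => ∑ x ∈ (Fintype.piFinset W').filter (fun x => x i = a), f x) (W' i) s
      (by rw [h2 i hi]; exact hs i)
    rw [← sum_pi_update W' i A hA, ← sum_pi_update W' i (W' i) subset_rfl,
      Function.update_eq_self] at hle
    refine ⟨Function.update W' i A, ?_, ?_, ?_, ?_⟩
    · intro u
      by_cases hu : u = i
      · subst hu; simpa using hA.trans (h1 u)
      · simpa [hu] using h1 u
    · intro u hu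
      have hu' : u ≠ i := by rintro rfl; simp at hu
      rw [Function.update_of_ne hu']
      exact h2 u (fun h => hu (Finset.mem_insert_of_mem h))
    · intro u hu
      by_cases hu' : u = i
      · subst hu'; simpa using hAc
      · rw [Function.update_of_ne hu']
        exact h3 u (Finset.mem_of_mem_insert_of_ne hu hu')
    · have hpos : (0:ℝ) < (W' i).card := by
        rw [h2 i hi]; exact_mod_cast (hW i).card_pos
      have hv : vol (Function.update W' i A) * (W' i).card = vol W' * s := by
        unfold vol
        rw [← Finset.mul_prod_erase _ _ (Finset.mem_univ i),
          ← Finset.mul_prod_erase _ (fun u => ((W' u).card : ℝ)) (Finset.mem_univ i)]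
        rw [Finset.prod_congr rfl (g := fun u => ((W' u).card : ℝ))]
        · simp [hAc]; ring
        · intro u hu
          rw [Function.update_of_ne (Finset.ne_of_mem_erase hu)]
      refine le_of_mul_le_mul_right ?_ hpos
      have h5 := mul_le_mul_of_nonneg_left hle (vol_pos hW).le
      have h6 := mul_le_mul_of_nonneg_left h4 (show (0:ℝ) ≤ s by positivity)
      calc _ = vol W * ((W' i).card * ∑ x ∈ Fintype.piFinset (Function.update W' i A), f x) := by ring
        _ ≤ _ := h5
        _ = s * (vol W * ∑ x ∈ Fintype.piFinset W', f x) := by ring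
        _ ≤ _ := h6
        _ = (vol W' * s) * ∑ x ∈ Fintype.piFinset W, f x := by ring
        _ = _ := by rw [← hv]; ring

/-- counting of crossing edges -/
lemma crossing (r s : ℕ) (hs : 0 < s) (H : RGraph r) (W : ι → Finset ℕ) (hc : ∀ i, (W i).card = s)
    (hdisj : ∀ i j, i ≠ j → Disjoint (W i) (W j)) (hsub : ∀ i, W i ⊆ H.verts) (I : Finset ι)
    (S : Finset ℕ) (hS : S = I.biUnion W) :
    ((I.card.choose r : ℝ)) * (s:ℝ) ^ r ≤
      (∑ t ∈ I.powersetCard r, num W (Eh H.edges t)) / s ^ (Fintype.card ι) * s ^ r +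
      (((I.card * s).choose r : ℝ) - ((H.edges.filter (fun e => e ⊆ S)).card : ℝ)) := by
  have hinj : ∀ x ∈ Fintype.piFinset W, Function.Injective x := by
    intro x hx i j hij
    by_contra hne
    rw [Fintype.mem_piFinset] at hx
    exact Finset.disjoint_left.1 (hdisj i j hne) (hx i) (hij ▸ hx j)
  have hScard : S.card = I.card * s := by
    rw [hS, Finset.card_biUnion (fun i _ j _ h => hdisj i j h)]
    simp [hc]
  have hpicard : (Fintype.piFinset W).card = s ^ (Fintype.card ι) := by
    rw [Fintype.card_piFinset]; simp [hc]
  set P := (I.powersetCard r) ×ˢ (Fintype.piFinset W) with hP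
  have hPc : P.card = I.card.choose r * s ^ (Fintype.card ι) := by
    rw [hP, Finset.card_product, Finset.card_powersetCard, hpicard]
  by_cases hrM : r ≤ Fintype.card ι
  swap
  · have hI : I.card < r := lt_of_le_of_lt (Finset.card_le_univ I) (by omega)
    have h1 : (H.edges.filter (fun e => e ⊆ S)).card ≤ (I.card * s).choose r := by
      rw [← hScard, ← Finset.card_powersetCard]
      apply Finset.card_le_card
      intro e he
      rw [Finset.mem_filter] at he
      exact Finset.mem_powersetCard.2 ⟨he.2, H.edges_card e he.1⟩
    have h1' : ((H.edges.filter (fun e => e ⊆ S)).card : ℝ) ≤ ((I.card * s).choose r : ℝ) := by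
      exact_mod_cast h1
    rw [Nat.choose_eq_zero_of_lt hI]
    have : 0 ≤ (∑ t ∈ I.powersetCard r, num W (Eh H.edges t)) / (s:ℝ) ^ (Fintype.card ι) * s ^ r := by
      have : 0 ≤ ∑ t ∈ I.powersetCard r, num W (Eh H.edges t) :=
        Finset.sum_nonneg fun _ _ => num_nonneg _ _
      positivity
    simp only [Nat.cast_zero, zero_mul]
    linarith
  have hsplit := Finset.card_filter_add_card_filter_not (s := P) (fun p => p.1.image p.2 ∈ H.edges)
  have hgood : ((P.filter (fun p => p.1.image p.2 ∈ H.edges)).card : ℝ) =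
      ∑ t ∈ I.powersetCard r, num W (Eh H.edges t) := by
    rw [Finset.card_filter, hP, Finset.sum_product]
    push_cast
    refine Finset.sum_congr rfl fun t _ => ?_
    rw [num_eq_sum]
    refine Finset.sum_congr rfl fun x _ => ?_
    unfold Eh
    congr
  have hbad : (P.filter (fun p => ¬ p.1.image p.2 ∈ H.edges)).card ≤
      s ^ (Fintype.card ι - r) * ((S.powersetCard r).filter (fun e => e ∉ H.edges)).card := by
    apply Finset.card_le_mul_card_image_of_maps_to (f := fun p => p.1.image p.2)
    · rintro ⟨t, x⟩ h
      simp only [hP, Finset.mem_filter, Finset.mem_product, Finset.mem_powersetCard] at h ⊢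
      refine ⟨⟨?_, ?_⟩, h.2⟩
      · intro v hv
        obtain ⟨i, hi, rfl⟩ := Finset.mem_image.1 hv
        rw [hS, Finset.mem_biUnion]
        exact ⟨i, h.1.1.1 hi, Fintype.mem_piFinset.1 h.1.2 i⟩
      · rw [Finset.card_image_of_injective _ (hinj x h.1.2)]
        exact h.1.1.2
    · intro e _
      rcases (Finset.filter (fun p : Finset ι × (ι → ℕ) => p.1.image p.2 = e)
        (P.filter (fun p => ¬ p.1.image p.2 ∈ H.edges))).eq_empty_or_nonempty with h0 | ⟨⟨t0, x0⟩, h0⟩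
      · rw [h0]; simp
      · simp only [hP, Finset.mem_filter, Finset.mem_product, Finset.mem_powersetCard] at h0
        obtain ⟨⟨⟨⟨ht0, ht0c⟩, hx0⟩, -⟩, he0⟩ := h0
        have key : ∀ (t : Finset ι) (x : ι → ℕ), x ∈ Fintype.piFinset W → t.image x = e →
            ∀ (t' : Finset ι) (x' : ι → ℕ),
            x' ∈ Fintype.piFinset W → t'.image x' = e → ∀ i ∈ t, i ∈ t' ∧ x i = x' i := by
          intro t x hx ht t' x' hx' ht' i hi
          have : x i ∈ t'.image x' := by rw [ht', ← ht]; exact Finset.mem_image_of_mem _ hi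
          obtain ⟨i', hi', hxx⟩ := Finset.mem_image.1 this
          have : i' = i := by
            by_contra hne
            exact Finset.disjoint_left.1 (hdisj i' i hne) (Fintype.mem_piFinset.1 hx' i')
              (hxx ▸ Fintype.mem_piFinset.1 hx i)
          subst this
          exact ⟨hi', hxx.symm⟩
        calc _ ≤ (({t0} : Finset (Finset ι)) ×ˢ Fintype.piFinset
              (fun i => if i ∈ t0 then {x0 i} else W i)).card := by
              apply Finset.card_le_card
              rintro ⟨t, x⟩ h
              simp only [hP, Finset.mem_filter, Finset.mem_product, Finset.mem_powersetCard] at h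
              obtain ⟨⟨⟨⟨ht, htc⟩, hx⟩, -⟩, he⟩ := h
              have k1 := key t x hx he t0 x0 hx0 he0
              have k2 := key t0 x0 hx0 he0 t x hx he
              rw [Finset.mem_product]
              constructor
              · rw [Finset.mem_singleton]
                ext i; exact ⟨fun h => (k1 i h).1, fun h => (k2 i h).1⟩
              · rw [Fintype.mem_piFinset]
                intro i
                by_cases hi : i ∈ t0
                · simp [hi, (k2 i hi).2]
                · simpa [hi] using Fintype.mem_piFinset.1 hx i
          _ = s ^ (Fintype.card ι - r) := by
            rw [Finset.card_product, Finset.card_singleton, one_mul, Fintype.card_piFinset]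
            rw [← Finset.prod_mul_prod_compl t0]
            rw [Finset.prod_congr rfl (g := fun _ => 1)]
            · rw [Finset.prod_congr (s₁ := t0ᶜ) rfl (g := fun _ => s)]
              · rw [Finset.prod_const, Finset.prod_const, one_pow, one_mul, Finset.card_compl, ht0c]
              · intro i hi
                rw [if_neg (Finset.mem_compl.1 hi), hc]
            · intro i hi
              rw [if_pos hi, Finset.card_singleton]
  have hnon : (((S.powersetCard r).filter (fun e => e ∉ H.edges)).card : ℝ) =
      ((I.card * s).choose r : ℝ) - ((H.edges.filter (fun e => e ⊆ S)).card : ℝ) := by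
    have := Finset.card_filter_add_card_filter_not (s := S.powersetCard r) (fun e => e ∈ H.edges)
    rw [Finset.card_powersetCard, hScard] at this
    have e1 : (S.powersetCard r).filter (fun e => e ∈ H.edges) = H.edges.filter (fun e => e ⊆ S) := by
      ext e
      simp only [Finset.mem_filter, Finset.mem_powersetCard]
      constructor
      · rintro ⟨⟨h1, h2⟩, h3⟩; exact ⟨h3, h1⟩
      · rintro ⟨h1, h2⟩; exact ⟨⟨h2, H.edges_card e h1⟩, h1⟩
    rw [e1] at this
    rw [← this]; push_cast; ring
  have hfin : (I.card.choose r : ℝ) * s ^ (Fintype.card ι) ≤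
      ∑ t ∈ I.powersetCard r, num W (Eh H.edges t) + s ^ (Fintype.card ι - r) *
        (((I.card * s).choose r : ℝ) - ((H.edges.filter (fun e => e ⊆ S)).card : ℝ)) := by
    rw [← hgood, ← hnon]
    rw [hPc] at hsplit
    have : I.card.choose r * s ^ (Fintype.card ι) ≤
      (P.filter (fun p => p.1.image p.2 ∈ H.edges)).card + s ^ (Fintype.card ι - r) *
        ((S.powersetCard r).filter (fun e => e ∉ H.edges)).card := by omega
    exact_mod_cast this
  have hs' : (0:ℝ) < s := by exact_mod_cast hs
  have hpow : (s:ℝ) ^ (Fintype.card ι) = s ^ (Fintype.card ι - r) * s ^ r := by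
    rw [← pow_add]; congr 1; omega
  rw [hpow] at hfin ⊢
  refine le_of_mul_le_mul_left ?_ (show (0:ℝ) < (s:ℝ) ^ (Fintype.card ι - r) by positivity)
  calc _ = (I.card.choose r : ℝ) * (s ^ (Fintype.card ι - r) * s ^ r) := by ring
    _ ≤ _ := hfin
    _ = _ := by field_simp

lemma binom_cmp (r : ℕ) (ε : ℝ) (hε : 0 < ε) : ∃ L : ℕ, r ≤ L ∧ 0 < L ∧ ∀ s : ℕ,
    (1 - ε) * ((L * s).choose r : ℝ) ≤ (L.choose r : ℝ) * (s:ℝ) ^ r := by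
  obtain ⟨L0, hL0⟩ := exists_nat_gt ((r:ℝ)^2 / ε)
  refine ⟨L0 + r + 1, by omega, by omega, fun s => ?_⟩
  set L := L0 + r + 1 with hL
  have hLpos : (0:ℝ) < L := by rw [hL]; positivity
  have hLr : (r:ℝ)^2 ≤ ε * L := by
    have : (L0:ℝ) ≤ L := by exact_mod_cast (by omega : L0 ≤ L)
    rw [div_lt_iff₀ hε] at hL0
    nlinarith
  have hrL : (r:ℝ) ≤ L := by exact_mod_cast (by omega : r ≤ L)
  rcases le_or_gt 1 ε with h1 | h1
  · have : 0 ≤ ((L * s).choose r : ℝ) := by positivity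
    have h2 : (0:ℝ) ≤ (L.choose r : ℝ) * (s:ℝ) ^ r := by positivity
    nlinarith
  have hf : (0:ℝ) < r.factorial := by exact_mod_cast r.factorial_pos
  have hu : ((L * s).choose r : ℝ) ≤ (L * s : ℝ) ^ r / r.factorial := by
    have := Nat.choose_le_pow_div (α := ℝ) r (L * s)
    push_cast at this; exact this
  have hl : (1 - ε) * (L:ℝ) ^ r ≤ (L.choose r : ℝ) * r.factorial := by
    have e1 : (L.choose r : ℝ) * r.factorial = (L.descFactorial r : ℝ) := by
      rw [Nat.descFactorial_eq_factorial_mul_choose]; push_cast; ring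
    rw [e1]
    have e2 : (((L + 1 - r) ^ r : ℕ) : ℝ) ≤ (L.descFactorial r : ℝ) := by
      exact_mod_cast Nat.pow_sub_le_descFactorial L r
    refine le_trans ?_ e2
    have e3 : ((L:ℝ) - r) ≤ ((L + 1 - r : ℕ) : ℝ) := by
      have : L + 1 - r = (L - r) + 1 := by omega
      rw [this]; push_cast [Nat.cast_sub (show r ≤ L by omega)]; linarith
    push_cast
    refine le_trans ?_ (pow_le_pow_left₀ (by linarith) e3 r)
    have e4 := one_add_mul_le_pow (a := -((r:ℝ)/L)) (by
      have : (r:ℝ)/L ≤ 1 := by rw [div_le_one hLpos]; exact hrL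
      linarith) r
    have e5 : ((L:ℝ) - r) ^ r = L ^ r * (1 + -((r:ℝ)/L)) ^ r := by
      rw [← mul_pow]; congr 1; field_simp; ring
    rw [e5, mul_comm (1 - ε)]
    refine mul_le_mul_of_nonneg_left (le_trans ?_ e4) (by positivity)
    have : (r:ℝ) * (r / L) ≤ ε := by
      rw [← mul_div_assoc, div_le_iff₀ hLpos]; nlinarith
    linarith
  calc (1 - ε) * ((L * s).choose r : ℝ) ≤ (1 - ε) * ((L * s : ℝ) ^ r / r.factorial) :=
        mul_le_mul_of_nonneg_left hu (by linarith)
    _ = ((1 - ε) * (L:ℝ) ^ r) * s ^ r / r.factorial := by rw [mul_pow]; ring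
    _ ≤ ((L.choose r : ℝ) * r.factorial) * s ^ r / r.factorial := by gcongr
    _ = _ := by field_simp

lemma local_partite (r : ℕ) (ε : ℝ) (hε : 0 < ε) (hε1 : ε ≤ 1) : ∃ L : ℕ, 0 < L ∧
    ∀ (ι : Type) [Fintype ι] [DecidableEq ι] (H : RGraph r) (d e' : ℝ) (W : ι → Finset ℕ) (s : ℕ)
      (I : Finset ι), 0 ≤ d → d ≤ 1 → e' ≤ ε / 4 → IsDense H d e' → 0 < s → (∀ i, s ≤ (W i).card) →
      (∀ i j, i ≠ j → Disjoint (W i) (W j)) → (∀ i, W i ⊆ H.verts) → I.card = L →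
      e' * H.verts.card ≤ s →
      ∃ t ∈ I.powersetCard r, (d - ε) * vol W ≤ num W (Eh H.edges t) := by
  obtain ⟨L, hrL, hL0, hL⟩ := binom_cmp r (ε / 4) (by linarith)
  refine ⟨L, hL0, ?_⟩
  intro ι _ _ H d e' W s I hd0 hd1 he' hden hs hsW hdisj hsub hI hbig
  by_contra hcon
  push Not at hcon
  have hWne : ∀ i, (W i).Nonempty := fun i => Finset.card_pos.1 (lt_of_lt_of_le hs (hsW i))
  obtain ⟨W', h1, -, h3, h4⟩ := shrink W hWne s hs hsW
    (fun x => ∑ t ∈ I.powersetCard r, if Eh H.edges t x then (1:ℝ) else 0) Finset.univ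
  have hsum : ∀ V : ι → Finset ℕ, ∑ x ∈ Fintype.piFinset V,
      (∑ t ∈ I.powersetCard r, if Eh H.edges t x then (1:ℝ) else 0) =
      ∑ t ∈ I.powersetCard r, num V (Eh H.edges t) := by
    intro V
    rw [Finset.sum_comm]
    exact Finset.sum_congr rfl fun t _ => (num_eq_sum V _).symm
  rw [hsum, hsum] at h4
  have hc' : ∀ i, (W' i).card = s := fun i => h3 i (Finset.mem_univ i)
  have hvol' : vol W' = (s:ℝ) ^ (Fintype.card ι) := by
    unfold vol; simp [hc']
  have hs' : (0:ℝ) < s := by exact_mod_cast hs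
  have hW := vol_pos hWne
  have hle : ∑ t ∈ I.powersetCard r, num W (Eh H.edges t) ≤ (L.choose r : ℝ) * ((d - ε) * vol W) := by
    have := Finset.sum_le_card_nsmul (I.powersetCard r) (fun t => num W (Eh H.edges t))
      ((d - ε) * vol W) (fun t ht => (hcon t ht).le)
    rwa [Finset.card_powersetCard, hI, nsmul_eq_mul] at this
  have hle' : (∑ t ∈ I.powersetCard r, num W' (Eh H.edges t)) / (s:ℝ) ^ (Fintype.card ι) ≤
      (L.choose r : ℝ) * (d - ε) := by
    rw [div_le_iff₀ (by positivity), ← hvol']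
    have hv' : 0 ≤ vol W' := by rw [hvol']; positivity
    refine le_of_mul_le_mul_left (h4.trans ((mul_le_mul_of_nonneg_left hle hv').trans (le_of_eq ?_))) hW
    ring
  have hcr := crossing r s hs H W' hc'
    (fun i j hij => (hdisj i j hij).mono (h1 i) (h1 j)) (fun i => (h1 i).trans (hsub i)) I
    (I.biUnion W') rfl
  rw [hI] at hcr
  have hScard : (I.biUnion W').card = L * s := by
    rw [Finset.card_biUnion (fun i _ j _ h => (hdisj i j h).mono (h1 i) (h1 j))]
    simp [hc', hI]
  have hden' := hden (I.biUnion W') (Finset.biUnion_subset.2 fun i _ => (h1 i).trans (hsub i)) (by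
    rw [hScard]; push_cast
    have : (1:ℝ) ≤ L := by exact_mod_cast hL0
    nlinarith)
  rw [hScard] at hden'
  have hLs := hL s
  set A := (L.choose r : ℝ) * (s:ℝ) ^ r with hA
  set B := ((L * s).choose r : ℝ) with hB
  have hBpos : 0 < B := by
    rw [hB]
    have : r ≤ L * s := hrL.trans (Nat.le_mul_of_pos_right L hs)
    exact_mod_cast Nat.choose_pos this
  have hfin : A ≤ A * (d - ε) + (B - (d - e') * B) := by
    have := mul_le_mul_of_nonneg_right hle' (show (0:ℝ) ≤ (s:ℝ)^r by positivity)
    have e1 : A * (d - ε) = (L.choose r : ℝ) * (d - ε) * (s:ℝ)^r := by rw [hA]; ring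
    rw [e1]
    linarith
  have h5 : (1 - ε / 4) * B * (1 - d + ε) ≤ A * (1 - d + ε) :=
    mul_le_mul_of_nonneg_right hLs (by linarith)
  have h6 : (1 - ε / 4) * B * (1 - d + ε) ≤ (1 - d + ε / 4) * B := by
    have : e' * B ≤ ε / 4 * B := mul_le_mul_of_nonneg_right he' hBpos.le
    linarith
  have h7 : (1 - ε / 4) * (1 - d + ε) ≤ (1 - d + ε / 4) := by
    refine le_of_mul_le_mul_right ?_ hBpos
    linarith
  nlinarith

end P9

section P10
open scoped Classical

def rpairs (r : ℕ) : Finset (Fin r × Fin r) := Finset.univ.filter (fun p => p.1 < p.2)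

lemma rpairs_card (r : ℕ) : (rpairs r).card = r.choose 2 := by
  have h := Finset.card_powersetCard 2 (Finset.univ : Finset (Fin r))
  rw [Finset.card_univ, Fintype.card_fin] at h
  rw [← h]
  refine Finset.card_bij (fun p _ => ({p.1, p.2} : Finset (Fin r))) ?_ ?_ ?_
  · intro p hp
    simp only [rpairs, Finset.mem_filter, Finset.mem_univ, true_and] at hp
    rw [Finset.mem_powersetCard]
    exact ⟨Finset.subset_univ _, Finset.card_pair hp.ne⟩
  · rintro ⟨a, b⟩ hp ⟨c, d⟩ hq h
    simp only [rpairs, Finset.mem_filter, Finset.mem_univ, true_and] at hp hq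
    have h1 : a ∈ ({c, d} : Finset (Fin r)) := by rw [← h]; simp
    have h2 : b ∈ ({c, d} : Finset (Fin r)) := by rw [← h]; simp
    have h3 : c ∈ ({a, b} : Finset (Fin r)) := by rw [h]; simp
    simp only [Finset.mem_insert, Finset.mem_singleton] at h1 h2 h3
    rw [Prod.mk.injEq]
    rcases h1 with rfl | rfl <;> rcases h2 with rfl | rfl <;> simp_all
    exact absurd (lt_trans hp hq) (lt_irrefl _)
  · intro s hs
    rw [Finset.mem_powersetCard] at hs
    obtain ⟨x, y, hxy, rfl⟩ := Finset.card_eq_two.1 hs.2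
    rcases lt_or_gt_of_ne hxy with h | h
    · exact ⟨(x, y), by simp [rpairs, h], rfl⟩
    · exact ⟨(y, x), by simp [rpairs, h], Finset.pair_comm _ _⟩

/-- blocks -/
def tau (r : ℕ) (p : Fin r × Fin r) (c : Fin r) : ℕ :=
  let N := (p.1.val * r + p.2.val) * r
  if c.val < p.1.val then N + c.val
  else if c.val = p.1.val then r ^ 3
  else if c.val < p.2.val then r ^ 3 + 1 + N + c.val
  else if c.val = p.2.val then 2 * r ^ 3 + 1
  else 2 * r ^ 3 + 2 + N + c.val

lemma tau_N (r : ℕ) (p : Fin r × Fin r) : (p.1.val * r + p.2.val) * r + r ≤ r ^ 3 := by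
  have h1 := p.1.isLt
  have h2 := p.2.isLt
  have h3 : p.1.val * r + p.2.val + 1 ≤ r * r := by nlinarith
  calc _ = (p.1.val * r + p.2.val + 1) * r := by ring
    _ ≤ (r * r) * r := Nat.mul_le_mul_right _ h3
    _ = _ := by ring

lemma tau_N_ne (r : ℕ) (p q : Fin r × Fin r) (h : p ≠ q) :
    (p.1.val * r + p.2.val) * r + r ≤ (q.1.val * r + q.2.val) * r ∨
    (q.1.val * r + q.2.val) * r + r ≤ (p.1.val * r + p.2.val) * r := by
  have h1 := p.1.isLt
  have h2 := p.2.isLt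
  have h3 := q.1.isLt
  have h4 := q.2.isLt
  have hne : p.1.val * r + p.2.val ≠ q.1.val * r + q.2.val := by
    intro he
    apply h
    have e1 : p.1.val = q.1.val := by
      rcases lt_trichotomy p.1.val q.1.val with hlt | heq | hgt
      · nlinarith
      · exact heq
      · nlinarith
    have e2 : p.2.val = q.2.val := by rw [e1] at he; omega
    exact Prod.ext (Fin.ext e1) (Fin.ext e2)
  rcases lt_or_gt_of_ne hne with hlt | hgt
  · left
    calc _ = (p.1.val * r + p.2.val + 1) * r := by ring
      _ ≤ _ := Nat.mul_le_mul_right _ hlt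
  · right
    calc _ = (q.1.val * r + q.2.val + 1) * r := by ring
      _ ≤ _ := Nat.mul_le_mul_right _ hgt

lemma tau_lt (r : ℕ) (p : Fin r × Fin r) (c : Fin r) : tau r p c < 3 * r ^ 3 + 2 := by
  have h := tau_N r p
  have := c.isLt
  unfold tau
  dsimp only
  split_ifs <;> omega

lemma tau_mono (r : ℕ) (p : Fin r × Fin r) (hp : p.1 < p.2) : StrictMono (tau r p) := by
  intro c d hcd
  have h := tau_N r p
  have := c.isLt
  have := d.isLt
  have hcd' : c.val < d.val := hcd
  have hp' : p.1.val < p.2.val := hp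
  unfold tau
  dsimp only
  split_ifs <;> omega

lemma tau_fst (r : ℕ) (p : Fin r × Fin r) : tau r p p.1 = r ^ 3 := by
  unfold tau; simp

lemma tau_snd (r : ℕ) (p : Fin r × Fin r) (hp : p.1 < p.2) : tau r p p.2 = 2 * r ^ 3 + 1 := by
  have hp' : p.1.val < p.2.val := hp
  unfold tau; dsimp only; split_ifs <;> omega

lemma tau_inter (r : ℕ) (p q : Fin r × Fin r) (hpq : p ≠ q) (hp : p.1 < p.2) (hq : q.1 < q.2)
    (c d : Fin r) (h : tau r p c = tau r q d) : (c = p.1 ∨ c = p.2) := by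
  have h1 := tau_N r p
  have h2 := tau_N r q
  have h3 := tau_N_ne r p q hpq
  have := c.isLt
  have := d.isLt
  have hp' : p.1.val < p.2.val := hp
  have hq' : q.1.val < q.2.val := hq
  rw [Fin.ext_iff, Fin.ext_iff]
  unfold tau at h
  dsimp only at h
  split_ifs at h <;> omega

end P10

section P11
open scoped Classical

lemma card_filter_emb {A B : Type} [Fintype A] [LinearOrder A] [LinearOrder B] (e : A → B)
    (he : StrictMono e) (t : Finset B) (ht : ∀ v ∈ t, ∃ l, e l = v) :
    (Finset.univ.filter (fun l => e l ∈ t)).card = t.card := by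
  refine Finset.card_bij (fun l _ => e l) ?_ ?_ ?_
  · intro l hl; simpa using hl
  · intro a _ b _ h; exact he.injective h
  · intro v hv
    obtain ⟨l, rfl⟩ := ht v hv
    exact ⟨l, by simpa using hv, rfl⟩

lemma rank_emb {r : ℕ} {B : Type} [LinearOrder B] (h : Fin r → B) (hh : StrictMono h) (a : Fin r) :
    ((Finset.univ.image h).filter (fun v => v < h a)).card = a := by
  rw [← card_filter_emb h hh]
  · have : (Finset.univ.filter (fun l => h l ∈ (Finset.univ.image h).filter (fun v => v < h a))) =
      Finset.Iio a := by
      ext l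
      simp [hh.lt_iff_lt]
    rw [this, Fin.card_Iio]
  · intro v hv
    simp only [Finset.mem_filter, Finset.mem_image, Finset.mem_univ, true_and] at hv
    exact hv.1

lemma sigma_of {M r : ℕ} (h1 h2 : Fin r → Fin M) (hh1 : StrictMono h1)
    (hh2 : StrictMono h2) (a b c d : Fin r) (hab : a < b) (hcd : c < d) (hac : h1 a = h2 c)
    (hbd : h1 b = h2 d) (hne : (a, b) ≠ (c, d)) (t1 t2 : Finset (Fin M))
    (ht1 : t1 = Finset.univ.image h1) (ht2 : t2 = Finset.univ.image h2)
    (hinter : t1 ∩ t2 = {h1 a, h1 b}) (e : Fin (2 * r - 2) → Fin M) (he : StrictMono e)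
    (hT : ∀ v, v ∈ t1 ∪ t2 ↔ ∃ l, e l = v) :
    ∃ σ, SeqInconsistent r σ ∧ (∀ l, e l ∈ t1 ↔ σ l ≠ Letter.Y) ∧
      (∀ l, e l ∈ t2 ↔ σ l ≠ Letter.X) := by
  have hin : ∀ l, e l ∈ t1 ∨ e l ∈ t2 := fun l => Finset.mem_union.1 ((hT _).2 ⟨l, rfl⟩)
  have hc1 : t1.card = r := by
    rw [ht1, Finset.card_image_of_injective _ hh1.injective]; simp
  have hc2 : t2.card = r := by
    rw [ht2, Finset.card_image_of_injective _ hh2.injective]; simp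
  have hci : (t1 ∩ t2).card = 2 := by
    rw [hinter, Finset.card_pair (hh1 hab).ne]
  obtain ⟨σ, hσ⟩ : ∃ σ : Fin (2 * r - 2) → Letter, σ = fun l =>
    if e l ∈ t1 then (if e l ∈ t2 then Letter.Z else Letter.X) else Letter.Y := ⟨_, rfl⟩
  have hX : ∀ l, σ l = Letter.X ↔ e l ∈ t1 \ t2 := by
    intro l; rw [hσ, Finset.mem_sdiff]; dsimp only; split_ifs <;> simp_all
  have hY : ∀ l, σ l = Letter.Y ↔ e l ∈ t2 \ t1 := by
    intro l
    have := hin l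
    rw [hσ, Finset.mem_sdiff]
    dsimp only
    by_cases k1 : e l ∈ t1 <;> by_cases k2 : e l ∈ t2 <;> simp [k1, k2]
    exact absurd this (by tauto)
  have hZ : ∀ l, σ l = Letter.Z ↔ e l ∈ t1 ∩ t2 := by
    intro l; rw [hσ, Finset.mem_inter]; dsimp only; split_ifs <;> simp_all
  have hnY : ∀ l, e l ∈ t1 ↔ σ l ≠ Letter.Y := by
    intro l; have := hin l; rw [Ne, hY, Finset.mem_sdiff]; tauto
  have hnX : ∀ l, e l ∈ t2 ↔ σ l ≠ Letter.X := by
    intro l; have := hin l; rw [Ne, hX, Finset.mem_sdiff]; tauto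
  have hcard : ∀ t : Finset (Fin M), t ⊆ t1 ∪ t2 →
      (Finset.univ.filter (fun l => e l ∈ t)).card = t.card := fun t ht =>
    card_filter_emb e he t (fun v hv => (hT v).1 (ht hv))
  have hi : h1 a ∈ t1 ∩ t2 := by rw [hinter]; simp
  have hj : h1 b ∈ t1 ∩ t2 := by rw [hinter]; simp
  obtain ⟨la, hla⟩ := (hT (h1 a)).1 (Finset.inter_subset_union hi)
  obtain ⟨lb, hlb⟩ := (hT (h1 b)).1 (Finset.inter_subset_union hj)
  have hZset : Finset.univ.filter (fun i => σ i = Letter.Z) = {la, lb} := by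
    ext l
    simp only [Finset.mem_filter, Finset.mem_univ, true_and, hZ, hinter, Finset.mem_insert,
      Finset.mem_singleton, ← hla, ← hlb, he.injective.eq_iff]
  have rank1 : ∀ l (u : Fin r), e l = h1 u →
      (Finset.univ.filter (fun j => σ j ≠ Letter.Y ∧ j < l)).card = u := by
    intro l u hl
    rw [← rank_emb h1 hh1 u, ← ht1, ← hcard _ ((Finset.filter_subset _ _).trans Finset.subset_union_left)]
    congr 1
    ext j
    simp only [Finset.mem_filter, Finset.mem_univ, true_and, ← hnY, ← hl, he.lt_iff_lt]
  have rank2 : ∀ l (u : Fin r), e l = h2 u →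
      (Finset.univ.filter (fun j => σ j ≠ Letter.X ∧ j < l)).card = u := by
    intro l u hl
    rw [← rank_emb h2 hh2 u, ← ht2, ← hcard _ ((Finset.filter_subset _ _).trans Finset.subset_union_right)]
    congr 1
    ext j
    simp only [Finset.mem_filter, Finset.mem_univ, true_and, ← hnX, ← hl, he.lt_iff_lt]
  refine ⟨σ, ⟨⟨?_, ?_, ?_⟩, ?_⟩, hnY, hnX⟩
  · simp only [hX]
    rw [hcard _ (Finset.sdiff_subset.trans Finset.subset_union_left), Finset.card_sdiff,
      Finset.inter_comm, hci, hc1]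
  · simp only [hY]
    rw [hcard _ (Finset.sdiff_subset.trans Finset.subset_union_right), Finset.card_sdiff,
      hci, hc2]
  · simp only [hZ]
    rw [hcard _ Finset.inter_subset_union, hci]
  · intro hcons
    unfold SeqConsistent seqRole at hcons
    have hZset' : (Finset.univ.filter (fun i => σ i = Letter.Z)) = {la, lb} := hZset
    rw [hZset', Finset.image_insert, Finset.image_singleton, Finset.image_insert,
      Finset.image_singleton, rank1 la a hla, rank1 lb b hlb, rank2 la c (hla.trans hac),
      rank2 lb d (hlb.trans hbd)] at hcons
    have hab' : a.val < b.val := hab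
    have hcd' : c.val < d.val := hcd
    have m1 : a.val + 1 ∈ ({c.val + 1, d.val + 1} : Finset ℕ) := by rw [← hcons]; simp
    have m2 : b.val + 1 ∈ ({c.val + 1, d.val + 1} : Finset ℕ) := by rw [← hcons]; simp
    have m3 : c.val + 1 ∈ ({a.val + 1, b.val + 1} : Finset ℕ) := by rw [hcons]; simp
    simp only [Finset.mem_insert, Finset.mem_singleton] at m1 m2 m3
    apply hne
    rw [Prod.mk.injEq, Fin.ext_iff, Fin.ext_iff]
    omega

instance : Fintype Letter := ⟨{Letter.X, Letter.Y, Letter.Z}, fun x => by cases x <;> simp⟩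

/-- the Ramsey / pigeonhole part -/
lemma find_sigma (r : ℕ) (ε' : ℝ) (hε' : 0 < ε') (L n : ℕ) : ∃ M : ℕ, 0 < M ∧
    ∀ (good : Finset (Fin M) → Prop) (m : Finset (Fin M) → Fin M → Fin M → ℝ)
      (P : Finset (Fin M) → Finset (Fin M) → Fin M → Fin M → Prop),
      (∀ I : Finset (Fin M), I.card = L → ∃ t ∈ I.powersetCard r, good t) →
      (∀ t i j, i ≠ j → 0 ≤ m t i j ∧ m t i j ≤ 1) →
      (∀ t (h : t.card = r), good t → 1 + ε' < ∑ p ∈ rpairs r,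
        m t (t.orderEmbOfFin h p.1) (t.orderEmbOfFin h p.2)) →
      (∀ i j, i < j → ∀ t : Fin r × Fin r → Finset (Fin M),
        1 + ε' / 2 < ∑ p ∈ rpairs r, m (t p) i j →
        ∃ p ∈ rpairs r, ∃ q ∈ rpairs r, p ≠ q ∧ P (t p) (t q) i j) →
      ∃ σ, SeqInconsistent r σ ∧ ∃ I : Finset (Fin M), I.card = n ∧
        ∀ w : Fin (2 * r - 2) → Fin M, StrictMono w → (∀ l, w l ∈ I) → ∀ l1 l2, l1 < l2 →
          σ l1 = Letter.Z → σ l2 = Letter.Z →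
          P ((Finset.univ.filter (fun l => σ l ≠ Letter.Y)).image w)
            ((Finset.univ.filter (fun l => σ l ≠ Letter.X)).image w) (w l1) (w l2) := by
  obtain ⟨Q, hQ⟩ := exists_nat_gt (2 * (r.choose 2 : ℝ) / ε')
  have hQ0 : (0:ℝ) < Q := lt_of_le_of_lt (by positivity) hQ
  set n' := n + (3 * r ^ 3 + 2) with hn'
  obtain ⟨M2, hM2⟩ := ramsey (Set (Fin (2 * r - 2) → Letter)) (2 * r - 2) n'
  obtain ⟨M1, hM1⟩ := ramsey (Prop × (Fin r × Fin r → Fin (Q + 1))) r (M2 + L + r)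
  obtain ⟨M, hMd⟩ : ∃ M, M = M1 + 1 := ⟨_, rfl⟩
  refine ⟨M, by omega, ?_⟩
  intro good m P hgood hm hsum hpig
  -- first colouring
  obtain ⟨T1, -, hT1c, ⟨g, f⟩, hT1⟩ := hM1 (Fin M) Finset.univ (by simp [hMd])
    (fun t => (good t, fun p => if h : t.card = r then
      ⟨min Q (⌊Q * m t (t.orderEmbOfFin h p.1) (t.orderEmbOfFin h p.2)⌋₊), by omega⟩ else 0))
  -- good
  have hg : g := by
    obtain ⟨I, hI, hIc⟩ := Finset.exists_subset_card_eq (show L ≤ T1.card by omega)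
    obtain ⟨t, ht, htg⟩ := hgood I hIc
    rw [Finset.mem_powersetCard] at ht
    have := hT1 t (ht.1.trans hI) ht.2
    rw [Prod.mk.injEq] at this
    rw [← this.1]; exact htg
  have hm1 : ∀ t ⊆ T1, ∀ (h : t.card = r), ∀ p ∈ rpairs r,
      ((f p : ℕ) : ℝ) ≤ Q * m t (t.orderEmbOfFin h p.1) (t.orderEmbOfFin h p.2) ∧
      Q * m t (t.orderEmbOfFin h p.1) (t.orderEmbOfFin h p.2) < (f p : ℕ) + 1 := by
    intro t ht h p hp
    simp only [rpairs, Finset.mem_filter, Finset.mem_univ, true_and] at hp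
    have h1 := hT1 t ht h
    rw [Prod.mk.injEq] at h1
    have h2 := congrFun h1.2 p
    rw [dif_pos h] at h2
    rw [← h2]
    obtain ⟨hm0, hm1⟩ := hm t (t.orderEmbOfFin h p.1) (t.orderEmbOfFin h p.2) (by
      intro he; exact hp.ne ((t.orderEmbOfFin h).injective he))
    have hle : ⌊Q * m t (t.orderEmbOfFin h p.1) (t.orderEmbOfFin h p.2)⌋₊ ≤ Q := by
      rw [← Nat.floor_natCast (R := ℝ) Q]
      apply Nat.floor_le_floor
      rw [Nat.floor_natCast]
      nlinarith
    dsimp only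
    rw [min_eq_right hle]
    exact ⟨Nat.floor_le (by positivity), Nat.lt_floor_add_one _⟩
  have hfsum : 1 + ε' / 2 < ∑ p ∈ rpairs r, ((f p : ℕ) : ℝ) / Q := by
    obtain ⟨t, ht, htc⟩ := Finset.exists_subset_card_eq (show r ≤ T1.card by omega)
    have hgt : good t := by
      have := hT1 t ht htc
      rw [Prod.mk.injEq] at this
      rw [this.1]; exact hg
    have h1 := hsum t htc hgt
    have h2 : ∑ p ∈ rpairs r, m t (t.orderEmbOfFin htc p.1) (t.orderEmbOfFin htc p.2) ≤
        ∑ p ∈ rpairs r, (((f p : ℕ) : ℝ) / Q + 1 / Q) := by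
      refine Finset.sum_le_sum fun p hp => ?_
      rw [← add_div, le_div_iff₀ hQ0]
      have := (hm1 t ht htc p hp).2
      linarith
    rw [Finset.sum_add_distrib, Finset.sum_const, rpairs_card, nsmul_eq_mul] at h2
    have h3 : (r.choose 2 : ℝ) * (1 / Q) ≤ ε' / 2 := by
      rw [div_lt_iff₀ hε'] at hQ
      rw [mul_one_div, div_le_iff₀ hQ0]
      linarith
    linarith
  -- second colouring
  obtain ⟨T2, hT21, hT2c, κ, hT2⟩ := hM2 (Fin M) T1 (by omega)
    (fun T => {σ | ∀ w : Fin (2 * r - 2) → Fin M, StrictMono w → Finset.univ.image w = T →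
        ∀ l1 l2, l1 < l2 → σ l1 = Letter.Z → σ l2 = Letter.Z →
          P ((Finset.univ.filter (fun l => σ l ≠ Letter.Y)).image w)
            ((Finset.univ.filter (fun l => σ l ≠ Letter.X)).image w) (w l1) (w l2)})
  -- pigeonhole
  have hT2c' : T2.card = n' := hT2c
  set gg : Fin n' → Fin M := (fun x => T2.orderEmbOfFin hT2c' x) with hgg
  have hggm : StrictMono gg := (T2.orderEmbOfFin hT2c').strictMono
  have hggT : ∀ x, gg x ∈ T2 := fun x => Finset.orderEmbOfFin_mem T2 hT2c' x
  have hlt : ∀ p c, tau r p c < n' := fun p c => lt_of_lt_of_le (tau_lt r p c) (by omega)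
  set hmap : Fin r × Fin r → Fin r → Fin M := fun p c => gg ⟨tau r p c, hlt p c⟩ with hmapd
  have hmapm : ∀ p ∈ rpairs r, StrictMono (hmap p) := by
    intro p hp c d hcd
    simp only [rpairs, Finset.mem_filter, Finset.mem_univ, true_and] at hp
    exact hggm (by rw [Fin.mk_lt_mk]; exact tau_mono r p hp hcd)
  set tt : Fin r × Fin r → Finset (Fin M) := fun p => Finset.univ.image (hmap p) with htt
  have httc : ∀ p ∈ rpairs r, (tt p).card = r := by
    intro p hp
    rw [htt]; dsimp only
    rw [Finset.card_image_of_injective _ (hmapm p hp).injective]; simp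
  have htT2 : ∀ p, tt p ⊆ T2 := by
    intro p v hv
    obtain ⟨c, -, rfl⟩ := Finset.mem_image.1 hv
    exact hggT _
  set i0 := gg ⟨r ^ 3, by omega⟩ with hi0
  set j0 := gg ⟨2 * r ^ 3 + 1, by omega⟩ with hj0
  have hij : i0 < j0 := hggm (by rw [Fin.mk_lt_mk]; omega)
  have hfst : ∀ p, hmap p p.1 = i0 := by
    intro p; rw [hmapd, hi0]; dsimp only; congr 2; exact tau_fst r p
  have hsnd : ∀ p ∈ rpairs r, hmap p p.2 = j0 := by
    intro p hp
    simp only [rpairs, Finset.mem_filter, Finset.mem_univ, true_and] at hp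
    rw [hmapd, hj0]; dsimp only; congr 2; exact tau_snd r p hp
  have hord : ∀ p (hp : p ∈ rpairs r) c, (tt p).orderEmbOfFin (httc p hp) c = hmap p c := by
    intro p hp c
    have := Finset.orderEmbOfFin_unique (httc p hp) (f := hmap p)
      (fun x => Finset.mem_image_of_mem _ (Finset.mem_univ x)) (hmapm p hp)
    rw [this]
  obtain ⟨p, hp, q, hq, hpq, hPpq⟩ := hpig i0 j0 hij tt (by
    refine lt_of_lt_of_le hfsum (Finset.sum_le_sum fun p hp => ?_)
    have := (hm1 (tt p) ((htT2 p).trans hT21) (httc p hp) p hp).1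
    rw [hord p hp, hord p hp, hfst, hsnd p hp] at this
    rw [div_le_iff₀ hQ0]; linarith)
  have hp' : p.1 < p.2 := by simpa [rpairs] using hp
  have hq' : q.1 < q.2 := by simpa [rpairs] using hq
  have hinter : tt p ∩ tt q = {hmap p p.1, hmap p p.2} := by
    ext v
    simp only [Finset.mem_inter, Finset.mem_insert, Finset.mem_singleton]
    constructor
    · rintro ⟨h1, h2⟩
      obtain ⟨c, -, rfl⟩ := Finset.mem_image.1 h1
      obtain ⟨d, -, hd⟩ := Finset.mem_image.1 h2
      have : tau r p c = tau r q d := by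
        have := hggm.injective hd
        rw [Fin.mk.injEq] at this
        exact this.symm
      rcases tau_inter r p q hpq hp' hq' c d this with rfl | rfl
      · left; rfl
      · right; rfl
    · rintro (rfl | rfl)
      · exact ⟨Finset.mem_image_of_mem _ (Finset.mem_univ _), by
          rw [hfst, ← hfst q]; exact Finset.mem_image_of_mem _ (Finset.mem_univ _)⟩
      · exact ⟨Finset.mem_image_of_mem _ (Finset.mem_univ _), by
          rw [hsnd p hp, ← hsnd q hq]; exact Finset.mem_image_of_mem _ (Finset.mem_univ _)⟩
  have hTc : (tt p ∪ tt q).card = 2 * r - 2 := by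
    rw [Finset.card_union, httc p hp, httc q hq, hinter,
      Finset.card_pair ((hmapm p hp) hp').ne]
    omega
  have hTsub : tt p ∪ tt q ⊆ T2 := Finset.union_subset (htT2 p) (htT2 q)
  have hTv : ∀ v, v ∈ tt p ∪ tt q ↔ ∃ l, (tt p ∪ tt q).orderEmbOfFin hTc l = v := by
    intro v
    have := Finset.range_orderEmbOfFin (tt p ∪ tt q) hTc
    rw [← Finset.mem_coe, ← this]; rfl
  obtain ⟨σ, hσ, hσ1, hσ2⟩ := sigma_of (hmap p) (hmap q) (hmapm p hp) (hmapm q hq) p.1 p.2 q.1 q.2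
    hp' hq' (by rw [hfst, hfst]) (by rw [hsnd p hp, hsnd q hq]) hpq (tt p) (tt q) rfl rfl hinter
    ((tt p ∪ tt q).orderEmbOfFin hTc) ((tt p ∪ tt q).orderEmbOfFin hTc).strictMono hTv
  have hσκ : σ ∈ κ := by
    rw [← hT2 _ hTsub hTc]
    intro w hw hwT l1 l2 hl hz1 hz2
    have hwe : w = (tt p ∪ tt q).orderEmbOfFin hTc :=
      Finset.orderEmbOfFin_unique hTc (fun x => by
        rw [← hwT]; exact Finset.mem_image_of_mem _ (Finset.mem_univ x)) hw
    have e1 : (Finset.univ.filter (fun l => σ l ≠ Letter.Y)).image w = tt p := by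
      ext v
      simp only [Finset.mem_image, Finset.mem_filter, Finset.mem_univ, true_and]
      constructor
      · rintro ⟨l, hl, rfl⟩; rw [hwe]; exact (hσ1 l).2 hl
      · intro hv
        obtain ⟨l, hl⟩ := (hTv v).1 (Finset.mem_union_left _ hv)
        exact ⟨l, (hσ1 l).1 (by rw [hl]; exact hv), by rw [hwe]; exact hl⟩
    have e2 : (Finset.univ.filter (fun l => σ l ≠ Letter.X)).image w = tt q := by
      ext v
      simp only [Finset.mem_image, Finset.mem_filter, Finset.mem_univ, true_and]
      constructor
      · rintro ⟨l, hl, rfl⟩; rw [hwe]; exact (hσ2 l).2 hl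
      · intro hv
        obtain ⟨l, hl⟩ := (hTv v).1 (Finset.mem_union_right _ hv)
        exact ⟨l, (hσ2 l).1 (by rw [hl]; exact hv), by rw [hwe]; exact hl⟩
    have hz : ∀ l, σ l = Letter.Z → w l = i0 ∨ w l = j0 := by
      intro l hl
      have : w l ∈ tt p ∩ tt q := by
        rw [Finset.mem_inter, hwe]
        exact ⟨(hσ1 l).2 (by rw [hl]; decide), (hσ2 l).2 (by rw [hl]; decide)⟩
      rw [hinter, hfst, hsnd p hp] at this
      simpa using this
    have hww := hw hl
    rw [e1, e2]
    rcases hz l1 hz1 with h1 | h1 <;> rcases hz l2 hz2 with h2 | h2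
    · rw [h1, h2] at hww; exact absurd hww (lt_irrefl _)
    · rw [h1, h2]; exact hPpq
    · rw [h1, h2] at hww; exact absurd (hww.trans hij) (lt_irrefl _)
    · rw [h1, h2] at hww; exact absurd hww (lt_irrefl _)
  obtain ⟨I, hI, hIc⟩ := Finset.exists_subset_card_eq (show n ≤ T2.card by omega)
  refine ⟨σ, hσ, I, hIc, ?_⟩
  intro w hw hwI
  have hsub : Finset.univ.image w ⊆ T2 := by
    intro v hv
    obtain ⟨l, -, rfl⟩ := Finset.mem_image.1 hv
    exact hI (hwI l)
  have := hT2 (Finset.univ.image w) hsub (by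
    rw [Finset.card_image_of_injective _ hw.injective]; simp)
  rw [← this] at hσκ
  exact hσκ w hw rfl

end P11

section P12
open scoped Classical

lemma pigeon {κ : Type} (S : Finset κ) (R : κ → ℕ → ℕ → Prop) (X Y : Finset ℕ) :
    2 * ∑ p ∈ S, cnt (R p) X Y ≤ X.card * Y.card +
      ∑ p ∈ S, ∑ q ∈ S, cnt (fun a b => R p a b ∧ R q a b) X Y := by
  have e1 : ∀ Q : ℕ → ℕ → Prop, cnt Q X Y = ∑ z ∈ X ×ˢ Y, if Q z.1 z.2 then (1:ℝ) else 0 := by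
    intro Q; rw [cnt_eq_sum, Finset.sum_product]
  have e2 : ∑ p ∈ S, cnt (R p) X Y = ∑ z ∈ X ×ˢ Y, ∑ p ∈ S, if R p z.1 z.2 then (1:ℝ) else 0 := by
    rw [Finset.sum_comm]; exact Finset.sum_congr rfl fun p _ => e1 _
  have e3 : ∑ p ∈ S, ∑ q ∈ S, cnt (fun a b => R p a b ∧ R q a b) X Y =
      ∑ z ∈ X ×ˢ Y, (∑ p ∈ S, if R p z.1 z.2 then (1:ℝ) else 0) *
        (∑ p ∈ S, if R p z.1 z.2 then (1:ℝ) else 0) := by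
    simp only [Finset.sum_mul_sum]
    rw [Finset.sum_comm (s := X ×ˢ Y)]
    refine Finset.sum_congr rfl fun p _ => ?_
    rw [Finset.sum_comm (s := X ×ˢ Y)]
    refine Finset.sum_congr rfl fun q _ => ?_
    rw [e1]
    refine Finset.sum_congr rfl fun z _ => ?_
    by_cases h1 : R p z.1 z.2 <;> by_cases h2 : R q z.1 z.2 <;> simp [h1, h2]
  have e4 : (X.card * Y.card : ℝ) = ∑ z ∈ X ×ˢ Y, (1:ℝ) := by simp
  rw [e2, e3, e4, Finset.mul_sum, ← Finset.sum_add_distrib]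
  refine Finset.sum_le_sum fun z _ => ?_
  nlinarith [sq_nonneg ((∑ p ∈ S, if R p z.1 z.2 then (1:ℝ) else 0) - 1)]

lemma exists_parts (M s : ℕ) (U : Finset ℕ) (h : M * s ≤ U.card) :
    ∃ V : Fin M → Finset ℕ, (∀ i, V i ⊆ U) ∧ (∀ i, (V i).card = s) ∧
      ∀ i j, i ≠ j → Disjoint (V i) (V j) := by
  have hb : ∀ (i : Fin M) (x : Fin s), i.val * s + x.val < U.card := by
    intro i x
    have h1 := i.isLt
    have h2 := x.isLt
    have : (i.val + 1) * s ≤ M * s := Nat.mul_le_mul_right _ h1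
    nlinarith
  have hinj : ∀ i j x y, i.val * s + x.val = j.val * s + (y:Fin s).val → i = (j : Fin M) ∧ x = (y : Fin s) := by
    intro i j x y he
    have h1 := x.isLt
    have h2 := y.isLt
    have e1 : i.val = j.val := by
      rcases lt_trichotomy i.val j.val with hlt | heq | hgt
      · have : (i.val + 1) * s ≤ j.val * s := Nat.mul_le_mul_right _ hlt
        nlinarith
      · exact heq
      · have : (j.val + 1) * s ≤ i.val * s := Nat.mul_le_mul_right _ hgt
        nlinarith
    have e2 : x.val = y.val := by rw [e1] at he; omega
    exact ⟨Fin.ext e1, Fin.ext e2⟩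
  refine ⟨fun i => (Finset.univ : Finset (Fin s)).image
    (fun x => U.orderEmbOfFin rfl ⟨i.val * s + x.val, hb i x⟩), ?_, ?_, ?_⟩
  · intro i v hv
    obtain ⟨x, -, rfl⟩ := Finset.mem_image.1 hv
    exact Finset.orderEmbOfFin_mem _ _ _
  · intro i
    rw [Finset.card_image_of_injective]
    · simp
    · intro x y hxy
      have := (U.orderEmbOfFin rfl).injective hxy
      rw [Fin.mk.injEq] at this
      exact (hinj i i x y this).2
  · intro i j hij
    rw [Finset.disjoint_left]
    intro v h1 h2
    obtain ⟨x, -, rfl⟩ := Finset.mem_image.1 h1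
    obtain ⟨y, -, hy⟩ := Finset.mem_image.1 h2
    have := (U.orderEmbOfFin rfl).injective hy
    rw [Fin.mk.injEq] at this
    exact hij (hinj j i y x this).1.symm

lemma exists_rank_map {M : ℕ} (hM : 0 < M) (U : Finset ℕ) (ord : ℕ → ℕ) 
    (I : Finset (Fin M)) (hI : I.card = U.card) :
    ∃ φ : ℕ → Fin M, (∀ u ∈ U, φ u ∈ I) ∧
      ∀ u ∈ U, ∀ v ∈ U, ord u < ord v → φ u < φ v := by
  have hr : ∀ v ∈ U, (U.filter (fun u => ord u < ord v)).card < U.card := by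
    intro v hv
    apply Finset.card_lt_card
    refine Finset.filter_ssubset.2 ⟨v, hv, lt_irrefl _⟩
  refine ⟨fun v => if h : v ∈ U then I.orderEmbOfFin hI ⟨_, hr v h⟩ else ⟨0, hM⟩, ?_, ?_⟩
  · intro u hu
    simp only [hu, dif_pos]
    exact Finset.orderEmbOfFin_mem _ _ _
  · intro u hu v hv huv
    simp only [hu, hv, dif_pos]
    apply (I.orderEmbOfFin hI).strictMono
    rw [Fin.mk_lt_mk]
    apply Finset.card_lt_card
    refine ⟨?_, ?_⟩
    · intro w hw
      simp only [Finset.mem_filter] at hw ⊢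
      exact ⟨hw.1, hw.2.trans huv⟩
    · intro hsub
      have : u ∈ U.filter (fun w => ord w < ord u) := hsub (by simp [hu, huv])
      simp at this

lemma embed_F {r M : ℕ} (hM : 0 < M) (F : RGraph r) (hql : QuasiLinear F)
    (σ : Fin (2 * r - 2) → Letter) (hadm : AdmitsSeq F σ) (μ η : ℝ) (H : Finset (Finset ℕ))
    (W : Fin M → Finset ℕ) (hemb : EmbProp F.edges.card μ η H W)
    (hdisj : ∀ i j, i ≠ j → Disjoint (W i) (W j))
    (I : Finset (Fin M)) (hI : I.card = F.verts.card)
    (hP : ∀ w : Fin (2 * r - 2) → Fin M, StrictMono w → (∀ l, w l ∈ I) → ∀ l1 l2, l1 < l2 →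
          σ l1 = Letter.Z → σ l2 = Letter.Z →
          2 * μ * ((W (w l1)).card * (W (w l2)).card) ≤ cnt (fun x y =>
          DD H ((Finset.univ.filter (fun l => σ l ≠ Letter.Y)).image w) (w l1) (w l2) W η x y ∧
          DD H ((Finset.univ.filter (fun l => σ l ≠ Letter.X)).image w) (w l1) (w l2) W η x y)
          (W (w l1)) (W (w l2))) :
    ∃ ψ : ℕ → ℕ, Set.InjOn ψ ↑F.verts ∧ (∀ v ∈ F.verts, ∃ i, ψ v ∈ W i) ∧
      ∀ e ∈ F.edges, e.image ψ ∈ H := by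
  obtain ⟨ord, hord, hdesc⟩ := hadm
  obtain ⟨φ, hφI, hφ⟩ := exists_rank_map hM F.verts ord I hI
  have hφinj : Set.InjOn φ ↑F.verts := by
    intro u hu v hv huv
    by_contra hne
    have : ord u ≠ ord v := fun h => hne (hord hu hv h)
    rcases lt_or_gt_of_ne this with h | h
    · exact absurd huv (hφ u hu v hv h).ne
    · exact absurd huv (hφ v hv u hu h).ne'
  have hin : ∀ e ∈ F.edges, ∀ g ∈ F.edges, e.image φ ∩ g.image φ = (e ∩ g).image φ := by
    intro e he g hg
    refine (Finset.image_inter_of_injOn _ _ (hφinj.mono ?_)).symm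
    intro v hv
    rcases hv with hv | hv
    · exact F.edges_subset e he hv
    · exact F.edges_subset g hg hv
  have htw : ∀ e, ∃ f u v, e ∈ F.edges → (f ∈ F.edges ∧ f ≠ e ∧ e ∩ f = {u, v} ∧ ord u < ord v ∧
      ∀ f' ∈ F.edges, f' ≠ e → f' ≠ f → (e ∩ f').card ≤ 1) := by
    intro e
    by_cases he : e ∈ F.edges
    swap
    · exact ⟨∅, 0, 0, fun h => absurd h he⟩
    obtain ⟨f, hf, hfe, hc, huniq⟩ := hql e he
    obtain ⟨u, v, huv, h⟩ := Finset.card_eq_two.1 hc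
    have hue : u ∈ e ∩ f := by rw [h]; simp
    have hve : v ∈ e ∩ f := by rw [h]; simp
    have hne : ord u ≠ ord v := fun h' => huv (hord
      (F.edges_subset e he (Finset.mem_inter.1 hue).1) (F.edges_subset e he (Finset.mem_inter.1 hve).1) h')
    rcases lt_or_gt_of_ne hne with h' | h'
    · exact ⟨f, u, v, fun _ => ⟨hf, hfe, h, h', huniq⟩⟩
    · exact ⟨f, v, u, fun _ => ⟨hf, hfe, by rw [h, Finset.pair_comm], h', huniq⟩⟩
  choose f u v htw using htw
  have hue : ∀ e ∈ F.edges, u e ∈ e ∧ u e ∈ f e := by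
    intro e he
    rw [← Finset.mem_inter, (htw e he).2.2.1]; simp
  have hve : ∀ e ∈ F.edges, v e ∈ e ∧ v e ∈ f e := by
    intro e he
    rw [← Finset.mem_inter, (htw e he).2.2.1]; simp
  have huV : ∀ e ∈ F.edges, u e ∈ F.verts := fun e he => F.edges_subset e he (hue e he).1
  have hvV : ∀ e ∈ F.edges, v e ∈ F.verts := fun e he => F.edges_subset e he (hve e he).1
  have huv : ∀ e ∈ F.edges, φ (u e) < φ (v e) := fun e he =>
    hφ _ (huV e he) _ (hvV e he) (htw e he).2.2.2.1
  -- two edges sharing two vertices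
  have hshare : ∀ e ∈ F.edges, ∀ g ∈ F.edges, g ≠ e → 2 ≤ (e ∩ g).card →
      g = f e := by
    intro e he g hg hge h2
    by_contra hgf
    have := (htw e he).2.2.2.2 g hg hge hgf
    omega
  have htwuv : ∀ e ∈ F.edges, u (f e) = u e ∧ v (f e) = v e := by
    intro e he
    obtain ⟨hf, hfe, hinter, hlt, -⟩ := htw e he
    have hne : u e ≠ v e := fun h => by rw [h] at hlt; exact lt_irrefl _ hlt
    have h1 : e = f (f e) := hshare (f e) hf e he hfe.symm (by
      rw [Finset.inter_comm, hinter, Finset.card_pair hne])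
    obtain ⟨-, -, hinter', hlt', -⟩ := htw (f e) hf
    rw [← h1, Finset.inter_comm, hinter] at hinter'
    have m1 : u e ∈ ({u (f e), v (f e)} : Finset ℕ) := by rw [← hinter']; simp
    have m2 : v e ∈ ({u (f e), v (f e)} : Finset ℕ) := by rw [← hinter']; simp
    simp only [Finset.mem_insert, Finset.mem_singleton] at m1 m2
    rcases m1 with m1 | m1 <;> rcases m2 with m2 | m2
    · exact absurd (m1.trans m2.symm) hne
    · exact ⟨m1.symm, m2.symm⟩
    · rw [m1, m2] at hlt; omega
    · exact absurd (m1.trans m2.symm) hne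
  have himg : ∀ e ∈ F.edges, ∀ g ∈ F.edges, e.image φ = g.image φ → e = g := by
    have key : ∀ e ∈ F.edges, ∀ g ∈ F.edges, e.image φ = g.image φ → e ⊆ g := by
      intro e he g hg h x hx
      have : φ x ∈ g.image φ := by rw [← h]; exact Finset.mem_image_of_mem _ hx
      obtain ⟨y, hy, hxy⟩ := Finset.mem_image.1 this
      have := hφinj (F.edges_subset g hg hy) (F.edges_subset e he hx) hxy
      rw [← this]; exact hy
    exact fun e he g hg h => Finset.Subset.antisymm (key e he g hg h) (key g hg e he h.symm)
  set S : Finset (Finset (Fin M) × Fin M × Fin M) :=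
    F.edges.image (fun e => (e.image φ, φ (u e), φ (v e))) with hS
  obtain ⟨x, hx, hxE⟩ := hemb S (by
      rw [hS, Finset.card_image_of_injOn]
      intro e he g hg h
      rw [Prod.mk.injEq] at h
      exact himg e he g hg h.1) (by
      intro a ha
      obtain ⟨e, he, rfl⟩ := Finset.mem_image.1 ha
      exact ⟨Finset.mem_image_of_mem _ (hue e he).1, Finset.mem_image_of_mem _ (hve e he).1,
        (huv e he).ne⟩) (by
      intro a ha b hb hab
      obtain ⟨e, he, rfl⟩ := Finset.mem_image.1 ha
      obtain ⟨g, hg, rfl⟩ := Finset.mem_image.1 hb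
      have hge : g ≠ e := by rintro rfl; exact hab rfl
      dsimp only
      rw [hin g hg e he]
      by_cases h : g = f e
      · left
        subst h
        rw [(htwuv e he).1, (htwuv e he).2]
        refine ⟨rfl, ?_⟩
        rw [Finset.inter_comm, (htw e he).2.2.1, Finset.image_insert, Finset.image_singleton]
      · right
        refine Finset.card_image_le.trans ?_
        rw [Finset.inter_comm]
        exact (htw e he).2.2.2.2 g hg hge h) (by
      intro a ha
      obtain ⟨e, he, rfl⟩ := Finset.mem_image.1 ha
      dsimp only
      obtain ⟨hf, hfe, hinter, hlt, -⟩ := htw e he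
      have hne : u e ≠ v e := fun h => by rw [h] at hlt; exact lt_irrefl _ hlt
      obtain ⟨w, hw, hwr, hor⟩ := hdesc e (f e) ⟨he, hf, hfe.symm, by rw [hinter, Finset.card_pair hne]⟩
      have hwV : ∀ l, w l ∈ F.verts := by
        intro l
        rcases Finset.mem_union.1 ((hwr (w l)).2 ⟨l, rfl⟩) with h | h
        · exact F.edges_subset e he h
        · exact F.edges_subset _ hf h
      have hP' := hP (fun l => φ (w l)) (fun l l' hl => hφ _ (hwV l) _ (hwV l') (hw l l' hl))
        (fun l => hφI _ (hwV l))
      obtain ⟨l1, hl1⟩ := (hwr (u e)).1 (Finset.mem_union_left _ (hue e he).1)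
      obtain ⟨l2, hl2⟩ := (hwr (v e)).1 (Finset.mem_union_left _ (hve e he).1)
      have hl12 : l1 < l2 := by
        rcases lt_trichotomy l1 l2 with h | h | h
        · exact h
        · rw [h] at hl1; exact absurd (hl1.symm.trans hl2) hne
        · have := hw l2 l1 h
          rw [hl1, hl2] at this; omega
      have hZ : ∀ s : Letter, s ≠ Letter.Y → s ≠ Letter.X → s = Letter.Z := by
        intro s; cases s <;> simp
      have hz1 : σ l1 = Letter.Z := by
        have k1 := (hue e he).1
        have k2 := (hue e he).2
        rw [← hl1] at k1 k2
        rcases hor with ⟨h1, h2⟩ | ⟨h1, h2⟩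
        · exact hZ _ ((h1 l1).1 k1) ((h2 l1).1 k2)
        · exact hZ _ ((h2 l1).1 k2) ((h1 l1).1 k1)
      have hz2 : σ l2 = Letter.Z := by
        have k1 := (hve e he).1
        have k2 := (hve e he).2
        rw [← hl2] at k1 k2
        rcases hor with ⟨h1, h2⟩ | ⟨h1, h2⟩
        · exact hZ _ ((h1 l2).1 k1) ((h2 l2).1 k2)
        · exact hZ _ ((h2 l2).1 k2) ((h1 l2).1 k1)
      have hP'' := hP' l1 l2 hl12 hz1 hz2
      rw [hl1, hl2] at hP''
      refine ⟨_, _, ?_, hP''⟩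
      have himgs : ∀ g ⊆ e ∪ f e, ∀ s : Letter, (∀ i, w i ∈ g ↔ σ i ≠ s) →
          g.image φ = (Finset.univ.filter (fun l => σ l ≠ s)).image (fun l => φ (w l)) := by
        intro g hg s hs
        ext y
        simp only [Finset.mem_image, Finset.mem_filter, Finset.mem_univ, true_and]
        constructor
        · rintro ⟨z, hz, rfl⟩
          obtain ⟨l, rfl⟩ := (hwr z).1 (hg hz)
          exact ⟨l, (hs l).1 hz, rfl⟩
        · rintro ⟨l, hl, rfl⟩
          exact ⟨w l, (hs l).2 hl, rfl⟩
      intro b hb hbe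
      obtain ⟨g, hg, rfl⟩ := Finset.mem_image.1 hb
      dsimp only at hbe ⊢
      rw [Prod.mk.injEq] at hbe
      have g1 : u g = u e := hφinj (huV g hg) (huV e he) hbe.1
      have g2 : v g = v e := hφinj (hvV g hg) (hvV e he) hbe.2
      have hgef : g = e ∨ g = f e := by
        by_cases hge : g = e
        · left; exact hge
        · right
          refine hshare e he g hg hge ?_
          rw [← Finset.card_pair hne]
          apply Finset.card_le_card
          intro y hy
          simp only [Finset.mem_insert, Finset.mem_singleton] at hy
          rw [Finset.mem_inter]
          rcases hy with rfl | rfl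
          · exact ⟨(hue e he).1, g1 ▸ (hue g hg).1⟩
          · exact ⟨(hve e he).1, g2 ▸ (hve g hg).1⟩
      rcases hor with ⟨h1, h2⟩ | ⟨h1, h2⟩ <;> rcases hgef with rfl | rfl
      · left; exact himgs _ Finset.subset_union_left _ h1
      · right; exact himgs _ Finset.subset_union_right _ h2
      · right; exact himgs _ Finset.subset_union_left _ h1
      · left; exact himgs _ Finset.subset_union_right _ h2)
  rw [Fintype.mem_piFinset] at hx
  refine ⟨fun v => x (φ v), ?_, fun v _ => ⟨φ v, hx _⟩, ?_⟩
  · intro a ha b hb hab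
    apply hφinj ha hb
    by_contra hne
    exact Finset.disjoint_left.1 (hdisj _ _ hne) (hx (φ a)) (by
      have : x (φ a) = x (φ b) := hab
      rw [this]; exact hx _)
  · intro e he
    have := hxE (e.image φ, φ (u e), φ (v e)) (Finset.mem_image_of_mem _ he)
    unfold Eh at this
    dsimp only at this
    rw [Finset.image_image] at this
    exact this

end P12

section P13
open scoped Classical

lemma pigeon_apply {κ : Type} (S : Finset κ) (R : κ → ℕ → ℕ → Prop) (X Y : Finset ℕ) (m : κ → ℝ)
    (ε' μ : ℝ) (hX : X.Nonempty) (hY : Y.Nonempty) (hμ : 0 ≤ μ)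
    (hμ' : 2 * (S.card : ℝ) ^ 2 * μ ≤ ε' / 2)
    (hm : ∀ p ∈ S, m p * (X.card * Y.card) ≤ cnt (R p) X Y) (hs : 1 + ε' / 2 < ∑ p ∈ S, m p) :
    ∃ p ∈ S, ∃ q ∈ S, p ≠ q ∧
      2 * μ * (X.card * Y.card) ≤ cnt (fun a b => R p a b ∧ R q a b) X Y := by
  by_contra hcon
  push Not at hcon
  have h1 := pigeon S R X Y
  have hXY : (0:ℝ) < X.card * Y.card := by
    have := hX.card_pos
    have := hY.card_pos
    positivity
  have h2 : ∑ p ∈ S, ∑ q ∈ S, cnt (fun a b => R p a b ∧ R q a b) X Y ≤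
      ∑ p ∈ S, ∑ q ∈ S, ((if p = q then cnt (R p) X Y else 0) + 2 * μ * (X.card * Y.card)) := by
    refine Finset.sum_le_sum fun p hp => Finset.sum_le_sum fun q hq => ?_
    by_cases hpq : p = q
    · subst hpq
      rw [if_pos rfl]
      have : cnt (fun a b => R p a b ∧ R p a b) X Y = cnt (R p) X Y := by
        congr 1; ext a b; simp
      rw [this]
      have : 0 ≤ 2 * μ * (X.card * Y.card : ℝ) := by positivity
      linarith
    · rw [if_neg hpq, zero_add]
      exact (hcon p hp q hq hpq).le
  have h3 : ∑ p ∈ S, ∑ q ∈ S, ((if p = q then cnt (R p) X Y else 0) + 2 * μ * (X.card * Y.card)) =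
      ∑ p ∈ S, cnt (R p) X Y + (2 * (S.card : ℝ) ^ 2 * μ) * (X.card * Y.card) := by
    simp only [Finset.sum_add_distrib, Finset.sum_const, nsmul_eq_mul]
    congr 1
    · refine Finset.sum_congr rfl fun p hp => ?_
      rw [Finset.sum_ite_eq, if_pos hp]
    · ring
  have h4 : (∑ p ∈ S, m p) * (X.card * Y.card) ≤ ∑ p ∈ S, cnt (R p) X Y := by
    rw [Finset.sum_mul]; exact Finset.sum_le_sum hm
  have h5 := mul_le_mul_of_nonneg_right hμ' hXY.le
  have h6 := mul_lt_mul_of_pos_right hs hXY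
  linarith

lemma piR_le (r : ℕ) (hr : 3 ≤ r) : 0 < piR r ∧ piR r ≤ 1 / 2 := by
  have h3 : 3 ≤ r.choose 2 := by
    have := Nat.choose_le_choose 2 hr
    simpa using this
  have h4 : (2:ℝ) ≤ ((r.choose 2 : ℝ) ^ (r.choose 2)) := by
    have h1 : (2:ℝ) ≤ (r.choose 2 : ℝ) := by exact_mod_cast (by omega : 2 ≤ r.choose 2)
    exact h1.trans (le_self_pow₀ (by linarith) (by omega))
  unfold piR
  refine ⟨by positivity, ?_⟩
  rw [one_div]
  exact inv_anti₀ (by norm_num) h4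

theorem upper_bound (r : ℕ) (hr : 3 ≤ r) (F : RGraph r) (hql : QuasiLinear F)
    (hadm : ∀ σ : Fin (2 * r - 2) → Letter, SeqInconsistent r σ → AdmitsSeq F σ)
    (ε : ℝ) (hε : 0 < ε) (H : ℕ → RGraph r) (hH : LocallyDense H (piR r + ε)) :
    ∃ n, IsSubgraph F (H n) := by
  obtain ⟨hpi0, hpi1⟩ := piR_le r hr
  obtain ⟨e, he0, het, hvt, hden⟩ := hH
  set ε0 := min ε (1 / 4) with hε0d
  have hε0 : 0 < ε0 := by rw [hε0d]; positivity
  have hε01 : ε0 ≤ 1 / 4 := min_le_right _ _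
  have hε0ε : ε0 ≤ ε := min_le_left _ _
  set d := piR r + ε0 with hd
  set ε1 := ε0 / 2 with hε1
  have hε1p : 0 < ε1 := by linarith
  set k := r.choose 2 with hk
  have hkpos : 0 < k := Nat.choose_pos (by omega)
  obtain ⟨ε', hε', α, δ, ξ, hα, hα1, hδ, hξ, hsumm⟩ := sum_m k hkpos ε1 hε1p
  obtain ⟨L, hL0, hL⟩ := local_partite r ε1 hε1p (by linarith)
  obtain ⟨M, hM, hfind⟩ := find_sigma r ε' hε' L F.verts.card
  set μ := min 1 (ε' / (4 * (k:ℝ) ^ 2)) with hμd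
  have hμ : 0 < μ := by rw [hμd]; positivity
  have hμ1 : μ ≤ 1 := min_le_left _ _
  have hμ2 : 2 * (k:ℝ) ^ 2 * μ ≤ ε' / 2 := by
    have hkp : (0:ℝ) < 4 * (k:ℝ) ^ 2 := by positivity
    have : μ ≤ ε' / (4 * (k:ℝ) ^ 2) := min_le_right _ _
    rw [le_div_iff₀ hkp] at this
    linarith
  obtain ⟨c, η, hc, hc1, hη, hreach⟩ := master (Fin M) α δ ξ μ hα hδ hξ hμ hμ1 F.edges.card
  -- choose n
  have hMp : (0:ℝ) < M := by exact_mod_cast hM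
  have hev := ((het.eventually (gt_mem_nhds (show (0:ℝ) < min (ε1 / 4) (c / (2 * M)) by
    positivity))).and (hvt.eventually (Filter.eventually_ge_atTop (2 * M)))).exists
  obtain ⟨n, hen, hvn⟩ := hev
  have hen1 : e n ≤ ε1 / 4 := (hen.le).trans (min_le_left _ _)
  have hen2 : e n ≤ c / (2 * M) := (hen.le).trans (min_le_right _ _)
  refine ⟨n, ?_⟩
  set v := (H n).verts.card with hv
  set s0 := v / M with hs0
  have hs0M : M * s0 ≤ v := Nat.mul_div_le v M
  have hs0v : (v:ℝ) ≤ 2 * M * s0 := by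
    have h1 : v < M * s0 + M := by
      have := Nat.div_add_mod v M
      have := Nat.mod_lt v hM
      rw [← hs0] at *
      omega
    have h2 : v ≤ 2 * (M * s0) := by
      have : 2 ≤ s0 := by rw [hs0, Nat.le_div_iff_mul_le hM]; exact hvn
      nlinarith
    calc (v:ℝ) ≤ ((2 * (M * s0) : ℕ) : ℝ) := by exact_mod_cast h2
      _ = _ := by push_cast; ring
  have hs0p : 0 < s0 := Nat.div_pos (by omega) hM
  obtain ⟨V, hVsub, hVc, hVd⟩ := exists_parts M s0 (H n).verts hs0M
  obtain ⟨W, hWV, hind, hembp⟩ := hreach (H n).edges V (fun i => by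
    rw [← Finset.card_pos, hVc]; exact hs0p)
  have hWne : ∀ i, (W i).Nonempty := hWV.nonempty hc (fun i => by
    rw [← Finset.card_pos, hVc]; exact hs0p)
  have hWd : ∀ i j, i ≠ j → Disjoint (W i) (W j) := fun i j hij =>
    (hVd i j hij).mono (hWV i).1 (hWV j).1
  have hWsub : ∀ i, W i ⊆ (H n).verts := fun i => (hWV i).1.trans (hVsub i)
  set s := ⌈c * (s0:ℝ)⌉₊ with hs
  have hs0r : (0:ℝ) < s0 := by exact_mod_cast hs0p
  have hsp : 0 < s := Nat.ceil_pos.2 (by positivity)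
  have hsW : ∀ i, s ≤ (W i).card := by
    intro i
    rw [hs, Nat.ceil_le]
    have := (hWV i).2
    rwa [hVc] at this
  have hdense : IsDense (H n) d (e n) := by
    intro S hS hSc
    refine le_trans ?_ (hden n S hS hSc)
    apply mul_le_mul_of_nonneg_right _ (by positivity)
    linarith
  -- the function m
  have hm : ∀ (t : Finset (Fin M)) (i j : Fin M), ∃ m : ℝ, i ≠ j →
      ∃ G, Stuff (PDind t i j (H n).edges) W α δ ξ η G m := by
    intro t i j
    by_cases hij : i = j
    · exact ⟨0, fun h => absurd hij h⟩
    · obtain ⟨G, m, h⟩ := hind t i j hij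
      exact ⟨m, fun _ => ⟨G, h⟩⟩
  choose m hm using hm
  obtain ⟨σ, hσ, I, hI, hP⟩ := hfind
    (fun t => (piR r + ε1) * vol W ≤ num W (Eh (H n).edges t)) m
    (fun t t' i j => 2 * μ * ((W i).card * (W j).card) ≤ cnt (fun x y =>
      DD (H n).edges t i j W η x y ∧ DD (H n).edges t' i j W η x y) (W i) (W j)) (by
    intro I hI
    obtain ⟨t, ht, hle⟩ := hL (Fin M) (H n) d (e n) W s I (by linarith) (by linarith) hen1 hdense hsp hsW hWd
      hWsub hI (by
        have h1 : e n * v ≤ c / (2 * M) * (2 * M * s0) := by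
          apply mul_le_mul hen2 hs0v (by positivity) (by positivity)
        have h2 : c / (2 * M) * (2 * M * s0) = c * s0 := by field_simp
        rw [h2] at h1
        exact h1.trans (Nat.le_ceil _))
    refine ⟨t, ht, ?_⟩
    have : d - ε1 = piR r + ε1 := by rw [hd, hε1]; ring
    rwa [this] at hle) (by
    intro t i j hij
    obtain ⟨G, hG⟩ := hm t i j hij
    exact ⟨hG.1, hG.m_le_one hα1 hWne⟩) (by
    intro t ht hgood
    set S : Finset (Fin M × Fin M) := (rpairs r).image
      (fun p => (t.orderEmbOfFin ht p.1, t.orderEmbOfFin ht p.2)) with hS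
    have hinj : Set.InjOn (fun p : Fin r × Fin r => (t.orderEmbOfFin ht p.1, t.orderEmbOfFin ht p.2))
        ↑(rpairs r) := by
      rintro ⟨a, b⟩ _ ⟨a', b'⟩ _ h
      simp only [Prod.mk.injEq, EmbeddingLike.apply_eq_iff_eq] at h
      exact Prod.ext h.1 h.2
    have hlt : ∀ p ∈ S, p.1 < p.2 := by
      intro p hp
      obtain ⟨q, hq, rfl⟩ := Finset.mem_image.1 hp
      have : q.1 < q.2 := by simpa [rpairs] using hq
      exact (t.orderEmbOfFin ht).strictMono this
    have := hsumm (Fin M) (H n).edges W η t (fun p => m t p.1 p.2) S hWne (by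
      rw [hS, Finset.card_image_of_injOn hinj, rpairs_card]) (fun p hp => (hlt p hp).ne) (by
      intro p hp q hq hpq
      by_contra hcon
      have l1 := hlt p hp
      have l2 := hlt q hq
      have : p.1 = q.1 ∧ p.2 = q.2 := by
        simp only [Fin.ext_iff, Fin.lt_def, Ne] at *
        omega
      exact hpq (Prod.ext this.1 this.2)) (fun p hp => hm t p.1 p.2 (hlt p hp).ne) hgood
    rw [hS, Finset.sum_image hinj] at this
    exact this) (by
    intro i j hij t hsum
    refine pigeon_apply (rpairs r) (fun p x y => DD (H n).edges (t p) i j W η x y) (W i) (W j)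
      (fun p => m (t p) i j) ε' μ (hWne i) (hWne j) hμ.le (by rw [rpairs_card]; exact hμ2) ?_ hsum
    intro p hp
    obtain ⟨G, hG⟩ := hm (t p) i j hij.ne
    refine (hG.2.2.2 W (Sub.refl hα1 W)).trans ?_
    exact cnt_mono subset_rfl subset_rfl (fun a _ b _ h => h.1))
  obtain ⟨ψ, hψ1, hψ2, hψ3⟩ := embed_F hM F hql σ (hadm σ hσ) μ η (H n).edges W hembp hWd I hI hP
  refine ⟨ψ, hψ1, ?_, hψ3⟩
  intro x hx
  obtain ⟨i, hi⟩ := hψ2 x hx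
  exact hWsub i hi

end P13

section P14
open scoped Classical

variable {k m : ℕ} [NeZero k]

def ip (x y : Fin m → ZMod k) : ZMod k := ∑ i, x i * y i

noncomputable def ff (j : ZMod k) (x y : Fin m → ZMod k) : ℝ := (if ip x y = j then 1 else 0) - 1 / k

lemma ff_abs (j : ZMod k) (x y : Fin m → ZMod k) : |ff j x y| ≤ 1 := by
  have hk : (1:ℝ) ≤ k := by exact_mod_cast NeZero.one_le
  have h1 : 1 / (k:ℝ) ≤ 1 := by rw [div_le_one (by linarith)]; exact hk
  have h0 : 0 ≤ 1 / (k:ℝ) := by positivity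
  unfold ff
  rw [abs_le]
  split_ifs <;> constructor <;> linarith

lemma ip_add_single (x y : Fin m → ZMod k) (i : Fin m) (t : ZMod k) :
    ip x (y + Pi.single i t) = ip x y + x i * t := by
  unfold ip
  simp only [Pi.add_apply, mul_add, Finset.sum_add_distrib]
  congr 1
  rw [Finset.sum_eq_single i]
  · simp
  · intro b _ hb; simp [hb]
  · simp

lemma ff_orth (j : ZMod k) (x x' : Fin m → ZMod k) (i : Fin m) (h1 : x i = 1) (h0 : x' i = 0) :
    ∑ y, ff j x y * ff j x' y = 0 := by
  have hk : (0:ℝ) < k := by exact_mod_cast NeZero.pos k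
  have hshift : ∀ t : ZMod k, ∑ y, ff j x y * ff j x' y =
      ∑ y, ff j x (y + Pi.single i t) * ff j x' y := by
    intro t
    rw [← Equiv.sum_comp (Equiv.addRight (Pi.single i t : Fin m → ZMod k))
      (fun y => ff j x y * ff j x' y)]
    refine Finset.sum_congr rfl fun y _ => ?_
    simp only [Equiv.coe_addRight]
    congr 1
    unfold ff
    rw [ip_add_single, h0, zero_mul, add_zero]
  have hsum : (k:ℝ) * ∑ y, ff j x y * ff j x' y = 0 := by
    have e1 : (k:ℝ) * ∑ y, ff j x y * ff j x' y = ∑ t : ZMod k, ∑ y, ff j x y * ff j x' y := by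
      rw [Finset.sum_const, Finset.card_univ, ZMod.card, nsmul_eq_mul]
    rw [e1, Finset.sum_congr rfl (fun t _ => hshift t), Finset.sum_comm]
    refine Finset.sum_eq_zero fun y _ => ?_
    rw [← Finset.sum_mul]
    have : ∑ t : ZMod k, ff j x (y + Pi.single i t) = 0 := by
      unfold ff
      simp only [ip_add_single, h1, one_mul]
      rw [Finset.sum_sub_distrib, Finset.sum_const, Finset.card_univ, ZMod.card, nsmul_eq_mul]
      have : ∑ t : ZMod k, (if ip x y + t = j then (1:ℝ) else 0) = 1 := by
        rw [Finset.sum_eq_single (j - ip x y)]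
        · simp
        · intro b _ hb
          rw [if_neg]
          intro h; apply hb; rw [← h]; ring
        · simp
      rw [this]; field_simp; norm_num
    rw [this, zero_mul]
  exact (mul_eq_zero.1 hsum).resolve_left hk.ne'

lemma bad_card : ((Finset.univ : Finset ((Fin m → ZMod k) × (Fin m → ZMod k))).filter
    (fun p => ∀ i, ¬ (p.1 i = 1 ∧ p.2 i = 0))).card ≤ (k ^ 2 - 1) ^ m := by
  have h : (Fintype.piFinset (fun _ : Fin m => (Finset.univ : Finset (ZMod k × ZMod k)).erase (1, 0))).card
      = (k ^ 2 - 1) ^ m := by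
    rw [Fintype.card_piFinset]
    simp [Finset.card_erase_of_mem, ZMod.card, sq]
  rw [← h]
  refine Finset.card_le_card_of_injOn (fun p i => (p.1 i, p.2 i)) ?_ ?_
  · intro p hp
    simp only [Finset.coe_filter, Finset.mem_univ, true_and, Set.mem_setOf_eq] at hp
    rw [Finset.mem_coe, Fintype.mem_piFinset]
    intro i
    rw [Finset.mem_erase]
    refine ⟨?_, Finset.mem_univ _⟩
    intro he
    rw [Prod.mk.injEq] at he
    exact hp i he
  · rintro ⟨a, b⟩ _ ⟨c, d⟩ _ hpq
    refine Prod.ext (funext fun i => ?_) (funext fun i => ?_)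
    · exact (Prod.mk.inj (congrFun hpq i)).1
    · exact (Prod.mk.inj (congrFun hpq i)).2

lemma disc_sq (j : ZMod k) (X Y : Finset (Fin m → ZMod k)) :
    (∑ x ∈ X, ∑ y ∈ Y, ff j x y) ^ 2 ≤ ((k:ℝ) ^ m) ^ 2 * ((k ^ 2 - 1 : ℕ) : ℝ) ^ m := by
  have hN : (Fintype.card (Fin m → ZMod k) : ℝ) = (k:ℝ) ^ m := by
    rw [Fintype.card_fun, ZMod.card, Fintype.card_fin]; push_cast; rfl
  have hY : (Y.card : ℝ) ≤ (k:ℝ) ^ m := by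
    rw [← hN]; exact_mod_cast Finset.card_le_univ Y
  have h1 : (∑ x ∈ X, ∑ y ∈ Y, ff j x y) ^ 2 ≤ (Y.card : ℝ) * ∑ y ∈ Y, (∑ x ∈ X, ff j x y) ^ 2 := by
    rw [Finset.sum_comm]
    exact sq_sum_le_card_mul_sum_sq
  have h2 : ∑ y ∈ Y, (∑ x ∈ X, ff j x y) ^ 2 ≤ ∑ y, (∑ x ∈ X, ff j x y) ^ 2 :=
    Finset.sum_le_sum_of_subset_of_nonneg (Finset.subset_univ _) (fun _ _ _ => sq_nonneg _)
  have h3 : ∑ y, (∑ x ∈ X, ff j x y) ^ 2 = ∑ p ∈ X ×ˢ X, ∑ y, ff j p.1 y * ff j p.2 y := by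
    rw [Finset.sum_comm]
    refine Finset.sum_congr rfl fun y _ => ?_
    rw [sq, Finset.sum_mul_sum, Finset.sum_product]
  have h4 : ∑ p ∈ X ×ˢ X, ∑ y, ff j p.1 y * ff j p.2 y ≤
      ∑ p ∈ X ×ˢ X, if ∀ i, ¬ (p.1 i = 1 ∧ p.2 i = 0) then (k:ℝ) ^ m else 0 := by
    refine Finset.sum_le_sum fun p _ => ?_
    split_ifs with h
    · rw [← hN]
      have : ∑ y, ff j p.1 y * ff j p.2 y ≤ ∑ y : Fin m → ZMod k, (1:ℝ) := by
        refine Finset.sum_le_sum fun y _ => ?_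
        refine (le_abs_self _).trans ?_
        rw [abs_mul]
        exact mul_le_one₀ (ff_abs _ _ _) (abs_nonneg _) (ff_abs _ _ _)
      simpa using this
    · push Not at h
      obtain ⟨i, hi1, hi0⟩ := h
      exact (ff_orth j p.1 p.2 i hi1 hi0).le
  have h5 : (∑ p ∈ X ×ˢ X, if ∀ i, ¬ (p.1 i = 1 ∧ p.2 i = 0) then (k:ℝ) ^ m else 0) ≤
      (k:ℝ) ^ m * ((k ^ 2 - 1 : ℕ) : ℝ) ^ m := by
    rw [← Finset.sum_filter, Finset.sum_const, nsmul_eq_mul, mul_comm]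
    refine mul_le_mul_of_nonneg_left ?_ (by positivity)
    have : ((X ×ˢ X).filter (fun p => ∀ i, ¬ (p.1 i = 1 ∧ p.2 i = 0))).card ≤ (k ^ 2 - 1) ^ m :=
      (Finset.card_le_card (Finset.filter_subset_filter _ (Finset.subset_univ _))).trans bad_card
    exact_mod_cast this
  have h6 : ∑ y ∈ Y, (∑ x ∈ X, ff j x y) ^ 2 ≤ (k:ℝ) ^ m * ((k ^ 2 - 1 : ℕ) : ℝ) ^ m := by
    linarith
  calc _ ≤ _ := h1
    _ ≤ (k:ℝ) ^ m * ((k:ℝ) ^ m * ((k ^ 2 - 1 : ℕ) : ℝ) ^ m) :=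
      mul_le_mul hY h6 (Finset.sum_nonneg fun _ _ => sq_nonneg _) (by positivity)
    _ = _ := by ring

lemma exists_colouring (k : ℕ) (hk : 0 < k) (κ : ℝ) (hκ : 0 < κ) :
    ∃ (N : ℕ) (c : ℕ → ℕ → ℕ), 0 < N ∧ ∀ j < k, ∀ X Y : Finset ℕ, X ⊆ Finset.range N →
      Y ⊆ Finset.range N →
      (1 / k) * ((X.card : ℝ) * Y.card) - cnt (fun x y => c x y = j) X Y ≤ κ * (N * N) := by
  haveI : NeZero k := ⟨hk.ne'⟩
  have hk' : (0:ℝ) < k := by exact_mod_cast hk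
  have hq : ((k ^ 2 - 1 : ℕ) : ℝ) / (k:ℝ) ^ 2 < 1 := by
    rw [div_lt_one (by positivity)]
    have : k ^ 2 - 1 < k ^ 2 := Nat.sub_lt (by positivity) one_pos
    exact_mod_cast this
  obtain ⟨m, hm⟩ := exists_pow_lt_of_lt_one (show 0 < κ ^ 2 by positivity) hq
  set N := Fintype.card (Fin m → ZMod k) with hNd
  have hN : (N : ℝ) = (k:ℝ) ^ m := by
    rw [hNd, Fintype.card_fun, ZMod.card, Fintype.card_fin]; push_cast; rfl
  have hN0 : 0 < N := Fintype.card_pos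
  set E := Fintype.equivFin (Fin m → ZMod k) with hE
  set dec : ℕ → (Fin m → ZMod k) := fun u => if h : u < N then E.symm ⟨u, h⟩ else 0 with hdec
  have hdinj : ∀ X ⊆ Finset.range N, Set.InjOn dec ↑X := by
    intro X hX u hu v hv huv
    have h1 := Finset.mem_range.1 (hX hu)
    have h2 := Finset.mem_range.1 (hX hv)
    rw [hdec] at huv
    simp only [h1, h2, dif_pos] at huv
    have := E.symm.injective huv
    rwa [Fin.mk.injEq] at this
  refine ⟨N, fun u v => (ip (dec u) (dec v)).val, hN0, ?_⟩
  intro j hj X Y hX hY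
  have hd := disc_sq (j : ZMod k) (X.image dec) (Y.image dec)
  have hs : ∑ x ∈ X.image dec, ∑ y ∈ Y.image dec, ff (j : ZMod k) x y =
      cnt (fun u v => (ip (dec u) (dec v)).val = j) X Y - (1 / k) * ((X.card : ℝ) * Y.card) := by
    rw [Finset.sum_image (hdinj X hX), cnt_eq_sum]
    have : (1 / (k:ℝ)) * ((X.card : ℝ) * Y.card) = ∑ x ∈ X, ∑ y ∈ Y, (1 / (k:ℝ)) := by
      simp; ring
    rw [this, ← Finset.sum_sub_distrib]
    refine Finset.sum_congr rfl fun x _ => ?_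
    rw [Finset.sum_image (hdinj Y hY), ← Finset.sum_sub_distrib]
    refine Finset.sum_congr rfl fun y _ => ?_
    unfold ff
    have : ip (dec x) (dec y) = (j : ZMod k) ↔ (ip (dec x) (dec y)).val = j := by
      constructor
      · intro h; rw [h, ZMod.val_natCast_of_lt hj]
      · intro h; rw [← h, ZMod.natCast_zmod_val]
    by_cases h : ip (dec x) (dec y) = (j : ZMod k)
    · rw [if_pos h, if_pos (this.1 h)]
    · rw [if_neg h, if_neg (fun h' => h (this.2 h'))]
  rw [hs, ← hN] at hd
  have h7 : ((k ^ 2 - 1 : ℕ) : ℝ) ^ m ≤ κ ^ 2 * N ^ 2 := by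
    rw [div_pow, div_lt_iff₀ (by positivity)] at hm
    rw [hN, ← pow_mul, mul_comm m 2, pow_mul]
    exact hm.le
  have h8 : ((1 / k) * ((X.card : ℝ) * Y.card) -
      cnt (fun u v => (ip (dec u) (dec v)).val = j) X Y) ^ 2 ≤ (κ * (N * N)) ^ 2 := by
    have : (N:ℝ) ^ 2 * ((k ^ 2 - 1 : ℕ) : ℝ) ^ m ≤ N ^ 2 * (κ ^ 2 * N ^ 2) :=
      mul_le_mul_of_nonneg_left h7 (by positivity)
    nlinarith
  exact le_of_abs_le (abs_le_of_sq_le_sq h8 (by positivity))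

end P14

section P15
open scoped Classical

/-- increasing blocks and right colours -/
def LBGood {r : ℕ} (N : ℕ) (c : ℕ → ℕ → ℕ) (code : Fin r × Fin r → ℕ) (w : Fin r → ℕ) : Prop :=
  ∀ a b, a < b → w a / N < w b / N ∧ c (w a % N) (w b % N) = code (a, b)

lemma lb_strictMono {r N : ℕ} {w : Fin r → ℕ} (h : ∀ a b, a < b → w a / N < w b / N) :
    StrictMono w := by
  intro a b hab
  by_contra hcon
  exact absurd (h a b hab) (not_lt.2 (Nat.div_le_div_right (not_lt.1 hcon)))

noncomputable def LBgraph (r N B : ℕ) (c : ℕ → ℕ → ℕ) (code : Fin r × Fin r → ℕ) : RGraph r where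
  verts := Finset.range (B * N)
  edges := ((Finset.range (B * N)).powersetCard r).filter
    (fun e => ∃ w : Fin r → ℕ, Finset.univ.image w = e ∧ LBGood N c code w)
  edges_subset := by
    intro e he
    rw [Finset.mem_filter, Finset.mem_powersetCard] at he
    exact he.1.1
  edges_card := by
    intro e he
    rw [Finset.mem_filter, Finset.mem_powersetCard] at he
    exact he.1.2

lemma lb_rank {φ : ℕ → ℕ} {e : Finset ℕ} (hinj : Set.InjOn φ ↑e) (v : ℕ) :
    (e.filter (fun u => φ u < φ v)).card = ((e.image φ).filter (fun z => z < φ v)).card := by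
  rw [Finset.filter_image, Finset.card_image_of_injOn]
  exact hinj.mono (by intro x hx; exact (Finset.mem_filter.1 hx).1)

lemma lb_free {r N B : ℕ} {c : ℕ → ℕ → ℕ} {code : Fin r × Fin r → ℕ}
    (hcode : Set.InjOn code ↑(rpairs r)) (F : RGraph r) (hinc : ¬ Consistent F) :
    ¬ IsSubgraph F (LBgraph r N B c code) := by
  rintro ⟨φ, hφ, -, hed⟩
  apply hinc
  refine ⟨φ, hφ, ?_⟩
  rintro e f ⟨he, hf, hne, hcard⟩
  have he1 := (Finset.mem_filter.1 (hed e he)).2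
  have hf1 := (Finset.mem_filter.1 (hed f hf)).2
  obtain ⟨w, hw, hwg⟩ := he1
  obtain ⟨w', hw', hwg'⟩ := hf1
  have hm : StrictMono w := lb_strictMono (fun a b hab => (hwg a b hab).1)
  have hm' : StrictMono w' := lb_strictMono (fun a b hab => (hwg' a b hab).1)
  have hie : Set.InjOn φ ↑e := hφ.mono (by exact_mod_cast F.edges_subset e he)
  have hif : Set.InjOn φ ↑f := hφ.mono (by exact_mod_cast F.edges_subset f hf)
  have rk : ∀ x ∈ e, ∃ a, φ x = w a := by
    intro x hx
    have : φ x ∈ Finset.univ.image w := by rw [hw]; exact Finset.mem_image_of_mem _ hx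
    obtain ⟨a, -, ha⟩ := Finset.mem_image.1 this
    exact ⟨a, ha.symm⟩
  have rk' : ∀ x ∈ f, ∃ a, φ x = w' a := by
    intro x hx
    have : φ x ∈ Finset.univ.image w' := by rw [hw']; exact Finset.mem_image_of_mem _ hx
    obtain ⟨a, -, ha⟩ := Finset.mem_image.1 this
    exact ⟨a, ha.symm⟩
  have r1 : ∀ x a, φ x = w a → (e.filter (fun u => φ u < φ x)).card = a := by
    intro x a hx
    rw [lb_rank hie, hx, ← hw, rank_emb w hm a]
  have r2 : ∀ x a, φ x = w' a → (f.filter (fun u => φ u < φ x)).card = a := by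
    intro x a hx
    rw [lb_rank hif, hx, ← hw', rank_emb w' hm' a]
  have key : ∀ x y, x ∈ e ∩ f → y ∈ e ∩ f → φ x < φ y →
      (e.filter (fun u => φ u < φ x)).card = (f.filter (fun u => φ u < φ x)).card ∧
      (e.filter (fun u => φ u < φ y)).card = (f.filter (fun u => φ u < φ y)).card := by
    intro x y hx hy hxy
    rw [Finset.mem_inter] at hx hy
    obtain ⟨a, ha⟩ := rk x hx.1
    obtain ⟨b, hb⟩ := rk y hy.1
    obtain ⟨a', ha'⟩ := rk' x hx.2
    obtain ⟨b', hb'⟩ := rk' y hy.2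
    have hab : a < b := by rw [ha, hb] at hxy; exact hm.lt_iff_lt.1 hxy
    have hab' : a' < b' := by rw [ha', hb'] at hxy; exact hm'.lt_iff_lt.1 hxy
    have h1 := (hwg a b hab).2
    have h2 := (hwg' a' b' hab').2
    rw [← ha, ← hb] at h1
    rw [← ha', ← hb', h1] at h2
    have h3 := hcode (by simp [rpairs, hab]) (by simp [rpairs, hab']) h2
    rw [Prod.mk.injEq] at h3
    rw [r1 x a ha, r1 y b hb, r2 x a' ha', r2 y b' hb', h3.1, h3.2]
    exact ⟨rfl, rfl⟩
  have hall : ∀ x ∈ e ∩ f,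
      (e.filter (fun u => φ u < φ x)).card = (f.filter (fun u => φ u < φ x)).card := by
    intro x hx
    obtain ⟨y, hy, hyx⟩ := Finset.exists_mem_ne (by omega : 1 < (e ∩ f).card) x
    have : φ x ≠ φ y := fun h => hyx (hie (Finset.mem_inter.1 hx).1 (Finset.mem_inter.1 hy).1 h).symm
    rcases lt_or_gt_of_ne this with h | h
    · exact (key x y hx hy h).1
    · exact (key y x hy hx h).2
  unfold role
  ext z
  simp only [Finset.mem_image]
  constructor
  · rintro ⟨x, hx, rfl⟩
    exact ⟨x, hx, by rw [hall x hx]⟩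
  · rintro ⟨x, hx, rfl⟩
    exact ⟨x, hx, by rw [hall x hx]⟩

def blk (N : ℕ) (S : Finset ℕ) (b : ℕ) : Finset ℕ := S.filter (fun v => v / N = b)

lemma lb_count {r N B : ℕ} (c : ℕ → ℕ → ℕ) (code : Fin r × Fin r → ℕ) (S : Finset ℕ)
    (hS : S ⊆ Finset.range (B * N)) :
    ∑ β ∈ (Fintype.piFinset (fun _ : Fin r => Finset.range B)).filter StrictMono,
      num (fun a => blk N S (β a)) (fun x => ∀ p ∈ rpairs r, c (x p.1 % N) (x p.2 % N) = code p) ≤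
    (((LBgraph r N B c code).edges.filter (fun e => e ⊆ S)).card : ℝ) := by
  obtain ⟨T, hT⟩ : ∃ T, T = (Fintype.piFinset (fun _ : Fin r => S)).filter (LBGood N c code) :=
    ⟨_, rfl⟩
  have h1 : T.card ≤ ((LBgraph r N B c code).edges.filter (fun e => e ⊆ S)).card := by
    apply Finset.card_le_card_of_injOn (fun w => Finset.univ.image w)
    · intro w hw
      rw [hT] at hw
      have hw := Finset.mem_filter.1 hw
      have hwS := Fintype.mem_piFinset.1 hw.1
      have hm : StrictMono w := lb_strictMono (fun a b hab => (hw.2 a b hab).1)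
      have hsub : Finset.univ.image w ⊆ S := by
        intro z hz
        obtain ⟨a, -, rfl⟩ := Finset.mem_image.1 hz
        exact hwS a
      refine Finset.mem_filter.2 ⟨Finset.mem_filter.2 ⟨Finset.mem_powersetCard.2
        ⟨hsub.trans hS, ?_⟩, w, rfl, hw.2⟩, hsub⟩
      rw [Finset.card_image_of_injective _ hm.injective]; simp
    · intro w hw w' hw' h
      rw [hT] at hw hw'
      have hw := (Finset.mem_filter.1 hw).2
      have hw' := (Finset.mem_filter.1 hw').2
      have hm : StrictMono w := lb_strictMono (fun a b hab => (hw a b hab).1)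
      have hm' : StrictMono w' := lb_strictMono (fun a b hab => (hw' a b hab).1)
      refine (StrictMono.range_inj hm hm').1 ?_
      have := congrArg (fun s : Finset ℕ => (s : Set ℕ)) h
      simpa using this
  have h2 : T.card = ∑ β ∈ (Fintype.piFinset (fun _ : Fin r => Finset.range B)).filter StrictMono,
      (T.filter (fun w => (fun a => w a / N) = β)).card := by
    apply Finset.card_eq_sum_card_fiberwise
    intro w hw
    rw [hT] at hw
    have hw := Finset.mem_filter.1 hw
    have hwS := Fintype.mem_piFinset.1 hw.1
    refine Finset.mem_filter.2 ⟨Fintype.mem_piFinset.2 fun a => ?_, fun a b hab => (hw.2 a b hab).1⟩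
    have := Finset.mem_range.1 (hS (hwS a))
    exact Finset.mem_range.2 (Nat.div_lt_of_lt_mul (by rwa [mul_comm]))
  have h3 : ((T.card : ℕ) : ℝ) ≤ _ := Nat.cast_le.2 h1
  refine le_trans ?_ h3
  rw [h2]
  push_cast
  refine Finset.sum_le_sum fun β hβ => ?_
  have hβ := (Finset.mem_filter.1 hβ).2
  unfold num
  norm_cast
  apply Finset.card_le_card
  intro x hx
  simp only [Finset.mem_filter] at hx
  have hx1 := Fintype.mem_piFinset.1 hx.1
  have hx2 : ∀ a, x a ∈ S ∧ x a / N = β a := fun a => Finset.mem_filter.1 (hx1 a)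
  rw [hT]
  refine Finset.mem_filter.2 ⟨Finset.mem_filter.2 ⟨Fintype.mem_piFinset.2 fun a => (hx2 a).1, ?_⟩, ?_⟩
  · intro a b hab
    refine ⟨by rw [(hx2 a).2, (hx2 b).2]; exact hβ hab, hx.2 (a, b) (by simp [rpairs, hab])⟩
  · funext a; exact (hx2 a).2

lemma lb_cross {r N B : ℕ} (hN : 0 < N) (hr : 2 ≤ r) (S : Finset ℕ)
    (hS : S ⊆ Finset.range (B * N)) :
    S.card.choose r ≤ (∑ β ∈ (Fintype.piFinset (fun _ : Fin r => Finset.range B)).filter StrictMono,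
      (Fintype.piFinset (fun a => blk N S (β a))).card) + (B * N * N) * (B * N) ^ (r - 2) := by
  rw [← Finset.card_powersetCard r S,
    ← Finset.card_filter_add_card_filter_not (s := S.powersetCard r)
      (fun e => Set.InjOn (fun v => v / N) (e : Set ℕ))]
  apply Nat.add_le_add
  · rw [← Finset.card_sigma]
    apply Finset.card_le_card_of_surjOn
      (fun z : (Σ _ : Fin r → ℕ, Fin r → ℕ) => Finset.univ.image z.2)
    intro e he
    have he := Finset.mem_filter.1 he
    obtain ⟨⟨h1, h2⟩, h3⟩ := And.intro (Finset.mem_powersetCard.1 he.1) he.2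
    obtain ⟨w, hw⟩ : ∃ w : Fin r → ℕ, w = e.orderEmbOfFin h2 := ⟨_, rfl⟩
    have hwm : ∀ a, w a ∈ e := by intro a; rw [hw]; exact Finset.orderEmbOfFin_mem e h2 a
    have hws : StrictMono w := by rw [hw]; exact (e.orderEmbOfFin h2).strictMono
    refine ⟨⟨fun a => w a / N, w⟩, Finset.mem_coe.2 (Finset.mem_sigma.2 ⟨Finset.mem_filter.2
      ⟨Fintype.mem_piFinset.2 fun a => ?_, ?_⟩, Fintype.mem_piFinset.2 fun a => ?_⟩), ?_⟩
    · have := Finset.mem_range.1 (hS (h1 (hwm a)))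
      exact Finset.mem_range.2 (Nat.div_lt_of_lt_mul (by rwa [mul_comm]))
    · intro a b hab
      refine lt_of_le_of_ne (Nat.div_le_div_right (hws hab).le) fun h => ?_
      exact (hws hab).ne (h3 (hwm a) (hwm b) h)
    · exact Finset.mem_filter.2 ⟨h1 (hwm a), rfl⟩
    · rw [hw]
      simp
  · have hc : (((Finset.range (B * N)) ×ˢ (Finset.range N)) ×ˢ
        (Finset.range (B * N)).powersetCard (r - 2)).card ≤ (B * N * N) * (B * N) ^ (r - 2) := by
      rw [Finset.card_product, Finset.card_product, Finset.card_powersetCard, Finset.card_range,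
        Finset.card_range]
      exact Nat.mul_le_mul_left _ (Nat.choose_le_pow _ _)
    refine le_trans ?_ hc
    apply Finset.card_le_card_of_surjOn
      (fun z : (ℕ × ℕ) × Finset ℕ => insert z.1.1 (insert (z.1.1 / N * N + z.1.2) z.2))
    intro e he
    have he := Finset.mem_filter.1 he
    obtain ⟨⟨h1, h2⟩, h3⟩ := And.intro (Finset.mem_powersetCard.1 he.1) he.2
    simp only [Set.InjOn, not_forall] at h3
    obtain ⟨u, hu, v, hv, huv, hne⟩ := h3
    refine ⟨((u, v % N), (e.erase u).erase v), Finset.mem_coe.2 (Finset.mem_product.2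
      ⟨Finset.mem_product.2 ⟨hS (h1 hu), Finset.mem_range.2 (Nat.mod_lt _ hN)⟩,
      Finset.mem_powersetCard.2 ⟨?_, ?_⟩⟩), ?_⟩
    · exact (Finset.erase_subset _ _).trans ((Finset.erase_subset _ _).trans (h1.trans hS))
    · rw [Finset.card_erase_of_mem (Finset.mem_erase.2 ⟨fun h => hne h.symm, hv⟩),
        Finset.card_erase_of_mem hu, h2]; omega
    · have : u / N * N + v % N = v := by rw [huv, mul_comm]; exact Nat.div_add_mod v N
      simp only [this]
      rw [Finset.insert_erase (Finset.mem_erase.2 ⟨fun h => hne h.symm, hv⟩), Finset.insert_erase hu]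

lemma blk_card {N : ℕ} (hN : 0 < N) (X : Finset ℕ) (b : ℕ) (hX : ∀ v ∈ X, v / N = b) :
    Set.InjOn (fun v => v % N) (X : Set ℕ) ∧ X.image (fun v => v % N) ⊆ Finset.range N ∧
    (X.image (fun v => v % N)).card = X.card := by
  have h1 : Set.InjOn (fun v => v % N) (X : Set ℕ) := by
    intro u hu v hv h
    have hu := hX u hu
    have hv := hX v hv
    rw [← Nat.div_add_mod u N, ← Nat.div_add_mod v N, hu, hv]
    simp only at h
    rw [h]
  refine ⟨h1, ?_, Finset.card_image_of_injOn h1⟩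
  intro z hz
  obtain ⟨v, -, rfl⟩ := Finset.mem_image.1 hz
  exact Finset.mem_range.2 (Nat.mod_lt _ hN)

lemma cnt_image {N : ℕ} (R : ℕ → ℕ → Prop) (X Y : Finset ℕ)
    (hX : Set.InjOn (fun v => v % N) (X : Set ℕ)) (hY : Set.InjOn (fun v => v % N) (Y : Set ℕ)) :
    cnt R (X.image (fun v => v % N)) (Y.image (fun v => v % N)) =
      cnt (fun u v => R (u % N) (v % N)) X Y := by
  rw [cnt_eq_sum, cnt_eq_sum, Finset.sum_image hX]
  exact Finset.sum_congr rfl fun x _ => Finset.sum_image hY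

lemma lb_block {r N : ℕ} (hN : 0 < N) (κ : ℝ) (hκ : 0 ≤ κ) (hr : 3 ≤ r)
    (c : ℕ → ℕ → ℕ) (code : Fin r × Fin r → ℕ) (hcode : ∀ p ∈ rpairs r, code p < r.choose 2)
    (hc : ∀ j < r.choose 2, ∀ X Y : Finset ℕ, X ⊆ Finset.range N → Y ⊆ Finset.range N →
      (1 / (r.choose 2 : ℕ)) * ((X.card : ℝ) * Y.card) - cnt (fun x y => c x y = j) X Y ≤ κ * (N * N))
    (S : Finset ℕ) (β : Fin r → ℕ) :
    piR r * ((Fintype.piFinset (fun a => blk N S (β a))).card : ℝ) -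
      (r.choose 2 : ℕ) * (κ * (N:ℝ) ^ r) ≤
    num (fun a => blk N S (β a)) (fun x => ∀ p ∈ rpairs r, c (x p.1 % N) (x p.2 % N) = code p) := by
  have hk : 0 < r.choose 2 := Nat.choose_pos (by omega)
  have hk' : (1:ℝ) ≤ (r.choose 2 : ℕ) := by exact_mod_cast hk
  have hb : ∀ a, ∀ X ⊆ blk N S (β a), ∀ v ∈ X, v / N = β a := by
    intro a X hX v hv
    exact (Finset.mem_filter.1 (hX hv)).2
  have hlt : ∀ p ∈ rpairs r, p.1 < p.2 := by
    intro p hp; simpa [rpairs] using hp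
  have := telescope (fun a => blk N S (β a)) (fun _ => (N:ℝ)) (by
      intro a
      obtain ⟨-, h2, h3⟩ := blk_card hN (blk N S (β a)) (β a) (hb a _ subset_rfl)
      have := Finset.card_le_card h2
      rw [h3, Finset.card_range] at this
      exact_mod_cast this) (-1) κ hκ (fun _ => 1 / (r.choose 2 : ℕ))
    (fun p u v => c (u % N) (v % N) = code p) (rpairs r) (by intros; positivity)
    (by intros; exact (div_le_one (by positivity)).2 hk') (fun p hp => (hlt p hp).ne) (by
      intro p hp q hq hpq
      by_contra hcon
      have l1 := hlt p hp
      have l2 := hlt q hq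
      have : p.1 = q.1 ∧ p.2 = q.2 := by
        simp only [Fin.ext_iff, Fin.lt_def, Ne] at *
        omega
      exact hpq (Prod.ext this.1 this.2)) (by
      intro p hp X Y hX hY
      obtain ⟨a1, a2, a3⟩ := blk_card hN X (β p.1) (hb _ _ hX)
      obtain ⟨b1, b2, b3⟩ := blk_card hN Y (β p.2) (hb _ _ hY)
      have := hc (code p) (hcode p hp) _ _ a2 b2
      rw [a3, b3, cnt_image _ _ _ a1 b1] at this
      linarith)
  rw [Finset.prod_const, Finset.prod_const, rpairs_card, Finset.card_univ, Fintype.card_fin,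
    vol_eq] at this
  have hp : (1 / ((r.choose 2 : ℕ) : ℝ)) ^ (r.choose 2) = piR r := by
    unfold piR; rw [one_div, inv_pow]
  rw [hp] at this
  linarith

lemma lb_dense (r : ℕ) (hr : 3 ≤ r) (F : RGraph r) (hinc : ¬ Consistent F) (ε : ℝ) (hε : 0 < ε)
    (n0 : ℕ) : ∃ H : RGraph r, n0 ≤ H.verts.card ∧ ¬ IsSubgraph F H ∧ IsDense H (piR r) ε := by
  have hk : 0 < r.choose 2 := Nat.choose_pos (by omega)
  have hk' : (1:ℝ) ≤ (r.choose 2 : ℕ) := by exact_mod_cast hk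
  obtain ⟨θ, hθd⟩ : ∃ θ : ℝ, θ = ε * (ε / 2) ^ r / (r.factorial : ℝ) := ⟨_, rfl⟩
  have hf : (0:ℝ) < r.factorial := by exact_mod_cast r.factorial_pos
  have hθ : 0 < θ := by rw [hθd]; positivity
  obtain ⟨κ, hκd⟩ : ∃ κ : ℝ, κ = θ / (2 * (r.choose 2 : ℕ)) := ⟨_, rfl⟩
  have hκ : 0 < κ := by rw [hκd]; positivity
  obtain ⟨N, c, hN, hc⟩ := exists_colouring (r.choose 2) hk κ hκ
  obtain ⟨B, hB⟩ := exists_nat_ge (max (2 / θ) (max (n0 : ℝ) (max (2 * r / ε) 1)))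
  have hB1 : 2 / θ ≤ B := le_trans (le_max_left _ _) hB
  have hB2 : (n0:ℝ) ≤ B := le_trans (le_trans (le_max_left _ _) (le_max_right _ _)) hB
  have hB3 : 2 * r / ε ≤ B := le_trans (le_trans (le_trans (le_max_left _ _) (le_max_right _ _))
    (le_max_right _ _)) hB
  have hB4 : 1 ≤ (B:ℝ) := le_trans (le_trans (le_trans (le_max_right _ _) (le_max_right _ _))
    (le_max_right _ _)) hB
  have e := (rpairs r).equivFin
  obtain ⟨code, hcoded⟩ : ∃ code : Fin r × Fin r → ℕ,
      code = fun p => if h : p ∈ rpairs r then (e ⟨p, h⟩ : ℕ) else 0 := ⟨_, rfl⟩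
  have hcode1 : Set.InjOn code ↑(rpairs r) := by
    intro p hp q hq h
    have hp : p ∈ rpairs r := hp
    have hq : q ∈ rpairs r := hq
    rw [hcoded] at h
    simp only [hp, hq, dif_pos] at h
    have := e.injective (Fin.ext h)
    exact congrArg Subtype.val this
  have hcode2 : ∀ p ∈ rpairs r, code p < r.choose 2 := by
    intro p hp
    rw [hcoded, ← rpairs_card]
    simp only [hp, dif_pos]
    exact (e ⟨p, hp⟩).2
  refine ⟨LBgraph r N B c code, ?_, lb_free hcode1 F hinc, ?_⟩
  · have h1 : n0 ≤ B := by exact_mod_cast hB2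
    show n0 ≤ (Finset.range (B * N)).card
    rw [Finset.card_range]
    nlinarith
  · intro S hS hcard
    have hS : S ⊆ Finset.range (B * N) := hS
    have hcard : ε * ((Finset.range (B * N)).card : ℝ) ≤ S.card := hcard
    rw [Finset.card_range] at hcard
    have hN1 : (1:ℝ) ≤ N := by exact_mod_cast hN
    obtain ⟨n, hn⟩ : ∃ n : ℝ, n = B * N := ⟨_, rfl⟩
    push_cast at hcard
    rw [← hn] at hcard
    have hn0 : 0 < n := by rw [hn]; positivity
    obtain ⟨Q, hQ⟩ : ∃ Q, Q = (Fintype.piFinset (fun _ : Fin r => Finset.range B)).filter StrictMono :=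
      ⟨_, rfl⟩
    have hcount := lb_count (r := r) (N := N) (B := B) c code S hS
    have hcross := lb_cross (r := r) (N := N) (B := B) hN (by omega) S hS
    rw [← hQ] at hcount hcross
    have hsum : ∑ β ∈ Q, (piR r * ((Fintype.piFinset (fun a => blk N S (β a))).card : ℝ) -
      (r.choose 2 : ℕ) * (κ * (N:ℝ) ^ r)) ≤ _ :=
      le_trans (Finset.sum_le_sum fun β _ => lb_block hN κ hκ.le hr c code hcode2 hc S β) hcount
    rw [Finset.sum_sub_distrib, ← Finset.mul_sum, Finset.sum_const, nsmul_eq_mul] at hsum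
    have hQc : (Q.card : ℝ) ≤ (B:ℝ) ^ r := by
      have : Q.card ≤ B ^ r := by
        rw [hQ]
        refine (Finset.card_filter_le _ _).trans ?_
        rw [Fintype.card_piFinset]; simp
      exact_mod_cast this
    have hcross' : (S.card.choose r : ℝ) ≤
        ∑ β ∈ Q, ((Fintype.piFinset (fun a => blk N S (β a))).card : ℝ) +
          (n * N) * n ^ (r - 2) := by
      rw [hn]; exact_mod_cast hcross
    obtain ⟨V, hV⟩ : ∃ V, V = ∑ β ∈ Q, ((Fintype.piFinset (fun a => blk N S (β a))).card : ℝ) :=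
      ⟨_, rfl⟩
    rw [← hV] at hsum hcross'
    have e1 : (n * N) * n ^ (r - 2) ≤ θ / 2 * n ^ r := by
      have : n ^ r = n * n * n ^ (r - 2) := by
        rw [← pow_two, ← pow_add]; congr 1; omega
      rw [this]
      have h2 : 2 ≤ B * θ := by rwa [div_le_iff₀ hθ] at hB1
      have h3 : (N:ℝ) ≤ θ / 2 * n := by
        rw [hn]
        nlinarith
      have h4 : n * N ≤ n * (θ / 2 * n) := mul_le_mul_of_nonneg_left h3 hn0.le
      calc (n * N) * n ^ (r - 2) ≤ (n * (θ / 2 * n)) * n ^ (r - 2) :=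
            mul_le_mul_of_nonneg_right h4 (by positivity)
        _ = _ := by ring
    have e2 : (Q.card : ℝ) * ((r.choose 2 : ℕ) * (κ * (N:ℝ) ^ r)) ≤ θ / 2 * n ^ r := by
      have h1 : ((r.choose 2 : ℕ) : ℝ) * (κ * (N:ℝ) ^ r) = θ / 2 * (N:ℝ) ^ r := by
        rw [hκd]; field_simp
      rw [h1, hn, mul_pow]
      calc (Q.card : ℝ) * (θ / 2 * (N:ℝ) ^ r) ≤ (B:ℝ) ^ r * (θ / 2 * (N:ℝ) ^ r) :=
            mul_le_mul_of_nonneg_right hQc (by positivity)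
        _ = _ := by ring
    have e3 : θ * n ^ r ≤ ε * (S.card.choose r : ℝ) := by
      have hSr : 2 * (r:ℝ) ≤ S.card := by
        have h1 : 2 * (r:ℝ) ≤ ε * B := by rw [div_le_iff₀ hε] at hB3; linarith
        have h2 : ε * B ≤ ε * n := by
          apply mul_le_mul_of_nonneg_left _ hε.le
          rw [hn]; nlinarith
        linarith
      have hSr' : 2 * r ≤ S.card := by exact_mod_cast hSr
      have h1 := Nat.pow_sub_le_descFactorial S.card r
      rw [Nat.descFactorial_eq_factorial_mul_choose] at h1
      have h2 : (((S.card + 1 - r : ℕ) : ℝ)) ^ r ≤ r.factorial * (S.card.choose r : ℝ) := by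
        exact_mod_cast h1
      have h3 : ε / 2 * n ≤ ((S.card + 1 - r : ℕ) : ℝ) := by
        rw [Nat.cast_sub (by omega)]
        push_cast
        linarith
      have h4 : (ε / 2 * n) ^ r ≤ r.factorial * (S.card.choose r : ℝ) :=
        (pow_le_pow_left₀ (by positivity) h3 r).trans h2
      rw [hθd, div_mul_eq_mul_div, div_le_iff₀ hf]
      rw [mul_pow] at h4
      have := mul_le_mul_of_nonneg_left h4 hε.le
      linarith
    have hp := piR_le r hr
    have hC : piR r * (S.card.choose r : ℝ) ≤ piR r * (V + θ / 2 * n ^ r) :=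
      mul_le_mul_of_nonneg_left (by linarith) hp.1.le
    have hx : piR r * (θ / 2 * n ^ r) ≤ θ / 2 * n ^ r := by
      have : 0 ≤ θ / 2 * n ^ r := by positivity
      nlinarith [hp.2]
    have hfin : (piR r - ε) * (S.card.choose r : ℝ) ≤
        (((LBgraph r N B c code).edges.filter (fun e => e ⊆ S)).card : ℝ) := by
      refine le_trans ?_ hsum
      nlinarith
    convert hfin

lemma lower_bound (r : ℕ) (hr : 3 ≤ r) (F : RGraph r) (hinc : ¬ Consistent F) :
    ∃ H : ℕ → RGraph r, LocallyDense H (piR r) ∧ ∀ n, ¬ IsSubgraph F (H n) := by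
  have h : ∀ n : ℕ, ∃ H : RGraph r, n ≤ H.verts.card ∧ ¬ IsSubgraph F H ∧
      IsDense H (piR r) (1 / ((n:ℝ) + 1)) := fun n =>
    lb_dense r hr F hinc _ (by positivity) n
  choose H h1 h2 h3 using h
  refine ⟨H, ⟨fun n => 1 / ((n:ℝ) + 1), fun n => by positivity,
    tendsto_one_div_add_atTop_nhds_zero_nat, ?_, h3⟩, h2⟩
  exact Filter.tendsto_atTop_mono h1 Filter.tendsto_id

end P15

/-- any quasi-linear, inconsistent r-graph admitting all inconsistent
descriptive sequences of order r has uniform Turán density `C(r,2) ^ (-C(r,2))`. -/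
theorem uniform_turan_density_eq_piR (r : ℕ) (hr : 3 ≤ r) (F : RGraph r)
    (hql : QuasiLinear F) (hinc : ¬ Consistent F)
    (hadm : ∀ σ : Fin (2 * r - 2) → Letter, SeqInconsistent r σ → AdmitsSeq F σ) :
    (∃ H : ℕ → RGraph r, LocallyDense H (piR r) ∧ ∀ n, ¬ IsSubgraph F (H n)) ∧
    ∀ ε : ℝ, 0 < ε → ∀ H : ℕ → RGraph r, LocallyDense H (piR r + ε) →
      ∃ n, IsSubgraph F (H n) := by
  exact ⟨lower_bound r hr F hinc, fun ε hε H hH => upper_bound r hr F hql hadm ε hε H hH⟩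

end UTD
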